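/- Let C be a smooth connected projective complex curve of genus g which is non-hyperelliptic, non-trigonal, and not a smooth plane quintic. Then there exists a divisor D of degree g-1 on C such that both |D| and |K(-D)| are base-point-free pencils, where K is the canonical class. -/

import Mathlib

open TensorProduct Function

noncomputable section


/-!  ### Graded algebras presented by their components

An ℕ-graded algebra `R = ⊕ₙ Rₙ` over a field `k` (with `R₀ = k`) is presented here through
its graded components, realized as `k`-subspaces `piece n` of an ambient `k`-algebra `A`,
with `1 ∈ piece 0` and `piece m * piece n ⊆ piece (m + n)`.  All notions below (Koszulness,
quadraticity) depend only on the components and the componentwise multiplication maps. -/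
structure GradedSystem (k A : Type) [Field k] [Ring A] [Algebra k A] where
  piece : ℕ → Submodule k A
  one_mem : (1 : A) ∈ piece 0
  mul_mem : ∀ {m n : ℕ} {x y : A}, x ∈ piece m → y ∈ piece n → x * y ∈ piece (m + n)

namespace GradedSystem

variable {k A : Type} [Field k] [Ring A] [Algebra k A] (S : GradedSystem k A)

/-- The componentwise multiplication map `Rₘ ⊗ Rₙ → R_{m+n}`. -/
def mulMap (m n : ℕ) : S.piece m →ₗ[k] S.piece n →ₗ[k] S.piece (m + n) :=
  LinearMap.mk₂ k (fun x y => ⟨(x : A) * (y : A), S.mul_mem x.2 y.2⟩)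
    (fun x x' y => Subtype.ext (by simp [add_mul]))
    (fun c x y => Subtype.ext (by simp [smul_mul_assoc]))
    (fun x y y' => Subtype.ext (by simp [mul_add]))
    (fun c x y => Subtype.ext (by simp [mul_smul_comm]))

/-- Transport of a graded component along an equality of degrees. -/
def cast {m n : ℕ} (h : m = n) : (S.piece m : Type) ≃ₗ[k] S.piece n :=
  LinearEquiv.ofEq _ _ (by rw [h])

/-- The degree-`d` component of the differential
`V_{i+1} ⊗ R(-(i+1)) → V_i ⊗ R(-i)` of a complex of free graded (right) `R`-modules with
`V_i = k^{n i}` generated in degree `i`; the differential is encoded by its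
restriction `φ i : V_{i+1} → V_i ⊗ R₁` to the generators (a "matrix of linear forms").
The degree-`(i+1+d)` component of the map is `V_{i+1} ⊗ R_d → V_i ⊗ R_{d+1}`. -/
def Dmap (n : ℕ → ℕ)
    (φ : ∀ i : ℕ, (Fin (n (i + 1)) → k) →ₗ[k] ((Fin (n i) → k) ⊗[k] S.piece 1))
    (i d : ℕ) :
    ((Fin (n (i + 1)) → k) ⊗[k] S.piece d) →ₗ[k] ((Fin (n i) → k) ⊗[k] S.piece (d + 1)) :=
  (LinearMap.lTensor (Fin (n i) → k)
      ((S.cast (add_comm 1 d)).toLinearMap ∘ₗ TensorProduct.lift (S.mulMap 1 d))) ∘ₗ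
    (TensorProduct.assoc k (Fin (n i) → k) (S.piece 1) (S.piece d)).toLinearMap ∘ₗ
    (LinearMap.rTensor (S.piece d) (φ i))

/-- `S` is connected: the degree-zero component is spanned by the unit, i.e. `R₀ = k`. -/
def ConnectedOne : Prop := S.piece 0 = Submodule.span k {(1 : A)}

/-- `S` is a *Koszul algebra*: `R₀ = k` and the trivial module `k` admits a linear free
resolution `⋯ → V₂ ⊗ R(-2) → V₁ ⊗ R(-1) → R → k → 0` (this is one of the standard
equivalent definitions of Koszulness: `Extⁿ(k, k(-m)) = 0` for `n ≠ m`).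
Exactness is expressed by its graded components: surjectivity of `V₁ ⊗ R_d → R_{d+1}`
(exactness at `R` in positive degrees), injectivity of `V_{i+1} ⊗ R₀ → V_i ⊗ R₁`
(exactness in the lowest degree at each spot), and `range = ker` elsewhere. -/
def IsKoszul : Prop :=
  S.ConnectedOne ∧
  ∃ (n : ℕ → ℕ)
    (φ : ∀ i : ℕ, (Fin (n (i + 1)) → k) →ₗ[k] ((Fin (n i) → k) ⊗[k] S.piece 1)),
    n 0 = 1 ∧
    (∀ d : ℕ, Surjective (S.Dmap n φ 0 d)) ∧
    (∀ i : ℕ, Injective (S.Dmap n φ i 0)) ∧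
    (∀ i d : ℕ, LinearMap.range (S.Dmap n φ (i + 1) d) = LinearMap.ker (S.Dmap n φ i (d + 1)))

/-- `S` is a *quadratic algebra*: `R₀ = k`, `R` is generated by `R₁` and its relations are
generated in degree `2`; equivalently there is an exact sequence
`V₂ ⊗ R(-2) → V₁ ⊗ R(-1) → R → k → 0` (exact at `V₁ ⊗ R(-1)` and at `R`). -/
def IsQuadratic : Prop :=
  S.ConnectedOne ∧
  ∃ (n : ℕ → ℕ)
    (φ : ∀ i : ℕ, (Fin (n (i + 1)) → k) →ₗ[k] ((Fin (n i) → k) ⊗[k] S.piece 1)),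
    n 0 = 1 ∧
    (∀ d : ℕ, Surjective (S.Dmap n φ 0 d)) ∧
    Injective (S.Dmap n φ 0 0) ∧
    (∀ d : ℕ, LinearMap.range (S.Dmap n φ 1 d) = LinearMap.ker (S.Dmap n φ 0 (d + 1)))

end GradedSystem

/-- For `m = 1`, the canonical identification `(k^m) ⊗ M ≃ M`. -/
def oneTensorEquiv {k : Type} [Field k] {m : ℕ} (h : m = 1) (M : Type)
    [AddCommGroup M] [Module k M] : ((Fin m → k) ⊗[k] M) ≃ₗ[k] M :=
  (TensorProduct.congr
      ((LinearEquiv.funCongrLeft k k (finCongr h.symm)).trans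
        (LinearEquiv.funUnique (Fin 1) k k))
      (LinearEquiv.refl k M)).trans (TensorProduct.lid k M)


/-!  ### Smooth connected projective complex curves

A smooth connected projective curve over `ℂ` is (equivalently) presented through its
function field `F` — a finitely generated extension of `ℂ` of transcendence degree 1 —
together with its set of points (= places of `F/ℂ`), each point giving an
order-of-vanishing valuation `ord P : F → ℤ`.  Divisors are finitely supported `ℤ`-valued
functions on points, and `H⁰(C, O(D))` is the Riemann–Roch space of `D`. -/
structure PreCurve where
  /-- the function field of the curve -/
  F : Type
  [fieldF : Field F]
  [algF : Algebra ℂ F]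
  /-- `F` is a finitely generated extension of `ℂ` of transcendence degree 1 -/
  trdeg_one : ∃ x : F, Transcendental ℂ x ∧
    FiniteDimensional (IntermediateField.adjoin ℂ {x}) F
  /-- the (closed) points of the curve -/
  Point : Type
  /-- order of vanishing of a rational function at a point -/
  ord : Point → F → ℤ
  ord_zero' : ∀ P, ord P 0 = 0
  ord_mul : ∀ P, ∀ f g : F, f ≠ 0 → g ≠ 0 → ord P (f * g) = ord P f + ord P g
  ord_add : ∀ P, ∀ f g : F, f ≠ 0 → g ≠ 0 → f + g ≠ 0 →
    min (ord P f) (ord P g) ≤ ord P (f + g)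
  ord_algebraMap : ∀ P, ∀ c : ℂ, c ≠ 0 → ord P (algebraMap ℂ F c) = 0
  /-- every point admits a local uniformizer (the valuation is surjective) -/
  ord_uniformizer : ∀ P, ∃ f : F, f ≠ 0 ∧ ord P f = 1
  /-- a nonzero rational function has only finitely many zeros and poles -/
  ord_finite_support : ∀ f : F, f ≠ 0 → (Function.support fun P => ord P f).Finite
  /-- distinct points are separated by rational functions -/
  ord_separates : ∀ P Q : Point, P ≠ Q → ∃ f : F, f ≠ 0 ∧ 0 < ord P f ∧ ord Q f = 0

attribute [instance] PreCurve.fieldF PreCurve.algF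

namespace PreCurve

variable (C : PreCurve)

/-- Divisors on the curve. -/
abbrev Div := C.Point →₀ ℤ

/-- The divisor of a single point. -/
def pt (P : C.Point) : C.Div := Finsupp.single P 1

/-- The degree of a divisor. -/
def deg (D : C.Div) : ℤ := D.sum fun _ n => n

/-- The Riemann–Roch space `H⁰(C, O(D)) = {f ∈ F | div f + D ≥ 0} ∪ {0}`. -/
def H0 (D : C.Div) : Submodule ℂ C.F where
  carrier := {f : C.F | f = 0 ∨ ∀ P, 0 ≤ C.ord P f + D P}
  zero_mem' := Or.inl rfl
  add_mem' := by
    intro f g hf hg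
    rcases eq_or_ne f 0 with rfl | hf0
    · simpa using hg
    rcases eq_or_ne g 0 with rfl | hg0
    · simpa using hf
    rcases eq_or_ne (f + g) 0 with h0 | h0
    · exact Or.inl h0
    rcases hf with rfl | hf
    · exact absurd rfl hf0
    rcases hg with rfl | hg
    · exact absurd rfl hg0
    refine Or.inr fun P => ?_
    have hmin := C.ord_add P f g hf0 hg0 h0
    rcases le_total (C.ord P f) (C.ord P g) with hle | hle
    · rw [min_eq_left hle] at hmin
      have := hf P; omega
    · rw [min_eq_right hle] at hmin
      have := hg P; omega
  smul_mem' := by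
    intro c f hf
    rcases eq_or_ne c 0 with rfl | hc
    · exact Or.inl (zero_smul ℂ f)
    rcases hf with rfl | hf
    · exact Or.inl (smul_zero c)
    rcases eq_or_ne f 0 with rfl | hf0
    · exact Or.inl (smul_zero c)
    refine Or.inr fun P => ?_
    have hmap : (algebraMap ℂ C.F c) ≠ 0 := fun h =>
      hc ((algebraMap ℂ C.F).injective (by rw [h, map_zero]))
    have hsm : c • f = algebraMap ℂ C.F c * f := Algebra.smul_def c f
    rw [hsm, C.ord_mul P _ f hmap hf0, C.ord_algebraMap P c hc]
    simpa using hf P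

theorem mem_H0 {D : C.Div} {f : C.F} :
    f ∈ C.H0 D ↔ (f = 0 ∨ ∀ P, 0 ≤ C.ord P f + D P) := Iff.rfl

/-- `h⁰(D) = dim H⁰(C, O(D))`. -/
def h0 (D : C.Div) : ℕ := Module.finrank ℂ (C.H0 D)

theorem H0_mono {D E : C.Div} (h : ∀ P, D P ≤ E P) : C.H0 D ≤ C.H0 E := by
  intro f hf
  rcases (C.mem_H0.mp hf) with rfl | hf
  · exact (C.H0 E).zero_mem
  · exact C.mem_H0.mpr (Or.inr fun P => by have := h P; have := hf P; omega)

theorem mul_mem_H0 {D E : C.Div} {f g : C.F} (hf : f ∈ C.H0 D) (hg : g ∈ C.H0 E) :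
    f * g ∈ C.H0 (D + E) := by
  rcases (C.mem_H0.mp hf) with rfl | hf
  · exact C.mem_H0.mpr (Or.inl (zero_mul g))
  rcases (C.mem_H0.mp hg) with rfl | hg
  · exact C.mem_H0.mpr (Or.inl (mul_zero f))
  rcases eq_or_ne f 0 with rfl | hf0
  · exact C.mem_H0.mpr (Or.inl (zero_mul g))
  rcases eq_or_ne g 0 with rfl | hg0
  · exact C.mem_H0.mpr (Or.inl (mul_zero f))
  refine C.mem_H0.mpr (Or.inr fun P => ?_)
  rw [C.ord_mul P f g hf0 hg0, Finsupp.add_apply]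
  have := hf P; have := hg P; omega

/-- Multiplication of sections, `H⁰(D) ⊗ H⁰(E) → H⁰(D + E)`, as a bilinear map. -/
def mulH0 (D E : C.Div) : C.H0 D →ₗ[ℂ] C.H0 E →ₗ[ℂ] C.H0 (D + E) :=
  LinearMap.mk₂ ℂ (fun f g => ⟨(f : C.F) * (g : C.F), C.mul_mem_H0 f.2 g.2⟩)
    (fun f f' g => Subtype.ext (by simp [add_mul]))
    (fun c f g => Subtype.ext (by simp [smul_mul_assoc]))
    (fun f g g' => Subtype.ext (by simp [mul_add]))
    (fun c f g => Subtype.ext (by simp [mul_smul_comm]))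

/-- Transport of `H⁰` along an equality of divisors. -/
def castH0 {D E : C.Div} (h : D = E) : (C.H0 D : Type) ≃ₗ[ℂ] C.H0 E :=
  LinearEquiv.ofEq _ _ (by rw [h])

/-- The multiplication map `H⁰(D) ⊗ H⁰(E) → H⁰(G)` for `G = D + E`. -/
def mulTo (D E G : C.Div) (h : D + E = G) : (C.H0 D ⊗[ℂ] C.H0 E) →ₗ[ℂ] C.H0 G :=
  (C.castH0 h).toLinearMap ∘ₗ TensorProduct.lift (C.mulH0 D E)

/-- The inclusion `H⁰(D) ⊆ H⁰(E)` for `D ≤ E`. -/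
def inclH0 {D E : C.Div} (h : ∀ P, D P ≤ E P) : (C.H0 D : Type) →ₗ[ℂ] C.H0 E :=
  Submodule.inclusion (C.H0_mono h)

/-- Multiplication by a fixed section `a ∈ H⁰(E)`, as a map `H⁰(M) → H⁰(E + M)`. -/
def mulBy {E : C.Div} (a : C.F) (ha : a ∈ C.H0 E) (M : C.Div) :
    (C.H0 M : Type) →ₗ[ℂ] C.H0 (E + M) :=
  C.mulH0 E M ⟨a, ha⟩

/-- The reduced effective divisor attached to a finite set of points. -/
def divOfFinset (s : Finset C.Point) : C.Div := ∑ P ∈ s, C.pt P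

/-- The divisor of a nonzero rational function. -/
def divOf (f : C.F) : C.Div := by
  classical
  exact if h : f = 0 then 0
    else Finsupp.ofSupportFinite (fun P => C.ord P f) (C.ord_finite_support f h)

/-- Linear equivalence of divisors. -/
def LinEquiv (D E : C.Div) : Prop := ∃ f : C.F, f ≠ 0 ∧ D - E = C.divOf f

end PreCurve

/-- A smooth connected projective complex curve: the data of `PreCurve` together with
properness (principal divisors have degree zero), finite–dimensionality of Riemann–Roch
spaces, `H⁰(O) = ℂ`, a canonical divisor `K`, and the genus, tied together by the
Riemann–Roch theorem (in its Serre-duality form `h⁰(D) − h⁰(K−D) = deg D + 1 − g`). -/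
structure Curve extends PreCurve where
  deg_principal : ∀ f : toPreCurve.F, f ≠ 0 → (∑ᶠ P, toPreCurve.ord P f) = 0
  finiteDim : ∀ D : toPreCurve.Div, FiniteDimensional ℂ (toPreCurve.H0 D)
  h0_triv : toPreCurve.h0 0 = 1
  /-- a canonical divisor (class) of the curve -/
  K : toPreCurve.Div
  /-- the genus of the curve -/
  genus : ℕ
  riemann_roch : ∀ D : toPreCurve.Div,
    (toPreCurve.h0 D : ℤ) - toPreCurve.h0 (K - D) = toPreCurve.deg D + 1 - genus

namespace Curve

variable (C : Curve)

/-- `h¹(D)`, via Serre duality. -/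
def h1 (D : C.Div) : ℕ := C.h0 (C.K - D)

/-- The complete linear system `|D|` is base-point free. -/
def BasePointFree (D : C.Div) : Prop := ∀ P : C.Point, C.h0 (D - C.pt P) + 1 = C.h0 D

/-- `|D|` is a base-point-free pencil (base-point free of projective dimension 1). -/
def IsBPFPencil (D : C.Div) : Prop := C.BasePointFree D ∧ C.h0 D = 2

/-- `C` is hyperelliptic: it carries a `g¹₂`. -/
def Hyperelliptic : Prop := ∃ D : C.Div, C.deg D = 2 ∧ 2 ≤ C.h0 D

/-- `C` is trigonal: it admits a degree-3 map to `ℙ¹`. -/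
def Trigonal : Prop := ∃ D : C.Div, C.deg D = 3 ∧ 2 ≤ C.h0 D ∧ C.BasePointFree D

/-- `D` is very ample (it separates points and tangent vectors). -/
def VeryAmple (D : C.Div) : Prop :=
  ∀ P Q : C.Point, C.h0 (D - C.pt P - C.pt Q) + 2 = C.h0 D

/-- `C` is a smooth plane quintic: it carries a very ample `g²₅`. -/
def IsPlaneQuintic : Prop := ∃ D : C.Div, C.deg D = 5 ∧ C.h0 D = 3 ∧ C.VeryAmple D

/-- The homogeneous coordinate algebra `R_L = ⊕ₙ H⁰(C, Lⁿ)` of a divisor (class) `L`,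
as a graded system inside the function field. -/
def RL (L : C.Div) : GradedSystem ℂ C.F where
  piece n := C.H0 (n • L)
  one_mem := by
    refine C.mem_H0.mpr (Or.inr fun P => ?_)
    have h1 : C.ord P 1 = 0 := by
      simpa using C.ord_algebraMap P 1 one_ne_zero
    simp [h1]
  mul_mem := by
    intro m n x y hx hy
    have h := C.mul_mem_H0 hx hy
    show x * y ∈ C.H0 ((m + n) • L)
    rwa [add_smul]

/-- The embedding given by the complete linear system `|L|` is projectively normal:
`R_L` is generated in degree one (equivalently, `Symⁿ H⁰(L) → H⁰(Lⁿ)` is surjective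
for all `n`). -/
def ProjectivelyNormal (L : C.Div) : Prop :=
  ∀ n : ℕ, Surjective
    (C.mulTo L (n • L) ((n + 1) • L) ((add_comm L (n • L)).trans (succ_nsmul L n).symm))

end Curve

/-- The homology of a (two-step) complex `X → Y → Z` at `Y`. -/
def homol {X Y Z : Type} [AddCommGroup X] [AddCommGroup Y] [AddCommGroup Z]
    [Module ℂ X] [Module ℂ Y] [Module ℂ Z] (f : X →ₗ[ℂ] Y) (g : Y →ₗ[ℂ] Z) : Type :=
  ↥(LinearMap.ker g) ⧸ Submodule.comap (LinearMap.ker g).subtype (LinearMap.range f)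


namespace Curve

variable {C : Curve}

/-! #### Orders of vanishing -/

theorem ord_one (P : C.Point) : C.ord P 1 = 0 := by
  simpa using C.ord_algebraMap P 1 one_ne_zero

theorem ord_inv (P : C.Point) (f : C.F) : C.ord P f⁻¹ = - C.ord P f := by
  rcases eq_or_ne f 0 with rfl | hf
  · simp [C.ord_zero']
  · have h := C.ord_mul P f f⁻¹ hf (inv_ne_zero hf)
    rw [mul_inv_cancel₀ hf, ord_one] at h
    omega

theorem ord_div (P : C.Point) {f g : C.F} (hf : f ≠ 0) (hg : g ≠ 0) :
    C.ord P (f / g) = C.ord P f - C.ord P g := by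
  rw [div_eq_mul_inv, C.ord_mul P _ _ hf (inv_ne_zero hg), ord_inv]; ring

theorem ord_smul (P : C.Point) {c : ℂ} (hc : c ≠ 0) (f : C.F) :
    C.ord P (c • f) = C.ord P f := by
  rcases eq_or_ne f 0 with rfl | hf
  · simp
  · have : algebraMap ℂ C.F c ≠ 0 := by simpa using hc
    rw [Algebra.smul_def, C.ord_mul P _ _ this hf, C.ord_algebraMap P c hc, zero_add]

theorem ord_pow (P : C.Point) {f : C.F} (hf : f ≠ 0) (n : ℕ) :
    C.ord P (f ^ n) = n * C.ord P f := by
  induction n with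
  | zero => simp [ord_one]
  | succ n ih => rw [pow_succ, C.ord_mul P _ _ (pow_ne_zero n hf) hf, ih]; push_cast; ring

variable (C) in
/-- Rational functions vanishing to order at least `n` at `P`. -/
def V (P : C.Point) (n : ℤ) : Submodule ℂ C.F where
  carrier := {f | f = 0 ∨ n ≤ C.ord P f}
  zero_mem' := Or.inl rfl
  add_mem' := by
    intro f g hf hg
    rcases eq_or_ne f 0 with rfl | hf0
    · simpa using hg
    rcases eq_or_ne g 0 with rfl | hg0
    · simpa using hf
    rcases eq_or_ne (f + g) 0 with h0 | h0
    · exact Or.inl h0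
    exact Or.inr ((le_min (hf.resolve_left hf0) (hg.resolve_left hg0)).trans
      (C.ord_add P f g hf0 hg0 h0))
  smul_mem' := by
    intro c f hf
    rcases eq_or_ne c 0 with rfl | hc
    · exact Or.inl (zero_smul ℂ f)
    rcases hf with rfl | hf
    · exact Or.inl (smul_zero c)
    · exact Or.inr (by rwa [ord_smul P hc])

theorem mem_V {P : C.Point} {n : ℤ} {f : C.F} : f ∈ C.V P n ↔ f = 0 ∨ n ≤ C.ord P f := Iff.rfl

theorem mem_V_iff {P : C.Point} {n : ℤ} {f : C.F} (hf : f ≠ 0) :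
    f ∈ C.V P n ↔ n ≤ C.ord P f := by simp [mem_V, hf]

theorem V_anti (P : C.Point) {m n : ℤ} (h : m ≤ n) : C.V P n ≤ C.V P m := by
  intro f hf
  exact hf.imp id h.trans

theorem mul_mem_V {P : C.Point} {m n : ℤ} {f g : C.F} (hf : f ∈ C.V P m) (hg : g ∈ C.V P n) :
    f * g ∈ C.V P (m + n) := by
  rcases eq_or_ne f 0 with rfl | hf0
  · simp
  rcases eq_or_ne g 0 with rfl | hg0
  · simp
  rw [mem_V_iff hf0] at hf
  rw [mem_V_iff hg0] at hg
  rw [mem_V_iff (mul_ne_zero hf0 hg0), C.ord_mul P f g hf0 hg0]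
  omega

theorem pow_mem_V {P : C.Point} {m : ℤ} {f : C.F} (hf : f ∈ C.V P m) (n : ℕ) :
    f ^ n ∈ C.V P (n * m) := by
  induction n with
  | zero => simp [mem_V, ord_one]
  | succ n ih =>
    rw [pow_succ]
    convert mul_mem_V ih hf using 2
    push_cast; ring

theorem algebraMap_mem_V (P : C.Point) (c : ℂ) : algebraMap ℂ C.F c ∈ C.V P 0 := by
  rcases eq_or_ne c 0 with rfl | hc
  · simp
  · exact Or.inr (C.ord_algebraMap P c hc).ge

theorem mem_V_ord (P : C.Point) (f : C.F) : f ∈ C.V P (C.ord P f) := Or.inr le_rfl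

theorem mul_mem_V_iff {P : C.Point} {n : ℤ} {f g : C.F} (hf : f ≠ 0) :
    f * g ∈ C.V P (C.ord P f + n) ↔ g ∈ C.V P n := by
  rcases eq_or_ne g 0 with rfl | hg
  · simp
  rw [mem_V_iff (mul_ne_zero hf hg), mem_V_iff hg, C.ord_mul P f g hf hg]
  omega

theorem ord_eq_of_mem_of_notMem {P : C.Point} {n : ℤ} {f : C.F} (h : f ∈ C.V P n)
    (h' : f ∉ C.V P (n + 1)) : f ≠ 0 ∧ C.ord P f = n := by
  have hf : f ≠ 0 := by rintro rfl; exact h' (zero_mem _)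
  rw [mem_V_iff hf] at h h'
  exact ⟨hf, by omega⟩

theorem mem_H0_iff {D : C.Div} {f : C.F} : f ∈ C.H0 D ↔ ∀ P, f ∈ C.V P (-D P) := by
  rw [C.mem_H0]
  constructor
  · rintro (rfl | h) P
    · exact zero_mem _
    · exact Or.inr (by have := h P; omega)
  · intro h
    rcases eq_or_ne f 0 with rfl | hf
    · exact Or.inl rfl
    · exact Or.inr fun P => by have := (mem_V_iff hf).1 (h P); omega

/-! #### Divisors of functions, degrees, linear equivalence -/

theorem divOf_apply {f : C.F} (hf : f ≠ 0) (P : C.Point) : C.divOf f P = C.ord P f := by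
  rw [PreCurve.divOf, dif_neg hf]; rfl

theorem divOf_mul {f g : C.F} (hf : f ≠ 0) (hg : g ≠ 0) :
    C.divOf (f * g) = C.divOf f + C.divOf g := by
  ext P
  rw [Finsupp.add_apply, divOf_apply hf, divOf_apply hg, divOf_apply (mul_ne_zero hf hg),
    C.ord_mul P f g hf hg]

theorem divOf_inv {f : C.F} (hf : f ≠ 0) : C.divOf f⁻¹ = - C.divOf f := by
  ext P
  rw [Finsupp.neg_apply, divOf_apply hf, divOf_apply (inv_ne_zero hf), ord_inv]

theorem divOf_one : C.divOf 1 = 0 := by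
  ext P
  rw [divOf_apply one_ne_zero, ord_one]; rfl

theorem divOf_smul {c : ℂ} (hc : c ≠ 0) {f : C.F} (hf : f ≠ 0) :
    C.divOf (c • f) = C.divOf f := by
  ext P
  rw [divOf_apply (smul_ne_zero hc hf), divOf_apply hf, ord_smul P hc]

@[simp] theorem deg_add (D E : C.Div) : C.deg (D + E) = C.deg D + C.deg E :=
  Finsupp.sum_add_index' (fun _ => rfl) fun _ _ _ => rfl

@[simp] theorem deg_zero : C.deg 0 = 0 := rfl

@[simp] theorem deg_neg (D : C.Div) : C.deg (-D) = - C.deg D := by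
  have := deg_add D (-D)
  rw [add_neg_cancel, deg_zero] at this
  omega

@[simp] theorem deg_sub (D E : C.Div) : C.deg (D - E) = C.deg D - C.deg E := by
  rw [sub_eq_add_neg, deg_add, deg_neg]; ring

@[simp] theorem deg_pt (P : C.Point) : C.deg (C.pt P) = 1 := by
  simp [PreCurve.deg, PreCurve.pt]

@[simp] theorem deg_nsmul (n : ℕ) (D : C.Div) : C.deg (n • D) = n * C.deg D := by
  induction n with
  | zero => simp
  | succ n ih => rw [succ_nsmul, deg_add, ih]; push_cast; ring

theorem deg_sum {ι : Type*} (s : Finset ι) (D : ι → C.Div) :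
    C.deg (∑ i ∈ s, D i) = ∑ i ∈ s, C.deg (D i) := by
  classical
  induction s using Finset.induction_on with
  | empty => simp
  | insert a s ha ih => rw [Finset.sum_insert ha, Finset.sum_insert ha, deg_add, ih]

@[simp] theorem deg_divOf (f : C.F) : C.deg (C.divOf f) = 0 := by
  rcases eq_or_ne f 0 with rfl | hf
  · simp [PreCurve.divOf]
  rw [← C.deg_principal f hf, PreCurve.deg, Finsupp.sum]
  rw [finsum_eq_sum_of_support_subset (s := (C.divOf f).support)]
  · exact Finset.sum_congr rfl fun P _ => divOf_apply hf P
  · intro P hP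
    simpa [divOf_apply hf] using hP

@[simp] theorem pt_self (P : C.Point) : C.pt P P = 1 := by simp [PreCurve.pt]

theorem pt_ne {P Q : C.Point} (h : P ≠ Q) : C.pt P Q = 0 := by
  simp [PreCurve.pt, h]

theorem pt_nonneg (P : C.Point) : 0 ≤ C.pt P := by
  classical
  intro Q
  rw [PreCurve.pt, Finsupp.single_apply]; split_ifs <;> simp

theorem pt_le_iff {P : C.Point} {D : C.Div} (hD : 0 ≤ D) : C.pt P ≤ D ↔ 1 ≤ D P := by
  classical
  constructor
  · intro h; simpa using h P
  · intro h Q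
    by_cases hQ : P = Q
    · subst hQ; simpa using h
    · rw [pt_ne hQ]; exact hD Q

theorem deg_nonneg {D : C.Div} (h : 0 ≤ D) : 0 ≤ C.deg D :=
  Finset.sum_nonneg fun P _ => h P

theorem deg_mono {D E : C.Div} (h : D ≤ E) : C.deg D ≤ C.deg E := by
  have := deg_nonneg (sub_nonneg.2 h)
  rw [deg_sub] at this
  omega

theorem eq_zero_of_deg {D : C.Div} (h : 0 ≤ D) (h' : C.deg D = 0) : D = 0 := by
  ext P
  by_contra hP
  have h1 := (Finset.sum_eq_zero_iff_of_nonneg (fun P _ => h P)).1 h' P (by simpa using hP)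
  exact hP h1

theorem eq_of_le_of_deg {D E : C.Div} (h : D ≤ E) (h' : C.deg D = C.deg E) : D = E := by
  have := eq_zero_of_deg (sub_nonneg.2 h) (by rw [deg_sub]; omega)
  exact (sub_eq_zero.1 this).symm

theorem exists_pt_le {D : C.Div} (h : 0 ≤ D) (h' : 0 < C.deg D) : ∃ P, C.pt P ≤ D := by
  by_contra! hc
  have : D = 0 := by
    ext P
    have h1 := hc P
    rw [pt_le_iff h] at h1
    have h2 : (0 : ℤ) ≤ D P := h P
    simp only [Finsupp.coe_zero, Pi.zero_apply]
    omega
  rw [this] at h'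
  simp at h'

theorem _root_.PreCurve.LinEquiv.refl (D : C.Div) : C.LinEquiv D D :=
  ⟨1, one_ne_zero, by rw [divOf_one, sub_self]⟩

theorem _root_.PreCurve.LinEquiv.symm {D E : C.Div} (h : C.LinEquiv D E) : C.LinEquiv E D := by
  obtain ⟨f, hf, h⟩ := h
  exact ⟨f⁻¹, inv_ne_zero hf, by rw [divOf_inv hf, ← h, neg_sub]⟩

theorem _root_.PreCurve.LinEquiv.trans {D E G : C.Div} (h : C.LinEquiv D E) (h' : C.LinEquiv E G) :
    C.LinEquiv D G := by
  obtain ⟨f, hf, h⟩ := h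
  obtain ⟨f', hf', h'⟩ := h'
  exact ⟨f * f', mul_ne_zero hf hf', by rw [divOf_mul hf hf', ← h, ← h']; abel⟩

theorem _root_.PreCurve.LinEquiv.add {D E D' E' : C.Div} (h : C.LinEquiv D E)
    (h' : C.LinEquiv D' E') : C.LinEquiv (D + D') (E + E') := by
  obtain ⟨f, hf, h⟩ := h
  obtain ⟨f', hf', h'⟩ := h'
  exact ⟨f * f', mul_ne_zero hf hf', by rw [divOf_mul hf hf', ← h, ← h']; abel⟩

theorem _root_.PreCurve.LinEquiv.neg {D E : C.Div} (h : C.LinEquiv D E) : C.LinEquiv (-D) (-E) := by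
  obtain ⟨f, hf, h⟩ := h
  exact ⟨f⁻¹, inv_ne_zero hf, by rw [divOf_inv hf, ← h]; abel⟩

theorem _root_.PreCurve.LinEquiv.sub {D E D' E' : C.Div} (h : C.LinEquiv D E)
    (h' : C.LinEquiv D' E') : C.LinEquiv (D - D') (E - E') := by
  simpa [sub_eq_add_neg] using h.add h'.neg

theorem _root_.PreCurve.LinEquiv.of_sub {D E D' E' : C.Div} (h : C.LinEquiv D E)
    (h' : D - E = D' - E') : C.LinEquiv D' E' := by
  obtain ⟨f, hf, h⟩ := h
  exact ⟨f, hf, by rw [← h', h]⟩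

theorem _root_.PreCurve.LinEquiv.deg_eq {D E : C.Div} (h : C.LinEquiv D E) : C.deg D = C.deg E := by
  obtain ⟨f, hf, h⟩ := h
  have := congrArg C.deg h
  rw [deg_sub, deg_divOf] at this
  omega

theorem mul_mem_H0_iff {D : C.Div} {f g : C.F} (hf : f ≠ 0) :
    f * g ∈ C.H0 D ↔ g ∈ C.H0 (D + C.divOf f) := by
  rw [mem_H0_iff, mem_H0_iff]
  refine forall_congr' fun P => ?_
  rw [← mul_mem_V_iff (P := P) hf (g := g), Finsupp.add_apply, divOf_apply hf]
  congr! 2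
  ring

/-- Multiplication by a nonzero function as an isomorphism of Riemann–Roch spaces. -/
def mulEquiv (D : C.Div) {f : C.F} (hf : f ≠ 0) :
    C.H0 (D + C.divOf f) ≃ₗ[ℂ] C.H0 D where
  toFun g := ⟨f * g, (mul_mem_H0_iff hf).2 g.2⟩
  invFun g := ⟨f⁻¹ * g, (mul_mem_H0_iff hf).1 (by rw [mul_inv_cancel_left₀ hf]; exact g.2)⟩
  map_add' a b := Subtype.ext (mul_add f a b)
  map_smul' c a := Subtype.ext (mul_smul_comm c f a)
  left_inv a := Subtype.ext (inv_mul_cancel_left₀ hf a)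
  right_inv a := Subtype.ext (mul_inv_cancel_left₀ hf a)

theorem _root_.PreCurve.LinEquiv.h0_eq {D E : C.Div} (h : C.LinEquiv D E) : C.h0 D = C.h0 E := by
  obtain ⟨f, hf, h⟩ := h
  have : D = E + C.divOf f := by rw [← h]; abel
  rw [this]
  exact (mulEquiv E hf).finrank_eq

theorem divOf_linEquiv {f : C.F} (hf : f ≠ 0) (D : C.Div) : C.LinEquiv (D + C.divOf f) D :=
  ⟨f, hf, by abel⟩

instance (D : C.Div) : FiniteDimensional ℂ (C.H0 D) := C.finiteDim D

theorem mem_H0_effective {D : C.Div} {f : C.F} (hf : f ≠ 0) :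
    f ∈ C.H0 D ↔ 0 ≤ D + C.divOf f := by
  rw [C.mem_H0, or_iff_right hf]
  refine forall_congr' fun P => ?_
  rw [Finsupp.add_apply, divOf_apply hf, add_comm, Finsupp.coe_zero, Pi.zero_apply]

theorem mem_H0_sub {D Z : C.Div} {f : C.F} (hf : f ≠ 0) :
    f ∈ C.H0 (D - Z) ↔ Z ≤ D + C.divOf f := by
  rw [mem_H0_effective hf, ← sub_nonneg (b := Z)]
  congr! 1
  abel

theorem h0_pos_iff {D : C.Div} : 0 < C.h0 D ↔ ∃ f ∈ C.H0 D, f ≠ 0 := by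
  rw [PreCurve.h0, Module.finrank_pos_iff_exists_ne_zero]
  constructor
  · rintro ⟨⟨f, hf⟩, h⟩
    exact ⟨f, hf, fun h' => h (Subtype.ext h')⟩
  · rintro ⟨f, hf, h⟩
    exact ⟨⟨f, hf⟩, fun h' => h (congrArg Subtype.val h')⟩

theorem exists_effective {D : C.Div} (h : 0 < C.h0 D) : ∃ E, 0 ≤ E ∧ C.LinEquiv E D := by
  obtain ⟨f, hf, hf0⟩ := h0_pos_iff.1 h
  exact ⟨D + C.divOf f, (mem_H0_effective hf0).1 hf, divOf_linEquiv hf0 D⟩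

theorem h0_pos_of_effective {D : C.Div} (h : 0 ≤ D) : 0 < C.h0 D :=
  h0_pos_iff.2 ⟨1, (mem_H0_effective one_ne_zero).2 (by rwa [divOf_one, add_zero]), one_ne_zero⟩

theorem h0_eq_zero_of_deg_neg {D : C.Div} (h : C.deg D < 0) : C.h0 D = 0 := by
  by_contra h0
  obtain ⟨E, hE, hl⟩ := exists_effective (Nat.pos_of_ne_zero h0)
  have := deg_nonneg hE
  rw [hl.deg_eq] at this
  omega

theorem linEquiv_zero_of_deg {D : C.Div} (h : 0 < C.h0 D) (h' : C.deg D = 0) :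
    C.LinEquiv D 0 := by
  obtain ⟨E, hE, hl⟩ := exists_effective h
  rw [eq_zero_of_deg hE (by rw [hl.deg_eq, h'])] at hl
  exact hl.symm

theorem h0_mono {D E : C.Div} (h : D ≤ E) : C.h0 D ≤ C.h0 E :=
  Submodule.finrank_mono (C.H0_mono h)

theorem H0_eq_of_le {D E : C.Div} (h : D ≤ E) (h' : C.h0 E ≤ C.h0 D) : C.H0 D = C.H0 E :=
  Submodule.eq_of_le_of_finrank_le (C.H0_mono h) h'

theorem sub_pt_le (D : C.Div) (P : C.Point) : D - C.pt P ≤ D :=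
  sub_le_self _ (pt_nonneg P)

theorem h0_le_sub_pt (D : C.Div) (P : C.Point) : C.h0 D ≤ C.h0 (D - C.pt P) + 1 := by
  have h1 := C.riemann_roch D
  have h2 := C.riemann_roch (D - C.pt P)
  have h3 : C.h0 (C.K - D) ≤ C.h0 (C.K - (D - C.pt P)) :=
    h0_mono (sub_le_sub_left (sub_pt_le D P) _)
  rw [deg_sub, deg_pt] at h2
  omega

theorem h0_sub_pt_le (D : C.Div) (P : C.Point) : C.h0 (D - C.pt P) ≤ C.h0 D :=
  h0_mono (sub_pt_le D P)

theorem h0_le_add_deg {Z : C.Div} (hZ : 0 ≤ Z) (D : C.Div) :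
    (C.h0 D : ℤ) ≤ C.h0 (D - Z) + C.deg Z := by
  have h1 := C.riemann_roch D
  have h2 := C.riemann_roch (D - Z)
  have h3 : C.h0 (C.K - D) ≤ C.h0 (C.K - (D - Z)) :=
    h0_mono (sub_le_sub_left (sub_le_self _ hZ) _)
  rw [deg_sub] at h2
  omega

theorem h0_K_sub (D : C.Div) :
    (C.h0 (C.K - D) : ℤ) = C.h0 D - C.deg D - 1 + C.genus := by
  have h1 := C.riemann_roch D
  omega

theorem h0_K : C.h0 C.K = C.genus := by
  have := h0_K_sub (C := C) 0
  rw [sub_zero, deg_zero, C.h0_triv] at this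
  push_cast at this
  omega

theorem deg_K : C.deg C.K = 2 * C.genus - 2 := by
  have := C.riemann_roch C.K
  rw [sub_self, C.h0_triv, h0_K] at this
  push_cast at this
  omega

/-! #### Residues -/

theorem exists_sub_mem_V {P : C.Point} {f : C.F} (hf : f ∈ C.V P 0) :
    ∃ c : ℂ, f - algebraMap ℂ C.F c ∈ C.V P 1 := by
  classical
  rcases eq_or_ne f 0 with rfl | hf0
  · exact ⟨0, by simp⟩
  let D : C.Div := -(C.divOf f ⊓ 0)
  have hD : 0 ≤ D := neg_nonneg.2 inf_le_right
  have hDP : D P = 0 := by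
    have := (mem_V_iff hf0).1 hf
    simp [D, Finsupp.inf_apply, divOf_apply hf0, this]
  have hfD : f ∈ C.H0 D := by
    rw [mem_H0_effective hf0]
    exact neg_le_iff_add_nonneg'.1 (by simp [D])
  have h1D : (1 : C.F) ∈ C.H0 D := by
    rw [mem_H0_effective one_ne_zero, divOf_one, add_zero]; exact hD
  have h1D' : (1 : C.F) ∉ C.H0 (D - C.pt P) := by
    rw [mem_H0_sub one_ne_zero, divOf_one, add_zero, pt_le_iff hD, hDP]
    norm_num
  have hle := C.H0_mono (sub_pt_le D P)
  have hlt : C.H0 (D - C.pt P) < C.H0 (D - C.pt P) ⊔ Submodule.span ℂ {1} := by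
    refine lt_of_le_of_ne le_sup_left fun h => h1D' ?_
    rw [h]
    exact (le_sup_right : _ ≤ C.H0 (D - C.pt P) ⊔ _) (Submodule.mem_span_singleton_self 1)
  have hsup : C.H0 (D - C.pt P) ⊔ Submodule.span ℂ {1} ≤ C.H0 D :=
    sup_le hle (by rwa [Submodule.span_singleton_le_iff_mem])
  have heq : C.H0 (D - C.pt P) ⊔ Submodule.span ℂ {1} = C.H0 D := by
    refine Submodule.eq_of_le_of_finrank_le hsup ?_
    have h1 := h0_le_sub_pt D P
    have : FiniteDimensional ℂ ↥(C.H0 (D - C.pt P) ⊔ Submodule.span ℂ {(1 : C.F)}) :=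
      Submodule.finiteDimensional_of_le hsup
    have h2 := Submodule.finrank_lt_finrank_of_lt hlt
    exact h1.trans h2
  rw [← heq, Submodule.mem_sup] at hfD
  obtain ⟨y, hy, z, hz, rfl⟩ := hfD
  obtain ⟨c, rfl⟩ := Submodule.mem_span_singleton.1 hz
  refine ⟨c, ?_⟩
  rw [Algebra.algebraMap_eq_smul_one, add_sub_cancel_right]
  have := mem_H0_iff.1 hy P
  simpa [hDP] using this

theorem exists_sub_smul_mem_V {P : C.Point} {n : ℤ} {f₀ f : C.F} (h₀ : f₀ ≠ 0)
    (hn : C.ord P f₀ = n) (hf : f ∈ C.V P n) : ∃ c : ℂ, f - c • f₀ ∈ C.V P (n + 1) := by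
  have h1 : f₀⁻¹ * f ∈ C.V P 0 := by
    have := mul_mem_V (mem_V_ord P f₀⁻¹) hf
    rwa [ord_inv, hn, neg_add_cancel] at this
  obtain ⟨c, hc⟩ := exists_sub_mem_V h1
  refine ⟨c, ?_⟩
  have := (mul_mem_V_iff (P := P) (n := 1) h₀).2 hc
  rwa [hn, mul_sub, mul_inv_cancel_left₀ h₀, mul_comm f₀ (algebraMap _ _ _),
    ← Algebra.smul_def] at this

theorem mem_H0_sub_pt {D : C.Div} {P : C.Point} {f : C.F} :
    f ∈ C.H0 (D - C.pt P) ↔ f ∈ C.H0 D ∧ f ∈ C.V P (-D P + 1) := by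
  constructor
  · intro h
    refine ⟨C.H0_mono (sub_pt_le D P) h, ?_⟩
    have := mem_H0_iff.1 h P
    rw [Finsupp.sub_apply, pt_self] at this
    convert this using 2
    ring
  · rintro ⟨h, hP⟩
    rw [mem_H0_iff] at h ⊢
    intro Q
    rw [Finsupp.sub_apply]
    by_cases hQ : P = Q
    · subst hQ
      rw [pt_self]
      convert hP using 2
      ring
    · rw [pt_ne hQ]; simpa using h Q

theorem exists_const_of_mem_H0_zero {f : C.F} (hf : f ∈ C.H0 0) :
    ∃ c : ℂ, f = algebraMap ℂ C.F c := by
  have h1 : (1 : C.F) ∈ C.H0 0 := by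
    rw [mem_H0_effective one_ne_zero, divOf_one, add_zero]
  obtain ⟨c, hc⟩ := (finrank_eq_one_iff_of_nonzero' (⟨1, h1⟩ : C.H0 0)
    (fun h => one_ne_zero (congrArg Subtype.val h))).1 C.h0_triv ⟨f, hf⟩
  refine ⟨c, ?_⟩
  rw [Algebra.algebraMap_eq_smul_one]
  exact (congrArg Subtype.val hc).symm

variable (C) in
/-- A fixed nonconstant function. -/
def x : C.F := C.trdeg_one.choose

theorem x_transcendental : Transcendental ℂ C.x := C.trdeg_one.choose_spec.1

instance : FiniteDimensional (IntermediateField.adjoin ℂ {C.x}) C.F :=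
  C.trdeg_one.choose_spec.2

theorem x_ne (c : ℂ) : C.x - algebraMap ℂ C.F c ≠ 0 := fun h =>
  x_transcendental (C := C) (by rw [sub_eq_zero.1 h]; exact isAlgebraic_algebraMap c)

theorem exists_point_of_nonconst {f : C.F} (hf : ∀ c : ℂ, f ≠ algebraMap ℂ C.F c) (c : ℂ) :
    ∃ P, f - algebraMap ℂ C.F c ∈ C.V P 1 := by
  by_contra! h
  have h0 : f - algebraMap ℂ C.F c ≠ 0 := sub_ne_zero.2 (hf c)
  have h1 : (f - algebraMap ℂ C.F c)⁻¹ ∈ C.H0 0 := by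
    rw [C.mem_H0]
    right
    intro P
    have := h P
    rw [mem_V_iff h0] at this
    rw [ord_inv]
    simp only [Finsupp.coe_zero, Pi.zero_apply]
    omega
  obtain ⟨d, hd⟩ := exists_const_of_mem_H0_zero h1
  apply hf (d⁻¹ + c)
  rw [map_add, map_inv₀, ← hd, inv_inv, sub_add_cancel]

theorem x_ne_const (c : ℂ) : C.x ≠ algebraMap ℂ C.F c := fun h => x_ne c (sub_eq_zero.2 h)

variable (C) in
/-- A point where `x` takes the value `c`. -/
def px (c : ℂ) : C.Point := (exists_point_of_nonconst (C := C) x_ne_const c).choose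

theorem px_spec (c : ℂ) : C.x - algebraMap ℂ C.F c ∈ C.V (C.px c) 1 :=
  (exists_point_of_nonconst (C := C) x_ne_const c).choose_spec

theorem eq_of_sub_mem_V {P : C.Point} {f : C.F} {c d : ℂ} (hc : f - algebraMap ℂ C.F c ∈ C.V P 1)
    (hd : f - algebraMap ℂ C.F d ∈ C.V P 1) : c = d := by
  by_contra h
  have h1 := sub_mem hd hc
  rw [sub_sub_sub_cancel_left, ← map_sub, mem_V_iff (by simpa [sub_eq_zero] using h),
    C.ord_algebraMap P _ (sub_ne_zero.2 h)] at h1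
  norm_num at h1

theorem px_injective : Function.Injective C.px := fun c d h => by
  have := px_spec (C := C) c
  rw [h] at this
  exact eq_of_sub_mem_V this (px_spec d)

instance : Infinite C.Point := Infinite.of_injective C.px px_injective

end Curve

namespace Curve

variable {C : Curve}

/-! #### Curves of Clifford index at least two -/

variable (C) in
/-- The curve is neither hyperelliptic, nor trigonal, nor a smooth plane quintic. -/
class IsGeneral : Prop where
  not_hyperelliptic : ¬ C.Hyperelliptic
  not_trigonal : ¬ C.Trigonal
  not_planeQuintic : ¬ C.IsPlaneQuintic

theorem h0_sub_pt_eq_or (D : C.Div) (P : C.Point) :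
    C.h0 (D - C.pt P) + 1 = C.h0 D ∨ C.h0 (D - C.pt P) = C.h0 D := by
  have := h0_le_sub_pt D P
  have := h0_sub_pt_le D P
  omega

section

variable [C.IsGeneral]

theorem h0_le_one_of_deg_eq_three {D : C.Div} (h : C.deg D = 3) : C.h0 D ≤ 1 := by
  by_contra! h0
  refine IsGeneral.not_trigonal (C := C) ⟨D, h, h0, fun P => ?_⟩
  refine (h0_sub_pt_eq_or D P).resolve_right fun h1 => ?_
  exact IsGeneral.not_hyperelliptic (C := C)
    ⟨D - C.pt P, by rw [deg_sub, deg_pt, h]; norm_num, by omega⟩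

theorem h0_le_one {D : C.Div} (h : C.deg D ≤ 3) : C.h0 D ≤ 1 := by
  let P : C.Point := Classical.arbitrary _
  have h1 : D ≤ D + (3 - C.deg D).toNat • C.pt P :=
    le_add_of_nonneg_right (nsmul_nonneg (pt_nonneg P) _)
  refine (h0_mono h1).trans (h0_le_one_of_deg_eq_three ?_)
  rw [deg_add, deg_nsmul, deg_pt]
  omega

theorem h0_le_two_of_deg_le_four {D : C.Div} (h : C.deg D ≤ 4) : C.h0 D ≤ 2 := by
  let P : C.Point := Classical.arbitrary _
  have h1 := h0_le_sub_pt D P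
  have h2 := h0_le_one (D := D - C.pt P) (by rw [deg_sub, deg_pt]; omega)
  omega

theorem isBPFPencil_of_deg_eq_four {D : C.Div} (h : C.deg D = 4) (h2 : 2 ≤ C.h0 D) :
    C.IsBPFPencil D := by
  have h3 := h0_le_two_of_deg_le_four h.le
  refine ⟨fun P => ?_, by omega⟩
  have h1 := h0_le_sub_pt D P
  have h2 := h0_le_one (D := D - C.pt P) (by rw [deg_sub, deg_pt]; omega)
  omega

theorem h0_le_two {D : C.Div} (h : C.deg D ≤ 5) : C.h0 D ≤ 2 := by
  by_contra! h3
  rcases (show C.deg D ≤ 4 ∨ C.deg D = 5 by omega) with h | h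
  · have := h0_le_two_of_deg_le_four h
    omega
  have key : ∀ P Q, C.h0 D ≤ C.h0 (D - C.pt P - C.pt Q) + 2 ∧
      C.h0 (D - C.pt P - C.pt Q) ≤ 1 := fun P Q => by
    have h1 := h0_le_sub_pt D P
    have h2 := h0_le_sub_pt (D - C.pt P) Q
    have h4 := h0_le_one (D := D - C.pt P - C.pt Q) (by simp only [deg_sub, deg_pt]; omega)
    omega
  have P : C.Point := Classical.arbitrary _
  have := key P P
  refine IsGeneral.not_planeQuintic (C := C) ⟨D, h, by omega, fun P Q => ?_⟩
  have := key P Q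
  omega

variable (C) in
theorem five_le_genus : 5 ≤ C.genus := by
  have P : C.Point := Classical.arbitrary _
  have hK := deg_K (C := C)
  have hK0 := h0_K (C := C)
  by_contra! h
  interval_cases hg : C.genus
  · have h1 := C.riemann_roch (C.pt P)
    have h2 := h0_le_one (D := C.pt P) (by simp)
    rw [deg_pt, hg] at h1
    push_cast at h1
    omega
  · have h1 := C.riemann_roch (2 • C.pt P)
    have h2 := h0_le_one (D := 2 • C.pt P) (by simp)
    rw [deg_nsmul, deg_pt, hg] at h1
    push_cast at h1
    omega
  · have := h0_le_one (D := C.K) (by rw [hK]; norm_num)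
    omega
  · have := h0_le_two (D := C.K) (by rw [hK]; norm_num)
    omega
  · have := h0_le_two (D := C.K - C.pt P) (by rw [deg_sub, deg_pt, hK]; norm_num)
    have := h0_le_sub_pt C.K P
    omega

end

/-! #### Base-point-free pencils -/

theorem IsBPFPencil.h0_sub_pt {A : C.Div} (h : C.IsBPFPencil A) (P : C.Point) :
    C.h0 (A - C.pt P) = 1 := by
  have := h.1 P
  have := h.2
  omega

theorem exists_unique_section {D : C.Div} (h : C.h0 D = 1) :
    ∃ f ∈ C.H0 D, f ≠ 0 ∧ ∀ f' ∈ C.H0 D, ∃ c : ℂ, f' = c • f := by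
  obtain ⟨v, hv, h'⟩ := finrank_eq_one_iff'.1 h
  refine ⟨v, v.2, fun h => hv (Subtype.ext h), fun f' hf' => ?_⟩
  obtain ⟨c, hc⟩ := h' ⟨f', hf'⟩
  exact ⟨c, (congrArg Subtype.val hc).symm⟩

theorem exists_section_through {D : C.Div} (h : 2 ≤ C.h0 D) (P : C.Point) :
    ∃ f ∈ C.H0 (D - C.pt P), f ≠ 0 := by
  have := h0_le_sub_pt D P
  exact h0_pos_iff.1 (by omega)

theorem exists_of_h0_eq_two {A : C.Div} (h : C.h0 A = 2) {s : C.F} (hs : s ∈ C.H0 A)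
    (hs0 : s ≠ 0) : ∃ t ∈ C.H0 A, (∀ c : ℂ, t ≠ c • s) ∧
      ∀ f ∈ C.H0 A, ∃ a b : ℂ, f = a • s + b • t := by
  have h1 : ∃ t ∈ C.H0 A, ∀ c : ℂ, t ≠ c • s := by
    by_contra! hc
    have : C.h0 A ≤ 1 := by
      refine finrank_le_one ⟨s, hs⟩ fun w => ?_
      obtain ⟨c, hc⟩ := hc w w.2
      exact ⟨c, Subtype.ext hc.symm⟩
    omega
  obtain ⟨t, ht, hts⟩ := h1
  refine ⟨t, ht, hts, ?_⟩
  have hli : LinearIndependent ℂ ![s, t] :=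
    (LinearIndependent.pair_iff' hs0).2 fun a ha => hts a ha.symm
  have hspan : Submodule.span ℂ (Set.range ![s, t]) = C.H0 A := by
    refine Submodule.eq_of_le_of_finrank_le ?_ ?_
    · rw [Submodule.span_le]
      rintro _ ⟨i, rfl⟩
      fin_cases i
      · exact hs
      · exact ht
    · rw [finrank_span_eq_card hli]
      exact h.le
  intro f hf
  rw [← hspan, Matrix.range_cons, Matrix.range_cons, Matrix.range_empty, Set.union_empty,
    Set.singleton_union, Submodule.mem_span_pair] at hf
  obtain ⟨a, b, hab⟩ := hf
  exact ⟨a, b, hab.symm⟩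

theorem ne_zero_of_forall_ne_smul {s t : C.F} (h : ∀ c : ℂ, t ≠ c • s) : t ≠ 0 := by
  simpa using h 0

theorem IsBPFPencil.no_common_zero {A : C.Div} (h : C.IsBPFPencil A) {s t : C.F}
    (hs0 : s ≠ 0) (hts : ∀ c : ℂ, t ≠ c • s)
    {P : C.Point} (hs : s ∈ C.H0 (A - C.pt P)) (ht : t ∈ C.H0 (A - C.pt P)) : False := by
  obtain ⟨f, hf, hf0, hc⟩ := exists_unique_section (h.h0_sub_pt P)
  obtain ⟨a, rfl⟩ := hc s hs
  obtain ⟨b, rfl⟩ := hc t ht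
  have ha : a ≠ 0 := by rintro rfl; simp at hs0
  exact hts (b * a⁻¹) (by rw [smul_smul, inv_mul_cancel_right₀ ha])

/-- The map `(a, b) ↦ s a + t b` on pairs of sections. -/
def pairMap (N : C.Div) (s t : C.F) : (C.H0 N × C.H0 N) →ₗ[ℂ] C.F :=
  LinearMap.coprod ((LinearMap.mulLeft ℂ s) ∘ₗ (C.H0 N).subtype)
    ((LinearMap.mulLeft ℂ t) ∘ₗ (C.H0 N).subtype)

theorem pairMap_apply (N : C.Div) (s t : C.F) (a b : C.H0 N) :
    pairMap N s t (a, b) = s * a + t * b := rfl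

theorem pairMap_range_le {A N : C.Div} {s t : C.F} (hs : s ∈ C.H0 A) (ht : t ∈ C.H0 A) :
    LinearMap.range (pairMap N s t) ≤ C.H0 (N + A) := by
  rintro _ ⟨⟨a, b⟩, rfl⟩
  rw [pairMap_apply, add_comm N]
  exact add_mem (C.mul_mem_H0 hs a.2) (C.mul_mem_H0 ht b.2)

/-- The base-point-free pencil trick. -/
theorem IsBPFPencil.two_mul_h0_le_range {A : C.Div} (h : C.IsBPFPencil A) (N : C.Div) {s t : C.F}
    (hs : s ∈ C.H0 A) (ht : t ∈ C.H0 A) (hs0 : s ≠ 0) (hts : ∀ c : ℂ, t ≠ c • s) :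
    2 * C.h0 N ≤ Module.finrank ℂ (LinearMap.range (pairMap N s t)) + C.h0 (N - A) := by
  have ht0 := ne_zero_of_forall_ne_smul hts
  have hker : Module.finrank ℂ (LinearMap.ker (pairMap N s t)) ≤ C.h0 (N - A) := by
    have hmem : ∀ p ∈ LinearMap.ker (pairMap N s t), t⁻¹ * p.1 ∈ C.H0 (N - A) := by
      rintro ⟨⟨a, ha⟩, ⟨b, hb⟩⟩ hp
      rw [LinearMap.mem_ker, pairMap_apply] at hp
      change t⁻¹ * a ∈ C.H0 (N - A)
      change s * a + t * b = 0 at hp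
      have hab : t⁻¹ * a = s⁻¹ * (-b) := by
        field_simp
        linear_combination hp
      rw [mem_H0_iff]
      intro P
      by_cases hP : t ∈ C.V P (-A P + 1)
      · have hsP : s ∉ C.V P (-A P + 1) := fun hsP =>
          h.no_common_zero hs0 hts (mem_H0_sub_pt.2 ⟨hs, hsP⟩) (mem_H0_sub_pt.2 ⟨ht, hP⟩)
        obtain ⟨-, h1⟩ := ord_eq_of_mem_of_notMem (mem_H0_iff.1 hs P) hsP
        rw [hab]
        convert mul_mem_V (mem_V_ord P s⁻¹) (mem_H0_iff.1 (neg_mem hb) P) using 2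
        rw [ord_inv, h1, Finsupp.sub_apply]
        ring
      · obtain ⟨-, h1⟩ := ord_eq_of_mem_of_notMem (mem_H0_iff.1 ht P) hP
        convert mul_mem_V (mem_V_ord P t⁻¹) (mem_H0_iff.1 ha P) using 2
        rw [ord_inv, h1, Finsupp.sub_apply]
        ring
    let φ : LinearMap.ker (pairMap N s t) →ₗ[ℂ] C.H0 (N - A) :=
      LinearMap.codRestrict _
        ((LinearMap.mulLeft ℂ t⁻¹) ∘ₗ (C.H0 N).subtype ∘ₗ (LinearMap.fst ℂ _ _) ∘ₗ
          (LinearMap.ker (pairMap N s t)).subtype) fun p => hmem p p.2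
    refine LinearMap.finrank_le_finrank_of_injective (f := φ) ?_
    rintro ⟨⟨⟨a, ha⟩, ⟨b, hb⟩⟩, hp⟩ ⟨⟨⟨a', ha'⟩, ⟨b', hb'⟩⟩, hq⟩ h0
    have h1 : t⁻¹ * a = t⁻¹ * a' := congrArg Subtype.val h0
    obtain rfl : a = a' := mul_left_cancel₀ (inv_ne_zero ht0) h1
    rw [LinearMap.mem_ker, pairMap_apply] at hp hq
    change s * a + t * b = 0 at hp
    change s * a + t * b' = 0 at hq
    obtain rfl : b = b' := mul_left_cancel₀ ht0 (by linear_combination hp - hq)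
    rfl
  have := LinearMap.finrank_range_add_finrank_ker (pairMap N s t)
  rw [Module.finrank_prod] at this
  have h2 : Module.finrank ℂ (C.H0 N) = C.h0 N := rfl
  omega

theorem IsBPFPencil.exists_pair {A : C.Div} (h : C.IsBPFPencil A) : ∃ s ∈ C.H0 A, ∃ t ∈ C.H0 A,
    s ≠ 0 ∧ (∀ c : ℂ, t ≠ c • s) ∧ ∀ f ∈ C.H0 A, ∃ a b : ℂ, f = a • s + b • t := by
  obtain ⟨s, hs, hs0⟩ := h0_pos_iff.1 (show 0 < C.h0 A by rw [h.2]; norm_num)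
  obtain ⟨t, ht, h1, h2⟩ := exists_of_h0_eq_two h.2 hs hs0
  exact ⟨s, hs, t, ht, hs0, h1, h2⟩

theorem IsBPFPencil.two_mul_h0_le {A : C.Div} (h : C.IsBPFPencil A) (N : C.Div) :
    2 * C.h0 N ≤ C.h0 (N + A) + C.h0 (N - A) := by
  obtain ⟨s, hs, t, ht, hs0, hts, -⟩ := h.exists_pair
  have h1 := h.two_mul_h0_le_range N hs ht hs0 hts
  have h2 := Submodule.finrank_mono (pairMap_range_le (N := N) hs ht)
  have h3 : Module.finrank ℂ (C.H0 (N + A)) = C.h0 (N + A) := rfl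
  omega

end Curve

namespace Curve

variable {C : Curve}

/-! #### A bound for nodes on a curve in the cone over a pencil -/

/-- If all nontrivial combinations of two maps between spaces of the same finite dimension are
surjective, the spaces vanish. -/
theorem subsingleton_of_forall_surjective {V W : Type*} [AddCommGroup V] [AddCommGroup W]
    [Module ℂ V] [Module ℂ W] [FiniteDimensional ℂ V] [FiniteDimensional ℂ W]
    (hd : Module.finrank ℂ V = Module.finrank ℂ W) (f g : V →ₗ[ℂ] W)
    (h : ∀ a b : ℂ, (a, b) ≠ 0 → Surjective (a • f + b • g)) : Subsingleton V := by
  by_contra hV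
  rw [not_subsingleton_iff_nontrivial] at hV
  have hinj : ∀ a b : ℂ, (a, b) ≠ 0 → Injective (a • f + b • g) := fun a b hab =>
    (LinearMap.injective_iff_surjective_of_finrank_eq_finrank hd).2 (h a b hab)
  have hf : Bijective f := by
    have h1 := hinj 1 0 (by simp)
    have h2 := h 1 0 (by simp)
    rw [one_smul, zero_smul, add_zero] at h1 h2
    exact ⟨h1, h2⟩
  let e := LinearEquiv.ofBijective f hf
  obtain ⟨c, hc⟩ := Module.End.exists_eigenvalue (e.symm.toLinearMap ∘ₗ g)
  obtain ⟨v, hv⟩ := hc.exists_hasEigenvector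
  have h1 : g v = c • f v := by
    have := congrArg e hv.apply_eq_smul
    simpa [e] using this
  have h2 : ((-c) • f + (1 : ℂ) • g) v = ((-c) • f + (1 : ℂ) • g) 0 := by
    simp [h1]
  exact hv.2 (hinj (-c) 1 (by simp) h2)

theorem exists_le_of_pencil_surjective {F : Type*} [AddCommGroup F] [Module ℂ F]
    (B L : ℕ → Submodule ℂ F) (hB : ∀ k, FiniteDimensional ℂ (B k)) (f g : F →ₗ[ℂ] F)
    (hfB : ∀ k, ∀ x ∈ B k, f x ∈ B (k + 1)) (hgB : ∀ k, ∀ x ∈ B k, g x ∈ B (k + 1))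
    (hfL : ∀ k, ∀ x ∈ L k, f x ∈ L (k + 1)) (hgL : ∀ k, ∀ x ∈ L k, g x ∈ L (k + 1))
    (k₀ : ℕ) (h : ∀ k, k₀ ≤ k → ∀ a b : ℂ, (a, b) ≠ 0 → ∀ x ∈ B (k + 1),
      ∃ y ∈ B k, x - (a • f + b • g) y ∈ L (k + 1)) : ∃ k, k₀ ≤ k ∧ B k ≤ L k := by
  let Q : ℕ → Type _ := fun k => ↥(B k) ⧸ (L k).comap (B k).subtype
  have key : ∀ (φ : F →ₗ[ℂ] F) (_ : ∀ k, ∀ x ∈ B k, φ x ∈ B (k + 1))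
      (_ : ∀ k, ∀ x ∈ L k, φ x ∈ L (k + 1)) (k : ℕ), ∃ ψ : Q k →ₗ[ℂ] Q (k + 1),
      ∀ (x : F) (hx : x ∈ B k) (hx' : φ x ∈ B (k + 1)),
        ψ (Submodule.Quotient.mk ⟨x, hx⟩) = Submodule.Quotient.mk ⟨φ x, hx'⟩ := by
    intro φ h1 h2 k
    refine ⟨Submodule.mapQ _ _ (φ.restrict (h1 k)) fun x hx => h2 k x hx, fun x hx hx' => rfl⟩
  choose ψf hψf using key f hfB hfL
  choose ψg hψg using key g hgB hgL
  have hsurj : ∀ k, k₀ ≤ k → ∀ a b : ℂ, (a, b) ≠ 0 → Surjective (a • ψf k + b • ψg k) := by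
    intro k hk a b hab q
    obtain ⟨⟨x, hx⟩, rfl⟩ := Submodule.Quotient.mk_surjective _ q
    obtain ⟨y, hy, hxy⟩ := h k hk a b hab x hx
    refine ⟨Submodule.Quotient.mk ⟨y, hy⟩, ?_⟩
    rw [LinearMap.add_apply, LinearMap.smul_apply, LinearMap.smul_apply,
      hψf k y hy (hfB k y hy), hψg k y hy (hgB k y hy), ← Submodule.Quotient.mk_smul,
      ← Submodule.Quotient.mk_smul, ← Submodule.Quotient.mk_add, eq_comm, Submodule.Quotient.eq]
    exact hxy
  have hanti : ∀ k, k₀ ≤ k → Module.finrank ℂ (Q (k + 1)) ≤ Module.finrank ℂ (Q k) := by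
    intro k hk
    exact LinearMap.finrank_le_finrank_of_surjective (hsurj k hk 1 0 (by simp))
  obtain ⟨k, hk, hmin⟩ : ∃ k, k₀ ≤ k ∧ ∀ l, k₀ ≤ l →
      Module.finrank ℂ (Q k) ≤ Module.finrank ℂ (Q l) := by
    obtain ⟨k, hk, hmin⟩ := WellFounded.has_min
      (InvImage.wf (fun k => Module.finrank ℂ (Q k)) Nat.lt_wfRel.wf) {k | k₀ ≤ k} ⟨k₀, by simp⟩
    exact ⟨k, hk, fun l hl => not_lt.1 (hmin l hl)⟩
  refine ⟨k, hk, ?_⟩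
  have hsub : Subsingleton (Q k) := subsingleton_of_forall_surjective
    (le_antisymm (hmin (k + 1) (by omega)) (hanti k hk)) (ψf k) (ψg k) (hsurj k hk)
  intro x hx
  have : (Submodule.Quotient.mk ⟨x, hx⟩ : Q k) = 0 := Subsingleton.elim _ _
  exact (Submodule.Quotient.mk_eq_zero ((L k).comap (B k).subtype)).1 this

theorem deg_le_natDegree_of_aeval_mem_V {w : C.F} (n : ℕ) : ∀ (W : C.Div), 0 ≤ W →
    (∀ q, 0 < W q → w ∈ C.V q 0) →
    (∀ (c : ℂ) (q r : C.Point), q ≠ r → 1 ≤ W q → 1 ≤ W r →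
      w - algebraMap ℂ C.F c ∈ C.V q 1 → w - algebraMap ℂ C.F c ∉ C.V r 1) →
    (∀ (c : ℂ) (q : C.Point), 2 ≤ W q → w - algebraMap ℂ C.F c ∉ C.V q 2) →
    ∀ p : Polynomial ℂ, p ≠ 0 → p.natDegree = n →
    (∀ q, 0 < W q → Polynomial.aeval w p ∈ C.V q (W q)) → C.deg W ≤ n := by
  induction n with
  | zero =>
    intro W hW _ _ _ p hp hn hV
    rw [Polynomial.eq_C_of_natDegree_eq_zero hn] at hV hp
    have hc : p.coeff 0 ≠ 0 := fun h => hp (by rw [h, Polynomial.C_0])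
    have : W = 0 := by
      ext q
      by_contra hq
      have hq' : 0 < W q := lt_of_le_of_ne (hW q) (Ne.symm hq)
      have h1 := hV q hq'
      rw [Polynomial.aeval_C, mem_V_iff (by simpa using hc), C.ord_algebraMap q _ hc] at h1
      omega
    simp [this]
  | succ n ih =>
    intro W hW hw h1 h2 p hp hn hV
    obtain ⟨c, hc⟩ := IsAlgClosed.exists_root p (by
      rw [Polynomial.degree_eq_natDegree hp, hn]; exact_mod_cast Nat.succ_ne_zero n)
    obtain ⟨p', rfl⟩ := Polynomial.dvd_iff_isRoot.2 hc
    have hp' : p' ≠ 0 := right_ne_zero_of_mul hp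
    have hn' : p'.natDegree = n := by
      rw [Polynomial.natDegree_mul (Polynomial.X_sub_C_ne_zero c) hp',
        Polynomial.natDegree_X_sub_C] at hn
      omega
    have hV' : ∀ q, 0 < W q →
        (w - algebraMap ℂ C.F c) * Polynomial.aeval w p' ∈ C.V q (W q) := fun q hq => by
      simpa using hV q hq
    have hreg : ∀ q, 0 < W q → w - algebraMap ℂ C.F c ∈ C.V q 0 := fun q hq =>
      sub_mem (hw q hq) (algebraMap_mem_V q c)
    have hunit : ∀ q, 0 < W q → w - algebraMap ℂ C.F c ∉ C.V q 1 →
        Polynomial.aeval w p' ∈ C.V q (W q) := fun q hq hq' => by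
      obtain ⟨h3, h4⟩ := ord_eq_of_mem_of_notMem (hreg q hq) (by simpa using hq')
      have := hV' q hq
      rwa [← zero_add (W q), ← h4, mul_mem_V_iff h3] at this
    by_cases hex : ∃ q, 0 < W q ∧ w - algebraMap ℂ C.F c ∈ C.V q 1
    · obtain ⟨q, hq, hqc⟩ := hex
      have hle : C.pt q ≤ W := (pt_le_iff hW).2 hq
      have h5 := ih (W - C.pt q) (sub_nonneg.2 hle)
        (fun r hr => hw r (hr.trans_le (sub_pt_le W q r)))
        (fun c q' r hqr hq' hr => h1 c q' r hqr (hq'.trans (sub_pt_le W q q'))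
          (hr.trans (sub_pt_le W q r)))
        (fun c q' hq' => h2 c q' (hq'.trans (sub_pt_le W q q'))) p' hp' hn' ?_
      · rw [deg_sub, deg_pt] at h5
        push_cast
        omega
      intro r hr
      by_cases hqr : q = r
      · subst hqr
        rw [Finsupp.sub_apply, pt_self] at hr ⊢
        obtain ⟨h3, h4⟩ := ord_eq_of_mem_of_notMem hqc (h2 c q (by omega))
        have h6 := hV' q hq
        rw [← add_sub_cancel 1 (W q)] at h6
        nth_rewrite 1 [← h4] at h6
        rwa [mul_mem_V_iff h3] at h6
      · rw [Finsupp.sub_apply, pt_ne hqr, sub_zero] at hr ⊢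
        exact hunit r hr (h1 c q r hqr hq hr hqc)
    · push Not at hex
      have h5 := ih W hW hw h1 h2 p' hp' hn' fun q hq => hunit q hq (hex q hq)
      push_cast
      omega

theorem pow_mem_H0 {D : C.Div} {f : C.F} (hf : f ∈ C.H0 D) (n : ℕ) : f ^ n ∈ C.H0 (n • D) := by
  induction n with
  | zero =>
    rw [pow_zero, zero_smul, mem_H0_effective one_ne_zero, divOf_one, add_zero]
  | succ n ih => rw [pow_succ, succ_nsmul]; exact C.mul_mem_H0 ih hf

/-- The pole order at `P` of a polynomial in a function with a simple pole. -/
theorem natDegree_le_of_aeval_mem_V {P : C.Point} {w : C.F} (hw0 : w ≠ 0)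
    (hw : C.ord P w = -1) {p : Polynomial ℂ} (hp : p ≠ 0) {n : ℤ}
    (h : Polynomial.aeval w p ∈ C.V P n) : n ≤ - p.natDegree := by
  by_contra! hn
  have hsum := Polynomial.aeval_eq_sum_range (x := w) (p := p)
  rw [Finset.sum_range_succ] at hsum
  have h1 : ∑ i ∈ Finset.range p.natDegree, p.coeff i • w ^ i ∈ C.V P (-p.natDegree + 1) := by
    refine sum_mem fun i hi => Submodule.smul_mem _ _ (Or.inr ?_)
    rw [Finset.mem_range] at hi
    rw [ord_pow P hw0, hw]
    omega
  have h2 : p.coeff p.natDegree • w ^ p.natDegree ∈ C.V P (-p.natDegree + 1) := by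
    have := sub_mem (V_anti P (show -(p.natDegree : ℤ) + 1 ≤ n by omega) h) h1
    rwa [hsum, add_sub_cancel_left] at this
  have hc : p.coeff p.natDegree ≠ 0 := by simpa using hp
  rw [mem_V_iff (smul_ne_zero hc (pow_ne_zero _ hw0)), ord_smul P hc, ord_pow P hw0, hw] at h2
  omega

end Curve

namespace Curve

variable {C : Curve}

/-- The span of the monomials of weight `k` in `u, s, t` with `u`-exponent less than `m`. -/
def coneSpan (u s t : C.F) (m k : ℕ) : Submodule ℂ C.F :=
  Submodule.span ℂ {f | ∃ i a b : ℕ, i < m ∧ i + a + b = k ∧ f = u ^ i * s ^ a * t ^ b}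

section coneSpan

variable {u s t : C.F} {m k : ℕ}

theorem left_mul_mem_coneSpan {f : C.F} (hf : f ∈ coneSpan u s t m k) :
    s * f ∈ coneSpan u s t m (k + 1) := by
  refine Submodule.span_induction (p := fun f _ => s * f ∈ coneSpan u s t m (k + 1))
    ?_ (by simp) (fun x y _ _ hx hy => by rw [mul_add]; exact add_mem hx hy)
    (fun c x _ hx => by rw [mul_smul_comm]; exact Submodule.smul_mem _ _ hx) hf
  rintro _ ⟨i, a, b, hi, h, rfl⟩
  exact Submodule.subset_span ⟨i, a + 1, b, hi, by omega, by ring⟩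

theorem right_mul_mem_coneSpan {f : C.F} (hf : f ∈ coneSpan u s t m k) :
    t * f ∈ coneSpan u s t m (k + 1) := by
  refine Submodule.span_induction (p := fun f _ => t * f ∈ coneSpan u s t m (k + 1))
    ?_ (by simp) (fun x y _ _ hx hy => by rw [mul_add]; exact add_mem hx hy)
    (fun c x _ hx => by rw [mul_smul_comm]; exact Submodule.smul_mem _ _ hx) hf
  rintro _ ⟨i, a, b, hi, h, rfl⟩
  exact Submodule.subset_span ⟨i, a, b + 1, hi, by omega, by ring⟩

theorem pow_mul_pow_mem_coneSpan {i : ℕ} (hi : i < m) (α β : ℂ) (n : ℕ) :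
    u ^ i * (α • s + β • t) ^ n ∈ coneSpan u s t m (i + n) := by
  induction n with
  | zero => exact Submodule.subset_span ⟨i, 0, 0, hi, rfl, by ring⟩
  | succ n ih =>
    have : u ^ i * (α • s + β • t) ^ (n + 1) =
        α • (s * (u ^ i * (α • s + β • t) ^ n)) + β • (t * (u ^ i * (α • s + β • t) ^ n)) := by
      simp only [Algebra.smul_def]; ring
    rw [this]
    exact add_mem (Submodule.smul_mem _ _ (left_mul_mem_coneSpan ih))
      (Submodule.smul_mem _ _ (right_mul_mem_coneSpan ih))

theorem finrank_coneSpan_le (u s t : C.F) (m k : ℕ) :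
    Module.finrank ℂ (coneSpan u s t m k) ≤ ∑ i ∈ Finset.range m, (k - i + 1) := by
  classical
  let S : Finset C.F := ((Finset.range m).sigma fun i => Finset.range (k - i + 1)).image
    fun p => u ^ p.1 * s ^ p.2 * t ^ (k - p.1 - p.2)
  have h1 : coneSpan u s t m k ≤ Submodule.span ℂ (S : Set C.F) := by
    refine Submodule.span_mono ?_
    rintro _ ⟨i, a, b, hi, h, rfl⟩
    rw [Finset.mem_coe, Finset.mem_image]
    refine ⟨⟨i, a⟩, ?_, ?_⟩
    · simp only [Finset.mem_sigma, Finset.mem_range]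
      omega
    · obtain rfl : b = k - i - a := by omega
      rfl
  refine (Submodule.finrank_mono h1).trans ((finrank_span_finset_le_card S).trans ?_)
  refine Finset.card_image_le.trans ?_
  simp

end coneSpan

theorem two_mul_sum_range (m k : ℕ) (h : m ≤ k) :
    2 * ((∑ i ∈ Finset.range m, (k - i + 1) : ℕ) : ℤ) = 2 * m * (k + 1) - m * (m - 1) := by
  induction m with
  | zero => simp
  | succ m ih =>
    have := ih (by omega)
    rw [Finset.sum_range_succ]
    push_cast [Nat.cast_sub (show m ≤ k by omega)] at this ⊢
    linarith

theorem nodes_le {A : C.Div} (hA : C.IsBPFPencil A) {m : ℕ} (hm : C.deg A = m) (hm1 : 1 ≤ m)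
    (τ : Finset C.Point) {u : C.F} (hu : u ∈ C.H0 (A + C.divOfFinset τ))
    (hpole : ∀ P ∈ τ, u ∉ C.V P (-A P))
    (h1 : ∀ s ∈ C.H0 A, s ≠ 0 → ∀ P ∈ τ, ∀ Q ∈ τ, P ≠ Q → s ∉ C.H0 (A - C.pt P - C.pt Q))
    (h2 : ∀ s ∈ C.H0 A, s ≠ 0 → ∀ s' ∈ C.H0 A, (∀ c : ℂ, s' ≠ c • s) → ∀ q ∉ τ, ∀ r ∉ τ,
      s ∈ C.H0 (A - C.pt q - C.pt r) → ∀ c : ℂ,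
        u - c • s' ∉ C.H0 (A + C.divOfFinset τ - C.pt q - C.pt r)) :
    2 * (((m : ℤ) - 1) * τ.card + 1 - C.genus) ≤ 2 * m - m * (m - 1) := by
  classical
  set T := C.divOfFinset τ with hT
  have hT_apply : ∀ P, T P = if P ∈ τ then 1 else 0 := by
    intro P
    rw [hT, PreCurve.divOfFinset, Finsupp.finsetSum_apply]
    simp only [PreCurve.pt, Finsupp.single_apply]
    simp
  have hT0 : 0 ≤ T := fun P => by rw [hT_apply]; split_ifs <;> simp
  have hTdeg : C.deg T = τ.card := by
    rw [hT, PreCurve.divOfFinset, deg_sum]; simp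
  obtain ⟨s₀, hs₀, t₀, ht₀, hs₀0, hst, hspan⟩ := hA.exists_pair
  let D : ℕ → C.Div := fun k => (m - 1) • T + k • A
  have hLB : ∀ k, coneSpan u s₀ t₀ m k ≤ C.H0 (D k) := by
    intro k
    rw [coneSpan, Submodule.span_le]
    rintro _ ⟨i, a, b, hi, hk, rfl⟩
    refine C.H0_mono (D := i • (A + T) + a • A + b • A) ?_
      (C.mul_mem_H0 (C.mul_mem_H0 (pow_mem_H0 hu i) (pow_mem_H0 hs₀ a)) (pow_mem_H0 ht₀ b))
    have : i • (A + T) + a • A + b • A ≤ D k := by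
      have h3 : i • (A + T) + a • A + b • A = i • T + k • A := by
        rw [← hk]; simp only [add_smul, smul_add]; abel
      rw [h3]
      exact add_le_add_left (nsmul_le_nsmul_left hT0 (by omega)) _
    exact this
  -- the fibrewise independence
  have hindep : ∀ s ∈ C.H0 A, s ≠ 0 → ∀ s' ∈ C.H0 A, (∀ c : ℂ, s' ≠ c • s) → ∀ k,
      ∀ p : Polynomial ℂ, p ≠ 0 → p.natDegree < m →
      s' ^ k * Polynomial.aeval (u / s') p ∉ C.H0 (D k - (A + C.divOf s)) := by
    intro s hs hs0 s' hs' hss' k p hp hpm hG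
    have hs'0 := ne_zero_of_forall_ne_smul hss'
    set Z := A + C.divOf s with hZ
    set w := u / s' with hw
    have hZ0 : 0 ≤ Z := (mem_H0_effective hs0).1 hs
    have hZV : ∀ q n, n ≤ Z q → s ∈ C.V q (-A q + n) := fun q n hn => by
      rw [hZ, Finsupp.add_apply, divOf_apply hs0] at hn
      exact Or.inr (by omega)
    have hs'q : ∀ q, 0 < Z q → C.ord q s' = -A q := fun q hq => by
      refine (ord_eq_of_mem_of_notMem (mem_H0_iff.1 hs' q) fun h => ?_).2
      exact hA.no_common_zero hs0 hss' (mem_H0_sub_pt.2 ⟨hs, hZV q 1 hq⟩)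
        (mem_H0_sub_pt.2 ⟨hs', h⟩)
    have hGV : ∀ q, 0 < Z q →
        Polynomial.aeval w p ∈ C.V q (Z q - (m - 1 : ℕ) * T q) := fun q hq => by
      have h3 := mem_H0_iff.1 hG q
      have h4 : -(D k - Z) q = C.ord q (s' ^ k) + (Z q - (m - 1 : ℕ) * T q) := by
        rw [ord_pow q hs'0, hs'q q hq]
        simp only [D, Finsupp.sub_apply, Finsupp.add_apply, Finsupp.smul_apply, nsmul_eq_mul]
        ring
      rwa [h4, mul_mem_V_iff (pow_ne_zero k hs'0)] at h3
    have hwq : ∀ q, 0 < Z q → ∀ (n : ℤ) (c : ℂ), w - algebraMap ℂ C.F c ∈ C.V q n →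
        u - c • s' ∈ C.V q (-A q + n) := fun q hq n c h => by
      rw [← hs'q q hq, Algebra.smul_def]
      have h3 : u - algebraMap ℂ C.F c * s' = s' * (w - algebraMap ℂ C.F c) := by
        rw [hw, mul_sub, mul_div_cancel₀ _ hs'0, mul_comm s']
      rwa [h3, mul_mem_V_iff hs'0]
    have hwreg : ∀ q, 0 < Z q → q ∉ τ → w ∈ C.V q 0 := fun q hq hqτ => by
      have h3 := mem_H0_iff.1 hu q
      rw [Finsupp.add_apply, hT_apply, if_neg hqτ, add_zero] at h3
      have h4 : u = s' * w := by rw [hw, mul_div_cancel₀ _ hs'0]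
      rwa [h4, ← hs'q q hq, ← add_zero (C.ord q s'), mul_mem_V_iff hs'0] at h3
    obtain ⟨W, hWapp⟩ : ∃ W : C.Div, ∀ q, W q = if q ∈ τ then 0 else Z q :=
      ⟨Z.filter fun q => q ∉ τ, fun q => by
        rw [Finsupp.filter_apply]
        split_ifs <;> simp_all⟩
    have hWle : ∀ q, W q ≤ Z q := fun q => by
      rw [hWapp]
      split_ifs
      · exact hZ0 q
      · exact le_rfl
    have hW0 : 0 ≤ W := fun q => by
      rw [hWapp]
      split_ifs
      · exact le_rfl
      · exact hZ0 q
    have hWτ : ∀ q, 0 < W q → q ∉ τ := fun q hq hqτ => by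
      rw [hWapp, if_pos hqτ] at hq
      exact lt_irrefl _ hq
    have hWZ : ∀ q, 0 < W q → W q = Z q := fun q hq => by
      rw [hWapp, if_neg (hWτ q hq)]
    have hbad : ∀ (c : ℂ) (q r : C.Point), 0 < W q → 0 < W r →
        s ∈ C.H0 (A - C.pt q - C.pt r) → u - c • s' ∈ C.V q (-A q + 1) →
        u - c • s' ∈ C.V r (-A r + C.pt q r + 1) → False := by
      intro c q r hq hr hs3 hu1 hu2
      refine h2 s hs hs0 s' hs' hss' q (hWτ q hq) r (hWτ r hr) hs3 c ?_
      have hTq : T q = 0 := by rw [hT_apply, if_neg (hWτ q hq)]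
      have hTr : T r = 0 := by rw [hT_apply, if_neg (hWτ r hr)]
      refine mem_H0_sub_pt.2 ⟨mem_H0_sub_pt.2 ⟨sub_mem hu (Submodule.smul_mem _ _
        (C.H0_mono (fun P => ?_) hs')), ?_⟩, ?_⟩
      · simpa using hT0 P
      · rwa [Finsupp.add_apply, hTq, add_zero]
      · convert hu2 using 2
        rw [Finsupp.sub_apply, Finsupp.add_apply, hTr]
        ring
    have hdegW := deg_le_natDegree_of_aeval_mem_V p.natDegree W hW0
      (fun q hq => hwreg q (hWZ q hq ▸ hq) (hWτ q hq)) ?_ ?_ p hp rfl ?_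
    · by_cases hex : ∃ P ∈ τ, 0 < Z P
      · obtain ⟨P, hPτ, hP⟩ := hex
        have huniq : ∀ Q ∈ τ, Q ≠ P → Z Q = 0 := by
          intro Q hQ hne
          by_contra hQ0
          have hQ0' : 0 < Z Q := lt_of_le_of_ne (hZ0 Q) (Ne.symm hQ0)
          refine h1 s hs hs0 P hPτ Q hQ hne.symm
            (mem_H0_sub_pt.2 ⟨mem_H0_sub_pt.2 ⟨hs, hZV P 1 hP⟩, ?_⟩)
          rw [Finsupp.sub_apply, pt_ne hne.symm, sub_zero]
          exact hZV Q 1 hQ0'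
        have hZW : Z = W + Finsupp.single P (Z P) := by
          ext Q
          change Z Q = W Q + Finsupp.single P (Z P) Q
          rw [Finsupp.single_apply, hWapp]
          by_cases hQ : Q ∈ τ
          · rw [if_pos hQ, zero_add]
            split_ifs with hPQ
            · rw [hPQ]
            · exact huniq Q hQ (Ne.symm hPQ)
          · rw [if_neg hQ, if_neg (fun h : P = Q => hQ (h ▸ hPτ)), add_zero]
        have hdegZ : C.deg Z = m := by rw [hZ, deg_add, deg_divOf, hm, add_zero]
        have hsingle : C.deg (Finsupp.single P (Z P)) = Z P := by
          simp [PreCurve.deg]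
        rw [hZW, deg_add, hsingle] at hdegZ
        have hu3 : u ∈ C.V P (-A P - 1) := by
          have := mem_H0_iff.1 hu P
          rwa [Finsupp.add_apply, hT_apply, if_pos hPτ, neg_add, ← sub_eq_add_neg] at this
        obtain ⟨hu0, hu4⟩ := ord_eq_of_mem_of_notMem hu3 (by
          rw [sub_add_cancel]; exact hpole P hPτ)
        have hw0 : w ≠ 0 := div_ne_zero hu0 hs'0
        have hwP : C.ord P w = -1 := by
          rw [hw, ord_div P hu0 hs'0, hu4, hs'q P hP]; ring
        have h5 := natDegree_le_of_aeval_mem_V hw0 hwP hp (hGV P hP)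
        rw [hT_apply, if_pos hPτ] at h5
        have h6 : ((m - 1 : ℕ) : ℤ) = m - 1 := by omega
        rw [h6] at h5
        linarith
      · push Not at hex
        have hZW : Z = W := by
          ext Q
          change Z Q = W Q
          rw [hWapp]
          split_ifs with hQ
          · exact le_antisymm (hex Q hQ) (hZ0 Q)
          · rfl
        have hdegZ : C.deg Z = m := by rw [hZ, deg_add, deg_divOf, hm, add_zero]
        rw [hZW] at hdegZ
        omega
    · intro c q r hqr hq hr hcq hcr
      have hq' := hWZ q hq ▸ hq
      have hr' := hWZ r hr ▸ hr
      refine hbad c q r hq hr (mem_H0_sub_pt.2 ⟨mem_H0_sub_pt.2 ⟨hs, hZV q 1 hq'⟩, ?_⟩)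
        (hwq q hq' 1 c hcq) ?_
      · rw [Finsupp.sub_apply, pt_ne hqr, sub_zero]
        exact hZV r 1 hr'
      · rw [pt_ne hqr, add_zero]
        exact hwq r hr' 1 c hcr
    · intro c q hq hcq
      have hq0 : 0 < W q := by omega
      have hq' := hWZ q hq0 ▸ hq
      refine hbad c q q hq0 hq0
        (mem_H0_sub_pt.2 ⟨mem_H0_sub_pt.2 ⟨hs, hZV q 1 (by omega)⟩, ?_⟩)
        (hwq q (by omega) 1 c (V_anti q (by norm_num) hcq)) ?_
      · rw [Finsupp.sub_apply, pt_self]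
        convert hZV q 2 hq' using 2
        ring
      · rw [pt_self]
        convert hwq q (by omega) 2 c hcq using 2
        ring
    · intro q hq
      have := hGV q (hWZ q hq ▸ hq)
      rwa [hT_apply, if_neg (hWτ q hq), mul_zero, sub_zero, ← hWZ q hq] at this
  -- sections of `D (k + 1)` modulo the cone are divisible by any section of the pencil
  have hsurj : ∀ k, m ≤ k → ∀ a b : ℂ, (a, b) ≠ 0 → ∀ f ∈ C.H0 (D (k + 1)),
      ∃ y ∈ C.H0 (D k), f - (a • s₀ + b • t₀) * y ∈ coneSpan u s₀ t₀ m (k + 1) := by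
    intro k hk a b hab f hf
    set s := a • s₀ + b • t₀ with hsdef
    have hs : s ∈ C.H0 A := add_mem (Submodule.smul_mem _ _ hs₀) (Submodule.smul_mem _ _ ht₀)
    have hs0 : s ≠ 0 := by
      intro h
      by_cases hb : b = 0
      · subst hb
        have ha : a ≠ 0 := fun ha => hab (by simp [ha])
        rw [zero_smul, add_zero] at hsdef
        rw [hsdef] at h
        exact smul_ne_zero ha hs₀0 h
      · refine hst (-(b⁻¹ * a)) ?_
        rw [neg_smul, mul_smul, eq_neg_iff_add_eq_zero, add_comm]
        have := congrArg (b⁻¹ • ·) h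
        simpa [hsdef, smul_smul, hb] using this
    obtain ⟨s', hs', hss', -⟩ := exists_of_h0_eq_two hA.2 hs hs0
    obtain ⟨α, β, hαβ⟩ := hspan s' hs'
    have hs'0 := ne_zero_of_forall_ne_smul hss'
    have hcone : ∀ p ∈ Polynomial.degreeLT ℂ m,
        s' ^ (k + 1) * Polynomial.aeval (u / s') p ∈ coneSpan u s₀ t₀ m (k + 1) := by
      intro p hp
      rw [Polynomial.aeval_eq_sum_range, Finset.mul_sum]
      refine sum_mem fun i hi => ?_
      rw [mul_smul_comm]
      by_cases hpi : p.coeff i = 0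
      · simp [hpi]
      have him : i < m := by
        have h3 := Polynomial.le_natDegree_of_ne_zero hpi
        rw [Polynomial.mem_degreeLT] at hp
        have := (Polynomial.natDegree_lt_iff_degree_lt (fun h => hpi (by simp [h]))).2 hp
        omega
      refine Submodule.smul_mem _ _ ?_
      have h3 : s' ^ (k + 1) * (u / s') ^ i = u ^ i * s' ^ (k + 1 - i) := by
        rw [div_pow, pow_sub₀ _ hs'0 (by omega)]
        field_simp
      rw [h3, hαβ]
      have := pow_mul_pow_mem_coneSpan (u := u) (s := s₀) (t := t₀) him α β (k + 1 - i)
      rwa [Nat.add_sub_cancel' (by omega : i ≤ k + 1)] at this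
    let G := D (k + 1)
    let Z := A + C.divOf s
    let Φ : (C.H0 (G - Z) × Polynomial.degreeLT ℂ m) →ₗ[ℂ] C.F :=
      LinearMap.coprod (C.H0 (G - Z)).subtype
        ((LinearMap.mulLeft ℂ (s' ^ (k + 1))) ∘ₗ (Polynomial.aeval (u / s')).toLinearMap ∘ₗ
          (Polynomial.degreeLT ℂ m).subtype)
    have hΦ : ∀ a p,
        Φ (a, p) = (a : C.F) + s' ^ (k + 1) * Polynomial.aeval (u / s') (p : Polynomial ℂ) :=
      fun a p => rfl
    have hZ0 : 0 ≤ Z := (mem_H0_effective hs0).1 hs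
    have hinj : LinearMap.ker Φ = ⊥ := by
      rw [LinearMap.ker_eq_bot']
      rintro ⟨⟨y, hy⟩, ⟨p, hp⟩⟩ h0
      rw [hΦ] at h0
      change y + s' ^ (k + 1) * Polynomial.aeval (u / s') p = 0 at h0
      have hp0 : p = 0 := by
        by_contra hp0
        refine hindep s hs hs0 s' hs' hss' (k + 1) p hp0 ?_ ?_
        · rw [Polynomial.mem_degreeLT] at hp
          exact (Polynomial.natDegree_lt_iff_degree_lt hp0).2 hp
        · rw [← neg_eq_of_add_eq_zero_right h0]
          exact neg_mem hy
      subst hp0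
      have hy0 : y = 0 := by simpa using h0
      subst hy0
      rfl
    have hle : LinearMap.range Φ ≤ C.H0 G := by
      rintro _ ⟨⟨y, p⟩, rfl⟩
      rw [hΦ]
      exact add_mem (C.H0_mono (fun P => sub_le_self G hZ0 P) y.2) (hLB _ (hcone p p.2))
    have : FiniteDimensional ℂ (Polynomial.degreeLT ℂ m) :=
      (Polynomial.degreeLTEquiv ℂ m).symm.finiteDimensional
    have hrange : LinearMap.range Φ = C.H0 G := by
      refine Submodule.eq_of_le_of_finrank_le hle ?_
      have h3 := LinearMap.finrank_range_add_finrank_ker Φ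
      rw [hinj, finrank_bot, add_zero, Module.finrank_prod,
        (Polynomial.degreeLTEquiv ℂ m).finrank_eq, Module.finrank_fin_fun] at h3
      rw [h3]
      have h4 := h0_le_add_deg hZ0 G
      rw [show C.deg Z = m by rw [deg_add, deg_divOf, hm, add_zero]] at h4
      exact_mod_cast h4
    rw [← hrange] at hf
    obtain ⟨⟨⟨y, hy⟩, ⟨p, hp⟩⟩, rfl⟩ := hf
    refine ⟨y / s, ?_, ?_⟩
    · rw [show y = s * (y / s) by field_simp, mul_mem_H0_iff hs0] at hy
      convert hy using 2
      simp only [G, Z, D, succ_nsmul]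
      abel
    · rw [hΦ, mul_div_cancel₀ _ hs0]
      change y + _ - y ∈ _
      rw [add_sub_cancel_left]
      exact hcone p hp
  obtain ⟨k, hk, hle⟩ := exists_le_of_pencil_surjective (fun k => C.H0 (D k))
    (fun k => coneSpan u s₀ t₀ m k) (fun k => inferInstance) (LinearMap.mulLeft ℂ s₀)
    (LinearMap.mulLeft ℂ t₀)
    (fun k x hx => by
      have := C.mul_mem_H0 hs₀ hx
      rwa [show A + D k = D (k + 1) by simp only [D, succ_nsmul]; abel] at this)
    (fun k x hx => by
      have := C.mul_mem_H0 ht₀ hx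
      rwa [show A + D k = D (k + 1) by simp only [D, succ_nsmul]; abel] at this)
    (fun k x hx => left_mul_mem_coneSpan hx) (fun k x hx => right_mul_mem_coneSpan hx) m
    (fun k hk a b hab f hf => by
      obtain ⟨y, hy, h3⟩ := hsurj k hk a b hab f hf
      refine ⟨y, hy, ?_⟩
      convert h3 using 2
      simp [add_mul])
  have h3 : FiniteDimensional ℂ (coneSpan u s₀ t₀ m k) := Submodule.finiteDimensional_of_le (hLB k)
  have h4 := (Submodule.finrank_mono hle).trans (finrank_coneSpan_le u s₀ t₀ m k)
  have h5 := C.riemann_roch (D k)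
  have h6 : C.deg (D k) = ((m : ℤ) - 1) * τ.card + k * m := by
    simp only [D, deg_add, deg_nsmul, hTdeg, hm]
    rw [Nat.cast_sub hm1]
    push_cast
    ring
  have h7 := two_mul_sum_range m k hk
  have h8 : (C.h0 (D k) : ℤ) ≤ ((∑ i ∈ Finset.range m, (k - i + 1) : ℕ) : ℤ) := by
    exact_mod_cast h4
  rw [h6] at h5
  nlinarith

end Curve

namespace Curve

variable {C : Curve}

theorem exists_smul_of_h0_le_one {D : C.Div} (h : C.h0 D ≤ 1) {f g : C.F} (hf : f ∈ C.H0 D)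
    (hf0 : f ≠ 0) (hg : g ∈ C.H0 D) : ∃ c : ℂ, g = c • f := by
  obtain ⟨e, he, he0, hc⟩ := exists_unique_section (D := D)
    (le_antisymm h (h0_pos_iff.2 ⟨f, hf, hf0⟩))
  obtain ⟨a, rfl⟩ := hc f hf
  obtain ⟨b, rfl⟩ := hc g hg
  have ha : a ≠ 0 := fun ha => hf0 (by rw [ha, zero_smul])
  exact ⟨b / a, by rw [smul_smul, div_mul_cancel₀ _ ha]⟩

theorem two_le_h0 {D : C.Div} {f g : C.F} (hf : f ∈ C.H0 D) (hf0 : f ≠ 0) (hg : g ∈ C.H0 D)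
    (hfg : ∀ c : ℂ, g ≠ c • f) : 2 ≤ C.h0 D := by
  by_contra! h
  obtain ⟨c, hc⟩ := exists_smul_of_h0_le_one (by omega) hf hf0 hg
  exact hfg c hc

theorem divOfFinset_singleton (P : C.Point) : C.divOfFinset {P} = C.pt P := by
  simp [PreCurve.divOfFinset]

/-- A birational net of degree `g + 1` maps the curve onto a singular plane curve. -/
theorem exists_node [IsGeneral C] {M : C.Div} (hM : C.deg M = C.genus + 1) (hM3 : C.h0 M = 3)
    (hMq : ∀ q, C.h0 (M - C.pt q) = 2) : ∃ q r, 2 ≤ C.h0 (M - C.pt q - C.pt r) := by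
  by_contra! hno
  have hg := five_le_genus C
  let s : C.Point := Classical.arbitrary _
  have hA : C.IsBPFPencil (M - C.pt s) := by
    refine ⟨fun P => ?_, hMq s⟩
    have h1 := hno s P
    have h2 := h0_le_sub_pt (M - C.pt s) P
    rw [hMq] at h2 ⊢
    omega
  obtain ⟨u, hu, hus⟩ : ∃ u ∈ C.H0 M, u ∉ C.H0 (M - C.pt s) := by
    by_contra! h
    have h1 : C.h0 M ≤ C.h0 (M - C.pt s) := Submodule.finrank_mono h
    rw [hMq] at h1
    omega
  have hAT : M - C.pt s + C.divOfFinset {s} = M := by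
    rw [divOfFinset_singleton, sub_add_cancel]
  have h := nodes_le hA (m := C.genus) (by rw [deg_sub, deg_pt, hM]; ring) (by omega) {s}
    (u := u) (by rwa [hAT]) ?_ ?_ ?_
  · rw [Finset.card_singleton] at h
    push_cast at h
    have : (5 : ℤ) ≤ C.genus := by exact_mod_cast hg
    nlinarith
  · intro P hP h
    rw [Finset.mem_singleton.1 hP] at h
    refine hus (mem_H0_sub_pt.2 ⟨hu, ?_⟩)
    convert h using 2
    rw [Finsupp.sub_apply, pt_self]
    ring
  · intro f _ _ P hP Q hQ hPQ
    exact absurd ((Finset.mem_singleton.1 hP).trans (Finset.mem_singleton.1 hQ).symm) hPQ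
  · intro f hf hf0 f' hf' hff' q hq r hr hfqr c hc
    rw [hAT] at hc
    have hle : M - C.pt s - C.pt q - C.pt r ≤ M - C.pt q - C.pt r :=
      sub_le_sub_right (sub_le_sub_right (sub_pt_le M s) _) _
    have h2 := two_le_h0 (C.H0_mono (fun P => hle P) hfqr) hf0 hc fun a ha => hus ?_
    · have := hno q r
      omega
    · rw [sub_eq_iff_eq_add.1 ha]
      exact add_mem (Submodule.smul_mem _ _ hf) (Submodule.smul_mem _ _ hf')

theorem exists_of_genus_eq_five [IsGeneral C] (hg : C.genus = 5) :
    ∃ D : C.Div, C.deg D = (C.genus : ℤ) - 1 ∧ C.IsBPFPencil D ∧ C.IsBPFPencil (C.K - D) := by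
  let P : C.Point := Classical.arbitrary _
  have hdeg : C.deg (C.pt P + C.pt P) = 2 := by rw [deg_add, deg_pt]; norm_num
  have h1 : ∀ E : C.Div, 0 ≤ E → C.deg E ≤ 3 → C.h0 E = 1 := fun E hE hE3 =>
    le_antisymm (h0_le_one hE3) (h0_pos_of_effective hE)
  have hE : 0 ≤ C.pt P + C.pt P := add_nonneg (pt_nonneg P) (pt_nonneg P)
  obtain ⟨q, r, hqr⟩ := exists_node (M := C.K - (C.pt P + C.pt P))
    (by rw [deg_sub, deg_K, hdeg, hg]; norm_num)
    (by
      have := h0_K_sub (C.pt P + C.pt P)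
      rw [h1 _ hE (by omega), hdeg, hg] at this
      omega)
    (fun q => by
      have h2 : C.deg (C.pt P + C.pt P + C.pt q) = 3 := by rw [deg_add, hdeg, deg_pt]; norm_num
      have := h0_K_sub (C.pt P + C.pt P + C.pt q)
      rw [h1 _ (add_nonneg hE (pt_nonneg q)) (by omega), h2, hg, ← sub_sub] at this
      omega)
  set D := C.pt P + C.pt P + C.pt q + C.pt r with hD
  have hdegD : C.deg D = 4 := by
    rw [hD, deg_add, deg_add, hdeg, deg_pt, deg_pt]; norm_num
  have hKD : C.K - (C.pt P + C.pt P) - C.pt q - C.pt r = C.K - D := by rw [hD]; abel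
  rw [hKD] at hqr
  have h2 := C.riemann_roch D
  rw [hdegD, hg] at h2
  refine ⟨D, by rw [hdegD, hg]; norm_num, isBPFPencil_of_deg_eq_four hdegD (by omega),
    isBPFPencil_of_deg_eq_four ?_ hqr⟩
  rw [deg_sub, deg_K, hdegD, hg]
  norm_num

end Curve

namespace Curve

variable {C : Curve}

theorem mem_H0_sub_of_le_max {D Z Z₁ Z₂ : C.Div} {f : C.F} (h₁ : f ∈ C.H0 (D - Z₁))
    (h₂ : f ∈ C.H0 (D - Z₂)) (h : ∀ P, Z P ≤ max (Z₁ P) (Z₂ P)) : f ∈ C.H0 (D - Z) := by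
  rw [mem_H0_iff] at *
  intro P
  rcases le_max_iff.1 (h P) with h | h
  · exact V_anti P (by simp only [Finsupp.sub_apply]; omega) (h₁ P)
  · exact V_anti P (by simp only [Finsupp.sub_apply]; omega) (h₂ P)

theorem mem_H0_sub_add {D Z₁ Z₂ : C.Div} {f : C.F} (h₁ : f ∈ C.H0 (D - Z₁))
    (h₂ : f ∈ C.H0 (D - Z₂)) (h1 : 0 ≤ Z₁) (h2 : 0 ≤ Z₂) (h : ∀ P, Z₁ P = 0 ∨ Z₂ P = 0) :
    f ∈ C.H0 (D - (Z₁ + Z₂)) := by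
  refine mem_H0_sub_of_le_max h₁ h₂ fun P => ?_
  have h3 := h1 P
  have h4 := h2 P
  rw [Finsupp.zero_apply] at h3 h4
  rw [Finsupp.add_apply, le_max_iff]
  rcases h P with h | h <;> omega

theorem pt_apply (P Q : C.Point) [Decidable (P = Q)] : C.pt P Q = if P = Q then 1 else 0 := by
  rw [PreCurve.pt, Finsupp.single_apply]

theorem finite_zeros {f : C.F} (hf : f ≠ 0) (D : C.Div) : {P | f ∈ C.H0 (D - C.pt P)}.Finite := by
  refine (D + C.divOf f).support.finite_toSet.subset fun P hP => ?_
  have h := (mem_H0_sub hf).1 hP P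
  rw [pt_self] at h
  simp only [Finset.mem_coe, Finsupp.mem_support_iff]
  omega

theorem h0_sub_pt_finite {D : C.Div} (h : 0 < C.h0 D) :
    {P | C.h0 (D - C.pt P) = C.h0 D}.Finite := by
  obtain ⟨f, hf, hf0⟩ := h0_pos_iff.1 h
  refine (finite_zeros hf0 D).subset fun P hP => ?_
  rw [Set.mem_ofPred_eq, H0_eq_of_le (sub_pt_le D P) (le_of_eq (Eq.symm hP))]
  exact hf

variable (C) in
/-- The divisor is of degree four and moves. -/
def IsTetragonal (A : C.Div) : Prop := C.deg A = 4 ∧ 2 ≤ C.h0 A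

theorem IsTetragonal.congr {A B : C.Div} (h : C.IsTetragonal A) (hAB : C.LinEquiv B A) :
    C.IsTetragonal B := ⟨by rw [hAB.deg_eq, h.1], by rw [hAB.h0_eq]; exact h.2⟩

theorem h0_sub_eq_zero {A A' : C.Div} (h : C.deg A = C.deg A') (hne : ¬ C.LinEquiv A A') :
    C.h0 (A - A') = 0 := by
  by_contra h0
  refine hne (PreCurve.LinEquiv.of_sub
    (linEquiv_zero_of_deg (Nat.pos_of_ne_zero h0) (by rw [deg_sub, h, sub_self])) (sub_zero _))

section General

variable [IsGeneral C]

theorem IsTetragonal.isBPFPencil {A : C.Div} (h : C.IsTetragonal A) : C.IsBPFPencil A :=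
  isBPFPencil_of_deg_eq_four h.1 h.2

/-- An analogue of Clifford's bound for degree `2 * k`, in the presence of a tetragonal pencil. -/
theorem IsTetragonal.h0_le_of_deg {A : C.Div} (hA : C.IsTetragonal A) (k : ℕ) (hk1 : 1 ≤ k)
    (hk : k + 2 ≤ C.genus) {N : C.Div} (hN : C.deg N = 2 * k) : C.h0 N ≤ k := by
  induction k using Nat.strong_induction_on generalizing N with
  | _ k ih =>
  rcases (show k = 1 ∨ k = 2 ∨ 3 ≤ k by omega) with rfl | rfl | hk3
  · exact h0_le_one (by rw [hN]; norm_num)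
  · exact h0_le_two_of_deg_le_four (by rw [hN]; norm_num)
  by_contra! h
  have h1 : C.h0 (N - A) ≤ k - 2 := ih (k - 2) (by omega) (by omega) (by omega) (by
    rw [deg_sub, hN, hA.1]
    push_cast [Nat.cast_sub (show 2 ≤ k by omega)]
    ring)
  have h2 : ∀ j : ℕ, k + 1 + 3 * j ≤ C.h0 (N + j • A) ∧
      C.h0 (N + j • A) + 3 ≤ C.h0 (N + (j + 1) • A) := by
    intro j
    induction j with
    | zero =>
      have := hA.isBPFPencil.two_mul_h0_le N
      simp only [zero_smul, add_zero, zero_add, one_smul, mul_zero]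
      omega
    | succ j ihj =>
      have := hA.isBPFPencil.two_mul_h0_le (N + (j + 1) • A)
      rw [add_assoc, ← succ_nsmul,
        show N + (j + 1) • A - A = N + j • A by rw [succ_nsmul]; abel] at this
      omega
  have h3 := (h2 (C.genus - k - 1)).1
  have h4 := C.riemann_roch (N + (C.genus - k - 1) • A)
  have h5 : C.deg (N + (C.genus - k - 1) • A) = 2 * k + 4 * (C.genus - k - 1 : ℕ) := by
    rw [deg_add, deg_nsmul, hN, hA.1]; ring
  have h6 : C.h0 (C.K - (N + (C.genus - k - 1) • A)) = 0 := by
    refine h0_eq_zero_of_deg_neg ?_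
    rw [deg_sub, deg_K, h5]
    omega
  rw [h5, h6] at h4
  omega

theorem IsTetragonal.h0_add {A A' : C.Div} (hA : C.IsTetragonal A) (hA' : C.IsTetragonal A')
    (hg : 6 ≤ C.genus) (hne : ¬ C.LinEquiv A A') : C.h0 (A + A') = 4 := by
  have h1 := hA'.isBPFPencil.two_mul_h0_le A
  rw [h0_sub_eq_zero (by rw [hA.1, hA'.1]) hne, hA.isBPFPencil.2] at h1
  have h2 := hA.h0_le_of_deg 4 (by norm_num) (by omega) (N := A + A')
    (by rw [deg_add, hA.1, hA'.1]; norm_num)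
  omega

end General

end Curve

namespace Curve

variable {C : Curve}

theorem exists_mem_inf {D D₁ D₂ : C.Div} (h₁ : D₁ ≤ D) (h₂ : D₂ ≤ D)
    (h : C.h0 D < C.h0 D₁ + C.h0 D₂) : ∃ f, f ≠ 0 ∧ f ∈ C.H0 D₁ ∧ f ∈ C.H0 D₂ := by
  by_contra! hc
  have h3 : C.H0 D₁ ⊓ C.H0 D₂ = ⊥ := by
    rw [Submodule.eq_bot_iff]
    rintro f ⟨hf1, hf2⟩
    by_contra hf
    exact hc f hf hf1 hf2
  have h4 := Submodule.finrank_sup_add_finrank_inf_eq (C.H0 D₁) (C.H0 D₂)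
  rw [h3, finrank_bot, add_zero] at h4
  have h5 : Module.finrank ℂ ↥(C.H0 D₁ ⊔ C.H0 D₂) ≤ C.h0 D :=
    Submodule.finrank_mono (sup_le (C.H0_mono fun P => h₁ P) (C.H0_mono fun P => h₂ P))
  have h6 : Module.finrank ℂ (C.H0 D₁) = C.h0 D₁ := rfl
  have h7 : Module.finrank ℂ (C.H0 D₂) = C.h0 D₂ := rfl
  omega

variable (C) in
/-- There are infinitely many classes of tetragonal pencils. -/
class IsExceptional : Prop extends IsGeneral C where
  six_le_genus : 6 ≤ C.genus
  exists_tetragonal : ∀ S : Finset C.Div, ∃ A, C.IsTetragonal A ∧ ∀ B ∈ S, ¬ C.LinEquiv A B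

section Exceptional

variable [IsExceptional C]

theorem exists_avoiding {ι : Type*} {S : Set ι} (hS : S.Finite) (R : ι → C.Div → Prop)
    (hR : ∀ x ∈ S, ∀ A B, C.IsTetragonal A → C.IsTetragonal B → R x A → R x B → C.LinEquiv A B)
    (T : Finset C.Div) :
    ∃ A, C.IsTetragonal A ∧ (∀ x ∈ S, ¬ R x A) ∧ ∀ B ∈ T, ¬ C.LinEquiv A B := by
  classical
  let b : ι → C.Div := fun x =>
    if h : ∃ B, C.IsTetragonal B ∧ R x B then h.choose else 0
  obtain ⟨A, hA, h⟩ := IsExceptional.exists_tetragonal (C := C) (T ∪ hS.toFinset.image b)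
  refine ⟨A, hA, fun x hx hxA => ?_, fun B hB => h B (Finset.mem_union_left _ hB)⟩
  have hex : ∃ B, C.IsTetragonal B ∧ R x B := ⟨A, hA, hxA⟩
  refine h (b x) (Finset.mem_union_right _ (Finset.mem_image_of_mem _ (hS.mem_toFinset.2 hx))) ?_
  have hb : b x = hex.choose := dif_pos hex
  rw [hb]
  exact hR x hx _ _ hA hex.choose_spec.1 hxA hex.choose_spec.2

section GenusSix

variable {A B B' P P' : C.Div}

theorem disjoint_of_genus_six (hg : C.genus = 6) (hA : C.IsTetragonal A) (hB : C.IsTetragonal B)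
    (hB' : C.IsTetragonal B') (hBB' : ¬ C.LinEquiv B B') (hP : 0 ≤ P) (hP' : 0 ≤ P')
    (hPl : C.LinEquiv P (C.K - A - B)) (hPl' : C.LinEquiv P' (C.K - A - B')) (x : C.Point) :
    P x = 0 ∨ P' x = 0 := by
  by_contra! hx
  have hM : C.LinEquiv (C.K - A - P) B := hPl.symm.of_sub (by abel)
  have hM' : C.LinEquiv (C.K - A - P') B' := hPl'.symm.of_sub (by abel)
  have hx1 : C.pt x ≤ P := (pt_le_iff hP).2 (lt_of_le_of_ne (hP x) (Ne.symm hx.1))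
  have hx2 : C.pt x ≤ P' := (pt_le_iff hP').2 (lt_of_le_of_ne (hP' x) (Ne.symm hx.2))
  have h1 : C.h0 (C.K - A - C.pt x) ≤ 2 := h0_le_two (by
    rw [deg_sub, deg_sub, deg_K, deg_pt, hA.1, hg]; norm_num)
  have h2 : C.H0 (C.K - A - P) = C.H0 (C.K - A - C.pt x) :=
    H0_eq_of_le (sub_le_sub_left hx1 _) (h1.trans (by rw [hM.h0_eq]; exact hB.2))
  have h3 : C.H0 (C.K - A - P') = C.H0 (C.K - A - C.pt x) :=
    H0_eq_of_le (sub_le_sub_left hx2 _) (h1.trans (by rw [hM'.h0_eq]; exact hB'.2))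
  obtain ⟨y, hy⟩ : ∃ y, P y < P' y := by
    by_contra! h
    have h4 : P' = P := eq_of_le_of_deg h (by
      simp only [hPl.deg_eq, hPl'.deg_eq, deg_sub, hB.1, hB'.1])
    subst h4
    exact hBB' (hM.symm.trans hM')
  have h4 : C.H0 (C.K - A - P) ≤ C.H0 (C.K - A - P - C.pt y) := by
    intro f hf
    have hf' : f ∈ C.H0 (C.K - A - P') := by rwa [h3, ← h2]
    rw [sub_sub _ P]
    refine mem_H0_sub_of_le_max hf hf' fun Q => ?_
    rw [Finsupp.add_apply]
    by_cases hQ : y = Q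
    · subst hQ
      rw [pt_self]
      exact le_max_of_le_right (by omega)
    · rw [pt_ne hQ, add_zero]
      exact le_max_left _ _
  have h5 : C.h0 (C.K - A - P) ≤ C.h0 (C.K - A - P - C.pt y) := Submodule.finrank_mono h4
  have h6 := (hB.congr hM).isBPFPencil
  have h7 := h6.h0_sub_pt y
  have h8 := h6.2
  omega

theorem h0_K_sub_tetragonal (hA : C.IsTetragonal A) : C.h0 (C.K - A) + 3 = C.genus := by
  have := h0_K_sub A
  rw [hA.isBPFPencil.2, hA.1] at this
  omega

theorem exists_sub_of_genus_six (hg : C.genus = 6) (hA : C.IsTetragonal A)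
    (hB : C.IsTetragonal B) (hAB : ¬ C.LinEquiv A B) :
    ∃ P, 0 ≤ P ∧ C.LinEquiv P (C.K - A - B) := by
  refine exists_effective ?_
  have h1 := h0_K_sub (A + B)
  rw [hA.h0_add hB hg.ge hAB, deg_add, hA.1, hB.1, hg, ← sub_sub] at h1
  omega

theorem h0_sub_pos_of_genus_six (hg : C.genus = 6) (hA : C.IsTetragonal A)
    (hB : C.IsTetragonal B) (hB' : C.IsTetragonal B') (hBB' : ¬ C.LinEquiv B B')
    (hAB : ¬ C.LinEquiv A B) (hP' : 0 ≤ P') (hPl' : C.LinEquiv P' (C.K - A - B')) :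
    0 < C.h0 (B - P') := by
  obtain ⟨P, hP, hPl⟩ := exists_sub_of_genus_six hg hA hB hAB
  have hM : C.LinEquiv (C.K - A - P) B := hPl.symm.of_sub (by abel)
  have hM' : C.LinEquiv (C.K - A - P') B' := hPl'.symm.of_sub (by abel)
  obtain ⟨f, hf0, hf, hf'⟩ := exists_mem_inf (sub_le_self (C.K - A) hP) (sub_le_self (C.K - A) hP')
    (by
      have := h0_K_sub_tetragonal hA
      rw [hM.h0_eq, hM'.h0_eq, hB.isBPFPencil.2, hB'.isBPFPencil.2]
      omega)
  have h1 := mem_H0_sub_add hf hf' hP hP'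
    (disjoint_of_genus_six hg hA hB hB' hBB' hP hP' hPl hPl')
  have h2 : C.LinEquiv (C.K - A - (P + P')) (B - P') := hM.of_sub (by abel)
  rw [← h2.h0_eq]
  exact h0_pos_iff.2 ⟨f, h1, hf0⟩

theorem two_le_h0_of_genus_six (hg : C.genus = 6) (hA : C.IsTetragonal A)
    (hB : C.IsTetragonal B) (hB' : C.IsTetragonal B') (hBB' : ¬ C.LinEquiv B B') :
    2 ≤ C.h0 (B + B' - A) := by
  classical
  obtain ⟨P, hP, hPl⟩ := exists_sub_of_genus_six hg hB hB' hBB'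
  have hdegP : C.deg P = 2 := by
    rw [hPl.deg_eq, deg_sub, deg_sub, deg_K, hB.1, hB'.1, hg]; norm_num
  have hl : C.LinEquiv (C.K - A - P) (B + B' - A) := hPl.symm.of_sub (by abel)
  rw [← hl.h0_eq]
  by_contra! hlt
  have h1 : 0 < C.h0 (C.K - A - P) := by
    have h2 := h0_le_add_deg hP (C.K - A)
    have := h0_K_sub_tetragonal hA
    omega
  obtain ⟨σ, hσ, hσ0⟩ := h0_pos_iff.1 h1
  obtain ⟨E, hE, hER, hEn⟩ := exists_avoiding
    (S := ((C.K - A - P + C.divOf σ).support : Set C.Point)) (Finset.finite_toSet _)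
    (fun x E => ∃ Q, 0 ≤ Q ∧ C.LinEquiv Q (C.K - A - E) ∧ Q x ≠ 0)
    (by
      rintro x - E E' hE hE' ⟨Q, hQ, hQl, hQx⟩ ⟨Q', hQ', hQl', hQx'⟩
      by_contra hne
      exact (disjoint_of_genus_six hg hA hE hE' hne hQ hQ' hQl hQl' x).elim hQx hQx')
    {A, B, B'}
  simp only [Finset.mem_insert, Finset.mem_singleton, forall_eq_or_imp, forall_eq] at hEn
  obtain ⟨hEA, hEB, hEB'⟩ := hEn
  obtain ⟨Q, hQ, hQl⟩ := exists_sub_of_genus_six hg hA hE (fun h => hEA h.symm)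
  have h3 := h0_sub_pos_of_genus_six hg hB hE hB' hEB' (fun h => hEB h.symm) hP hPl
  have h4 : C.LinEquiv (C.K - A - P - Q) (E - P) := hQl.symm.of_sub (by abel)
  rw [← h4.h0_eq] at h3
  obtain ⟨f, hf, hf0⟩ := h0_pos_iff.1 h3
  obtain ⟨c, rfl⟩ := exists_smul_of_h0_le_one (by omega) hσ hσ0
    (C.H0_mono (fun R => sub_le_self _ hQ R) hf)
  have hc : c ≠ 0 := fun hc => hf0 (by rw [hc, zero_smul])
  have h5 := (mem_H0_sub hf0).1 hf
  rw [divOf_smul hc hσ0] at h5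
  obtain ⟨x, hx⟩ := exists_pt_le hQ (by
    rw [hQl.deg_eq, deg_sub, deg_sub, deg_K, hA.1, hE.1, hg]; norm_num)
  have hx1 := (pt_le_iff hQ).1 hx
  have hx2 := h5 x
  refine hER x ?_ ⟨Q, hQ, hQl, by omega⟩
  rw [Finset.mem_coe, Finsupp.mem_support_iff]
  omega

end GenusSix

theorem two_le_h0_add_sub {A B B' : C.Div} (hA : C.IsTetragonal A)
    (hB : C.IsTetragonal B) (hB' : C.IsTetragonal B') (hBB' : ¬ C.LinEquiv B B') :
    2 ≤ C.h0 (B + B' - A) ∨ C.LinEquiv (B + B' + A) C.K := by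
  have hg := IsExceptional.six_le_genus (C := C)
  rcases hg.eq_or_lt with hg6 | hg7
  · exact Or.inl (two_le_h0_of_genus_six hg6.symm hA hB hB' hBB')
  refine or_iff_not_imp_left.2 fun h3 => ?_
  have h4 := hA.isBPFPencil.two_mul_h0_le (B + B')
  rw [hB.h0_add hB' hg hBB'] at h4
  have hdeg : C.deg (B + B' + A) = 12 := by rw [deg_add, deg_add, hA.1, hB.1, hB'.1]; norm_num
  have hg7' : C.genus = 7 := by
    by_contra hne
    have := hA.h0_le_of_deg 6 (by norm_num) (by omega) hdeg
    omega
  have h5 := h0_K_sub (B + B' + A)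
  rw [hdeg, hg7'] at h5
  have h6 := linEquiv_zero_of_deg (D := C.K - (B + B' + A)) (by omega)
    (by rw [deg_sub, deg_K, hdeg, hg7']; norm_num)
  exact h6.symm.of_sub (by abel)

end Exceptional

end Curve

namespace Curve

variable {C : Curve}

theorem h0_lt_of_notMem {D D' : C.Div} (h : D' ≤ D) {f : C.F} (hf : f ∈ C.H0 D)
    (hf' : f ∉ C.H0 D') : C.h0 D' < C.h0 D :=
  Submodule.finrank_lt_finrank_of_lt (lt_of_le_of_ne (C.H0_mono fun P => h P)
    fun he => hf' (he ▸ hf))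

theorem exists_notMem_of_h0_lt {D D' : C.Div} (h : C.h0 D' < C.h0 D) :
    ∃ f ∈ C.H0 D, f ∉ C.H0 D' := by
  by_contra! hc
  exact absurd (Submodule.finrank_mono (show C.H0 D ≤ C.H0 D' from hc)) (not_le.2 h)

theorem one_mem_H0_iff {D : C.Div} : (1 : C.F) ∈ C.H0 D ↔ 0 ≤ D := by
  rw [mem_H0_effective one_ne_zero, divOf_one, add_zero]

theorem mul_notMem_H0_sub_pt {A B : C.Div} {s t : C.F} {z : C.Point} (hs : s ∈ C.H0 A)
    (hs' : s ∉ C.H0 (A - C.pt z)) (ht : t ∈ C.H0 B) (ht' : t ∉ C.H0 (B - C.pt z)) :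
    s * t ∉ C.H0 (A + B - C.pt z) := by
  rw [mem_H0_sub_pt] at hs' ht' ⊢
  obtain ⟨hs0, hs1⟩ := ord_eq_of_mem_of_notMem (mem_H0_iff.1 hs z) fun h => hs' ⟨hs, h⟩
  obtain ⟨ht0, ht1⟩ := ord_eq_of_mem_of_notMem (mem_H0_iff.1 ht z) fun h => ht' ⟨ht, h⟩
  rintro ⟨-, h⟩
  rw [mem_V_iff (mul_ne_zero hs0 ht0), C.ord_mul _ _ _ hs0 ht0, Finsupp.add_apply] at h
  omega

theorem IsBPFPencil.disjoint_of_one_mem {A : C.Div} (h : C.IsBPFPencil A) {f : C.F}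
    (hA : 0 ≤ A) (hf : f ∈ C.H0 A) (hf1 : ∀ c : ℂ, f ≠ c • 1) (P : C.Point) :
    A P = 0 ∨ (A + C.divOf f) P = 0 := by
  have hf0 := ne_zero_of_forall_ne_smul hf1
  have hf2 := (mem_H0_effective hf0).1 hf
  by_contra! hc
  refine h.no_common_zero (s := 1) (t := f) (P := P) one_ne_zero hf1 ?_ ?_
  · rw [one_mem_H0_iff, sub_nonneg, pt_le_iff hA]
    exact lt_of_le_of_ne (hA P) (Ne.symm hc.1)
  · rw [mem_H0_sub hf0, pt_le_iff hf2]
    exact lt_of_le_of_ne (hf2 P) (Ne.symm hc.2)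

theorem exists_effective_through {A : C.Div} (h : 2 ≤ C.h0 A) (z : C.Point) :
    ∃ E, C.LinEquiv E A ∧ 0 ≤ E ∧ C.pt z ≤ E := by
  obtain ⟨f, hf, hf0⟩ := exists_section_through h z
  have h1 := (mem_H0_sub hf0).1 hf
  exact ⟨_, divOf_linEquiv hf0 A, (pt_nonneg z).trans h1, h1⟩

section Exceptional

variable [IsExceptional C]

theorem IsTetragonal.h0_add_sub_pt {A A' : C.Div} (hA : C.IsTetragonal A)
    (hA' : C.IsTetragonal A') (hne : ¬ C.LinEquiv A A') (z : C.Point) :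
    C.h0 (A + A' - C.pt z) = 3 := by
  have h1 := hA.h0_add hA' (IsExceptional.six_le_genus (C := C)) hne
  have h2 := h0_le_sub_pt (A + A') z
  have h3 := hA.isBPFPencil.h0_sub_pt z
  have h4 := hA'.isBPFPencil.h0_sub_pt z
  obtain ⟨s, hs, hs'⟩ := exists_notMem_of_h0_lt (D := A) (D' := A - C.pt z)
    (by have := hA.2; omega)
  obtain ⟨t, ht, ht'⟩ := exists_notMem_of_h0_lt (D := A') (D' := A' - C.pt z)
    (by have := hA'.2; omega)
  have h5 := h0_lt_of_notMem (sub_pt_le (A + A') z) (C.mul_mem_H0 hs ht)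
    (mul_notMem_H0_sub_pt hs hs' ht ht')
  omega

theorem exists_partner_of_effective {A A' B : C.Div} (hA : C.IsTetragonal A)
    (hA' : C.IsTetragonal A') (hne : ¬ C.LinEquiv A A') (hA0 : 0 ≤ A) (hA'0 : 0 ≤ A')
    (hB0 : 0 ≤ B) (hB : C.deg B = 4) (hB2 : 2 ≤ C.h0 (A + A' - B)) {z a : C.Point}
    (hz : C.pt z ≤ A) (hz' : C.pt z ≤ A') (hzB : C.pt z ≤ B) (ha : A a = 0) (ha' : A' a = 0)
    (haB : C.pt a ≤ B) :
    ∃ w, C.pt z + C.pt w ≤ A ∧ C.pt z + C.pt w ≤ A' ∧ C.pt z + C.pt w ≤ B ∧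
      3 ≤ C.h0 (A + A' - (C.pt z + C.pt w)) := by
  classical
  have hzA := (pt_le_iff hA0).1 hz
  have hzA' := (pt_le_iff hA'0).1 hz'
  have hzB' := (pt_le_iff hB0).1 hzB
  have haB' := (pt_le_iff hB0).1 haB
  have hza : z ≠ a := by rintro rfl; omega
  obtain ⟨σ, hσ, hσ0⟩ := exists_section_through hA.2 a
  obtain ⟨τ, hτ, hτ0⟩ := exists_section_through hA'.2 a
  have hσA := C.H0_mono (fun P => sub_pt_le A a P) hσ
  have hτA := C.H0_mono (fun P => sub_pt_le A' a P) hτ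
  have hσa := (mem_H0_sub hσ0).1 hσ
  have hτa := (mem_H0_sub hτ0).1 hτ
  have hσE := (mem_H0_effective hσ0).1 hσA
  have hτE := (mem_H0_effective hτ0).1 hτA
  have hσ1 : ∀ c : ℂ, σ ≠ c • 1 := by
    rintro c rfl
    have hc : c ≠ 0 := by rintro rfl; simp at hσ0
    have := (pt_le_iff hσE).1 hσa
    rw [divOf_smul hc one_ne_zero, divOf_one, add_zero] at this
    omega
  have hτ1 : ∀ c : ℂ, τ ≠ c • 1 := by
    rintro c rfl
    have hc : c ≠ 0 := by rintro rfl; simp at hτ0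
    have := (pt_le_iff hτE).1 hτa
    rw [divOf_smul hc one_ne_zero, divOf_one, add_zero] at this
    omega
  have hdis := hA.isBPFPencil.disjoint_of_one_mem hA0 hσA hσ1
  have hdis' := hA'.isBPFPencil.disjoint_of_one_mem hA'0 hτA hτ1
  have hN0 : 0 ≤ A + A' := add_nonneg hA0 hA'0
  have h1a : (1 : C.F) ∉ C.H0 (A + A' - C.pt a) := by
    rw [one_mem_H0_iff, sub_nonneg, pt_le_iff hN0, Finsupp.add_apply, ha, ha']
    norm_num
  have hzN : C.pt z ≤ A + A' := hz.trans (le_add_of_nonneg_right hA'0)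
  have hBza : C.pt z + C.pt a ≤ B := fun P => by
    have := hB0 P
    have h0 : (0 : C.Div) P = 0 := rfl
    rw [Finsupp.add_apply, pt_apply, pt_apply]
    split_ifs with h1 h2 h2
    · exact absurd (h1.trans h2.symm) hza
    · subst h1; omega
    · subst h2; omega
    · omega
  have heq : C.H0 (A + A' - B) = C.H0 (A + A' - (C.pt z + C.pt a)) := by
    refine H0_eq_of_le (sub_le_sub_left hBza _) (le_trans ?_ hB2)
    have h1 := hA.h0_add_sub_pt hA' hne z
    have h2 : C.h0 (A + A' - C.pt z - C.pt a) < C.h0 (A + A' - C.pt z) :=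
      h0_lt_of_notMem (sub_pt_le _ a) (f := 1) (one_mem_H0_iff.2 (sub_nonneg.2 hzN))
        fun h => h1a (C.H0_mono (fun P => sub_le_sub_right (sub_pt_le _ z) _ P) h)
    rw [← sub_sub]
    omega
  have hσB : B ≤ A + A' + C.divOf σ := by
    rw [← mem_H0_sub hσ0, heq, mem_H0_sub hσ0]
    calc C.pt z + C.pt a ≤ A' + (A + C.divOf σ) := add_le_add hz' hσa
      _ = _ := by abel
  have hτB : B ≤ A + A' + C.divOf τ := by
    rw [← mem_H0_sub hτ0, heq, mem_H0_sub hτ0]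
    calc C.pt z + C.pt a ≤ A + (A' + C.divOf τ) := add_le_add hz hτa
      _ = _ := by abel
  obtain ⟨X, hX⟩ : ∃ X : C.Div, ∀ y, X y = if 0 < A y ∧ 0 < A' y then B y else 0 :=
    ⟨B.filter fun y => 0 < A y ∧ 0 < A' y, fun y => Finsupp.filter_apply _ _ _⟩
  have key : ∀ y, 0 ≤ B y ∧ 0 ≤ A y ∧ 0 ≤ A' y ∧ 0 ≤ (A + C.divOf σ) y ∧
      0 ≤ (A' + C.divOf τ) y ∧ B y ≤ A' y + (A + C.divOf σ) y ∧
      B y ≤ A y + (A' + C.divOf τ) y := fun y => by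
    refine ⟨hB0 y, hA0 y, hA'0 y, hσE y, hτE y, ?_, ?_⟩
    · have := hσB y
      simp only [Finsupp.add_apply] at this ⊢
      omega
    · have := hτB y
      simp only [Finsupp.add_apply] at this ⊢
      omega
  have hall : ∀ y, 0 ≤ X y ∧ X y ≤ B y ∧ X y ≤ A y ∧ X y ≤ A' y ∧
      B y - X y ≤ (A + C.divOf σ) y ∧ B y - X y ≤ (A' + C.divOf τ) y := fun y => by
    obtain ⟨k1, k2, k3, k4, k5, k6, k7⟩ := key y
    have d := hdis y
    have d' := hdis' y
    rw [hX]
    split_ifs with h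
    · omega
    · omega
  have hX0 : 0 ≤ X := fun y => (hall y).1
  have hXB : X ≤ B := fun y => (hall y).2.1
  have hXA : X ≤ A := fun y => (hall y).2.2.1
  have hXA' : X ≤ A' := fun y => (hall y).2.2.2.1
  have hYσ : B - X ≤ A + C.divOf σ := fun y => (hall y).2.2.2.2.1
  have hzX : C.pt z ≤ X := by
    rw [pt_le_iff hX0, hX, if_pos ⟨by omega, by omega⟩]
    exact hzB'
  have hXa : X a = 0 := by rw [hX, if_neg (by omega)]
  have hdN : C.deg (A + A') = 8 := by rw [deg_add, hA.1, hA'.1]; norm_num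
  have h3X : 3 ≤ C.h0 (A + A' - X) := by
    have : C.h0 (A + A' - B) < C.h0 (A + A' - X) :=
      h0_lt_of_notMem (sub_le_sub_left hXB _)
        (one_mem_H0_iff.2 (sub_nonneg.2 (hXA.trans (le_add_of_nonneg_right hA'0))))
        fun h => h1a (C.H0_mono (fun P => sub_le_sub_left haB _ P) h)
    omega
  have h3Y : 3 ≤ C.h0 (A + A' - (B - X)) := by
    obtain ⟨t, ht, ht'⟩ := exists_notMem_of_h0_lt (D := A') (D' := A' - C.pt z)
      (by have := hA'.isBPFPencil.h0_sub_pt z; have := hA'.2; omega)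
    have hσz : σ ∉ C.H0 (A - C.pt z) := by
      rw [mem_H0_sub hσ0, pt_le_iff hσE]
      have := hdis z
      omega
    have hm : σ * t ∈ C.H0 (A + A' - (B - X)) := by
      have := C.mul_mem_H0 ((mem_H0_sub hσ0).2 hYσ) ht
      convert this using 2
      abel
    have : C.h0 (A + A' - B) < C.h0 (A + A' - (B - X)) :=
      h0_lt_of_notMem (sub_le_sub_left (sub_le_self _ hX0) _) hm
        fun h => mul_notMem_H0_sub_pt hσA hσz ht ht'
          (C.H0_mono (fun P => sub_le_sub_left hzB _ P) h)
    omega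
  have hdX : C.deg X = 2 := by
    have h1 : ¬ C.deg (A + A' - X) ≤ 5 := fun h => by have := h0_le_two h; omega
    have h2 : ¬ C.deg (A + A' - (B - X)) ≤ 5 := fun h => by have := h0_le_two h; omega
    rw [deg_sub, hdN] at h1 h2
    rw [deg_sub, hB] at h2
    omega
  obtain ⟨w, hw⟩ := exists_pt_le (sub_nonneg.2 hzX) (by rw [deg_sub, hdX, deg_pt]; norm_num)
  have hw' := eq_of_le_of_deg hw (by rw [deg_sub, hdX, deg_pt, deg_pt]; norm_num)
  have hXw : C.pt z + C.pt w = X := by rw [hw']; abel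
  rw [← hXw] at hXA hXA' hXB h3X
  exact ⟨w, hXA, hXA', hXB, h3X⟩

theorem partner_unique_of_add {A A' : C.Div} (hA : C.IsTetragonal A) (hA' : C.IsTetragonal A')
    (hne : ¬ C.LinEquiv A A') {z w w' : C.Point}
    (h : 3 ≤ C.h0 (A + A' - (C.pt z + C.pt w))) (h' : 3 ≤ C.h0 (A + A' - (C.pt z + C.pt w'))) :
    w = w' := by
  classical
  by_contra hw
  have h1 := hA.h0_add_sub_pt hA' hne z
  rw [← sub_sub] at h h'
  have h2 := H0_eq_of_le (sub_pt_le (A + A' - C.pt z) w) (by omega)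
  have h3 := H0_eq_of_le (sub_pt_le (A + A' - C.pt z) w') (by omega)
  have h4 : C.H0 (A + A' - C.pt z) ≤ C.H0 (A + A' - C.pt z - (C.pt w + C.pt w')) := fun f hf => by
    refine mem_H0_sub_add (h2 ▸ hf) (h3 ▸ hf) (pt_nonneg _) (pt_nonneg _) fun P => ?_
    rw [pt_apply, pt_apply]
    split_ifs with h5 h6 <;> first | exact absurd (h5.trans h6.symm) hw | simp
  have h5 : C.h0 (A + A' - C.pt z) ≤ C.h0 (A + A' - C.pt z - (C.pt w + C.pt w')) :=
    Submodule.finrank_mono h4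
  have h6 := h0_le_two (D := A + A' - C.pt z - (C.pt w + C.pt w')) (by
    rw [deg_sub, deg_sub, deg_add, deg_add, hA.1, hA'.1, deg_pt, deg_pt, deg_pt]; norm_num)
  omega

variable (C) in
/-- `w` lies with `z` on a member of all but finitely many tetragonal pencils. -/
def IsPartner (z w : C.Point) : Prop := ∃ T : Finset C.Div, ∀ B, C.IsTetragonal B →
  (∀ E ∈ T, ¬ C.LinEquiv B E) → 0 < C.h0 (B - (C.pt z + C.pt w))

theorem exists_isPartner {A A' : C.Div} (hA : C.IsTetragonal A) (hA' : C.IsTetragonal A')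
    (hne : ¬ C.LinEquiv A A') (z : C.Point) : ∃ w, 0 < C.h0 (A - (C.pt z + C.pt w)) ∧
      0 < C.h0 (A' - (C.pt z + C.pt w)) ∧ 3 ≤ C.h0 (A + A' - (C.pt z + C.pt w)) ∧
      C.IsPartner z w := by
  classical
  obtain ⟨A₁, h₁, h₁0, hz₁⟩ := exists_effective_through hA.2 z
  obtain ⟨A₂, h₂, h₂0, hz₂⟩ := exists_effective_through hA'.2 z
  have hA₁ := hA.congr h₁
  have hA₂ := hA'.congr h₂
  have hne' : ¬ C.LinEquiv A₁ A₂ := fun h => hne (h₁.symm.trans (h.trans h₂))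
  have key : ∃ T : Finset C.Div, ∀ B, C.IsTetragonal B → (∀ E ∈ T, ¬ C.LinEquiv B E) →
      ∃ w, C.pt z + C.pt w ≤ A₁ ∧ C.pt z + C.pt w ≤ A₂ ∧ 0 < C.h0 (B - (C.pt z + C.pt w)) ∧
      3 ≤ C.h0 (A₁ + A₂ - (C.pt z + C.pt w)) := by
    refine ⟨insert (C.K - (A₁ + A₂)) (Set.finite_Icc (0 : C.Div) (4 • (A₁ + A₂))).toFinset,
      fun B hB hBT => ?_⟩
    obtain ⟨B₁, hB₁, hB₁0, hzB⟩ := exists_effective_through hB.2 z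
    have hN0 : 0 ≤ A₁ + A₂ := add_nonneg h₁0 h₂0
    obtain ⟨a, ha0, haB⟩ : ∃ a, (A₁ + A₂) a = 0 ∧ 1 ≤ B₁ a := by
      by_contra! hc
      refine hBT B₁ (Finset.mem_insert_of_mem ?_) hB₁.symm
      rw [Set.Finite.mem_toFinset]
      refine ⟨hB₁0, fun P => ?_⟩
      have h3 := hc P
      have h4 := hN0 P
      have h5 := hB₁0 P
      have h6 : B₁ P ≤ 4 := by
        have h7 : (B₁ P) • C.pt P ≤ B₁ := fun Q => by
          rw [Finsupp.smul_apply, pt_apply]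
          split_ifs with h
          · subst h; simp
          · simpa using hB₁0 Q
        have h8 := deg_mono h7
        have h9 : C.deg (B₁ P • C.pt P) = B₁ P := by
          obtain ⟨n, hn⟩ := Int.eq_ofNat_of_zero_le h5
          rw [hn, natCast_zsmul, deg_nsmul, deg_pt, mul_one]
        rw [h9, hB₁.deg_eq, hB.1] at h8
        exact h8
      rw [Finsupp.smul_apply, nsmul_eq_mul]
      have h0 : (0 : C.Div) P = 0 := rfl
      rw [Nat.cast_ofNat]
      by_cases h : (A₁ + A₂) P = 0
      · have := h3 h; omega
      · omega
    have hBN : 2 ≤ C.h0 (A₁ + A₂ - B₁) := by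
      refine (two_le_h0_add_sub (hB.congr hB₁) hA₁ hA₂ hne').resolve_right fun h => ?_
      exact hBT _ (Finset.mem_insert_self _ _) (hB₁.symm.trans (h.of_sub (by abel)))
    rw [Finsupp.add_apply] at ha0
    have h3 := h₁0 a
    have h4 := h₂0 a
    have h0 : (0 : C.Div) a = 0 := rfl
    obtain ⟨w, hw₁, hw₂, hw, hw3⟩ := exists_partner_of_effective hA₁ hA₂ hne' h₁0 h₂0 hB₁0
      (by rw [hB₁.deg_eq, hB.1]) hBN hz₁ hz₂ hzB (by omega) (by omega) ((pt_le_iff hB₁0).2 haB)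
    refine ⟨w, hw₁, hw₂, ?_, hw3⟩
    have h5 : C.LinEquiv (B₁ - (C.pt z + C.pt w)) (B - (C.pt z + C.pt w)) :=
      hB₁.of_sub (by abel)
    rw [← h5.h0_eq]
    exact h0_pos_of_effective (sub_nonneg.2 hw)
  obtain ⟨T, hT⟩ := key
  obtain ⟨B, hB, hBT⟩ := IsExceptional.exists_tetragonal (C := C) T
  obtain ⟨w, hw₁, hw₂, -, hw3⟩ := hT B hB hBT
  have e1 : C.LinEquiv (A₁ - (C.pt z + C.pt w)) (A - (C.pt z + C.pt w)) := h₁.of_sub (by abel)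
  have e2 : C.LinEquiv (A₂ - (C.pt z + C.pt w)) (A' - (C.pt z + C.pt w)) := h₂.of_sub (by abel)
  have e3 : C.LinEquiv (A₁ + A₂ - (C.pt z + C.pt w)) (A + A' - (C.pt z + C.pt w)) :=
    (h₁.add h₂).of_sub (by abel)
  refine ⟨w, ?_, ?_, ?_, T, fun B hB hBT => ?_⟩
  · rw [← e1.h0_eq]; exact h0_pos_of_effective (sub_nonneg.2 hw₁)
  · rw [← e2.h0_eq]; exact h0_pos_of_effective (sub_nonneg.2 hw₂)
  · rw [← e3.h0_eq]; exact hw3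
  · obtain ⟨w', -, -, hw', hw'3⟩ := hT B hB hBT
    rwa [partner_unique_of_add hA₁ hA₂ hne' hw3 hw'3]

theorem IsPartner.unique {z w w' : C.Point} (h : C.IsPartner z w) (h' : C.IsPartner z w') :
    w = w' := by
  classical
  by_contra hne
  obtain ⟨T, hT⟩ := h
  obtain ⟨T', hT'⟩ := h'
  have hg := IsExceptional.six_le_genus (C := C)
  have hdW : C.deg (C.pt z + C.pt w + C.pt w') = 3 := by
    rw [deg_add, deg_add, deg_pt, deg_pt, deg_pt]; norm_num
  have hW1 : C.h0 (C.pt z + C.pt w + C.pt w') = 1 := by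
    have h1 := h0_le_one hdW.le
    have h2 := h0_pos_of_effective (C := C) (D := C.pt z + C.pt w + C.pt w')
      (add_nonneg (add_nonneg (pt_nonneg z) (pt_nonneg w)) (pt_nonneg w'))
    omega
  generalize hWdef : C.pt z + C.pt w + C.pt w' = W at hdW hW1
  have hKW := h0_K_sub W
  rw [hW1, hdW] at hKW
  have hfin := h0_sub_pt_finite (D := C.K - W) (by omega)
  obtain ⟨B, hB, hBT⟩ := IsExceptional.exists_tetragonal (C := C)
    (T ∪ T' ∪ hfin.toFinset.image fun c => W + C.pt c)
  have h1 := hT B hB fun E hE => hBT E (by simp [hE])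
  have h2 := hT' B hB fun E hE => hBT E (by simp [hE])
  obtain ⟨f, hf, hf0⟩ := h0_pos_iff.1 h1
  obtain ⟨g, hg', hg0⟩ := h0_pos_iff.1 h2
  rw [← sub_sub] at hf hg'
  obtain ⟨c, rfl⟩ := exists_smul_of_h0_le_one (hB.isBPFPencil.h0_sub_pt z).le
    (C.H0_mono (fun P => sub_pt_le _ w P) hf) hf0 (C.H0_mono (fun P => sub_pt_le _ w' P) hg')
  have hc : c ≠ 0 := fun hc => hg0 (by rw [hc, zero_smul])
  have hg2 : f ∈ C.H0 (B - C.pt z - C.pt w') := by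
    rw [mem_H0_sub hg0, divOf_smul hc hf0] at hg'
    rwa [mem_H0_sub hf0]
  have hf3 : f ∈ C.H0 (B - C.pt z - (C.pt w + C.pt w')) := by
    refine mem_H0_sub_add hf hg2 (pt_nonneg _) (pt_nonneg _) fun P => ?_
    rw [pt_apply, pt_apply]
    split_ifs with h5 h6 <;> first | exact absurd (h5.trans h6.symm) hne | simp
  have hBW : 0 < C.h0 (B - W) := by
    rw [← hWdef]
    refine h0_pos_iff.2 ⟨f, ?_, hf0⟩
    convert hf3 using 2
    abel
  obtain ⟨E, hE, hEB⟩ := exists_effective hBW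
  have hdE : C.deg E = 1 := by rw [hEB.deg_eq, deg_sub, hB.1, hdW]; norm_num
  obtain ⟨c, hc⟩ := exists_pt_le hE (by omega)
  have hcE := eq_of_le_of_deg hc (by rw [deg_pt, hdE])
  subst hcE
  have hl : C.LinEquiv B (W + C.pt c) := hEB.symm.of_sub (by abel)
  refine hBT (W + C.pt c) ?_ hl
  refine Finset.mem_union_right _ (Finset.mem_image_of_mem _ (hfin.mem_toFinset.2 ?_))
  have h3 := h0_K_sub (W + C.pt c)
  rw [← hl.h0_eq, ← hl.deg_eq, hB.isBPFPencil.2, hB.1, ← sub_sub] at h3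
  change C.h0 (C.K - W - C.pt c) = C.h0 (C.K - W)
  omega

theorem exists_tetragonal_not_linEquiv (A : C.Div) :
    ∃ A', C.IsTetragonal A' ∧ ¬ C.LinEquiv A A' := by
  obtain ⟨A', hA', h⟩ := IsExceptional.exists_tetragonal (C := C) {A}
  exact ⟨A', hA', fun h' => h A (by simp) h'.symm⟩

theorem exists_partner (z : C.Point) : ∃ w, C.IsPartner z w := by
  obtain ⟨A, hA, -⟩ := exists_tetragonal_not_linEquiv (0 : C.Div)
  obtain ⟨A', hA', hne⟩ := exists_tetragonal_not_linEquiv A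
  obtain ⟨w, -, -, -, hw⟩ := exists_isPartner hA hA' hne z
  exact ⟨w, hw⟩

variable (C) in
/-- The involution exchanging partners. -/
def conj (z : C.Point) : C.Point := (exists_partner z).choose

theorem isPartner_conj (z : C.Point) : C.IsPartner z (C.conj z) := (exists_partner z).choose_spec

@[simp]
theorem conj_conj (z : C.Point) : C.conj (C.conj z) = z := by
  refine (isPartner_conj _).unique ?_
  obtain ⟨T, hT⟩ := isPartner_conj z
  exact ⟨T, fun B hB h => by rw [add_comm]; exact hT B hB h⟩

variable (C) in
/-- The divisor `z + conj z`. -/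
def pr (z : C.Point) : C.Div := C.pt z + C.pt (C.conj z)

theorem pr_nonneg (z : C.Point) : 0 ≤ C.pr z := add_nonneg (pt_nonneg _) (pt_nonneg _)

@[simp]
theorem deg_pr (z : C.Point) : C.deg (C.pr z) = 2 := by
  rw [pr, deg_add, deg_pt, deg_pt]; norm_num

theorem IsTetragonal.h0_sub_pr_pos {A : C.Div} (hA : C.IsTetragonal A) (z : C.Point) :
    0 < C.h0 (A - C.pr z) := by
  obtain ⟨A', hA', hne⟩ := exists_tetragonal_not_linEquiv A
  obtain ⟨w, hw, -, -, hp⟩ := exists_isPartner hA hA' hne z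
  rwa [hp.unique (isPartner_conj z)] at hw

theorem IsTetragonal.three_le_h0_add_sub_pr {A A' : C.Div} (hA : C.IsTetragonal A)
    (hA' : C.IsTetragonal A') (hne : ¬ C.LinEquiv A A') (z : C.Point) :
    3 ≤ C.h0 (A + A' - C.pr z) := by
  obtain ⟨w, -, -, hw, hp⟩ := exists_isPartner hA hA' hne z
  rwa [hp.unique (isPartner_conj z)] at hw

end Exceptional

end Curve

namespace Curve

variable {C : Curve}

theorem notMem_H0_sub_pt_of_le {M M' : C.Div} {x : C.Point} {s : C.F}
    (hs : s ∈ C.H0 M') (hs' : s ∉ C.H0 (M' - C.pt x)) (hx : M' x = M x) :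
    s ∉ C.H0 (M - C.pt x) := by
  rw [mem_H0_sub_pt] at hs' ⊢
  rintro ⟨-, h⟩
  exact hs' ⟨hs, by rwa [hx]⟩

theorem exists_notMem_finite {S : Set C.Point} (hS : S.Finite) : ∃ w, w ∉ S :=
  hS.exists_notMem

@[elab_as_elim]
theorem effective_induction {p : (D : C.Div) → 0 ≤ D → Prop} (h0 : p 0 le_rfl)
    (hadd : ∀ D z (hD : 0 ≤ D), p D hD → p (D + C.pt z) (add_nonneg hD (pt_nonneg z)))
    {D : C.Div} (hD : 0 ≤ D) : p D hD := by
  obtain ⟨n, hn⟩ := Int.eq_ofNat_of_zero_le (deg_nonneg hD)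
  induction n generalizing D with
  | zero =>
    obtain rfl := eq_zero_of_deg hD (by simpa using hn)
    exact h0
  | succ n ih =>
    obtain ⟨z, hz⟩ := exists_pt_le hD (by omega)
    obtain ⟨E, rfl⟩ : ∃ E, D = E + C.pt z := ⟨D - C.pt z, by abel⟩
    rw [le_add_iff_nonneg_left] at hz
    refine hadd E z hz (ih hz ?_)
    rw [deg_add, deg_pt] at hn
    push_cast at hn
    omega

section Exceptional

variable [IsExceptional C]

theorem pr_apply_eq_zero {z y : C.Point} (h1 : z ≠ y) (h2 : C.conj z ≠ y) : C.pr z y = 0 := by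
  rw [pr, Finsupp.add_apply, pt_ne h1, pt_ne h2, add_zero]

theorem pr_disjoint {z a : C.Point} (h1 : a ≠ z) (h2 : a ≠ C.conj z) (P : C.Point) :
    C.pr z P = 0 ∨ C.pr a P = 0 := by
  by_cases hz : z = P
  · subst hz
    exact Or.inr (pr_apply_eq_zero h1 fun h => h2 (by rw [← h, conj_conj]))
  by_cases hz' : C.conj z = P
  · subst hz'
    exact Or.inr (pr_apply_eq_zero h2 fun h => h1 (by
      rw [← conj_conj a, h, conj_conj]))
  exact Or.inl (pr_apply_eq_zero hz hz')

theorem pt_le_pr (z : C.Point) : C.pt z ≤ C.pr z := le_add_of_nonneg_right (pt_nonneg _)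

theorem h0_pr (z : C.Point) : C.h0 (C.pr z) = 1 := by
  have h1 := h0_le_one (D := C.pr z) (by rw [deg_pr]; norm_num)
  have h2 := h0_pos_of_effective (pr_nonneg z)
  omega

theorem eq_of_pr_linEquiv {z w : C.Point} (h : C.LinEquiv (C.pr z) (C.pr w)) :
    C.pr z = C.pr w := by
  obtain ⟨f, hf, h⟩ := h
  have h1 : (1 : C.F) ∈ C.H0 (C.pr w) := one_mem_H0_iff.2 (pr_nonneg w)
  have h2 : f ∈ C.H0 (C.pr w) := by
    rw [mem_H0_effective hf, ← h, add_sub_cancel]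
    exact pr_nonneg z
  obtain ⟨c, rfl⟩ := exists_smul_of_h0_le_one (h0_pr w).le h1 one_ne_zero h2
  have hc : c ≠ 0 := by rintro rfl; simp at hf
  rw [divOf_smul hc one_ne_zero, divOf_one] at h
  exact sub_eq_zero.1 h

theorem exists_finite_isTetragonal_pr_add : ∃ R : Set C.Point, R.Finite ∧ ∀ z ∉ R, ∀ a,
    a ≠ z → a ≠ C.conj z → C.IsTetragonal (C.pr z + C.pr a) := by
  obtain ⟨A, hA, -⟩ := exists_tetragonal_not_linEquiv (0 : C.Div)
  obtain ⟨A', hA', hne⟩ := exists_tetragonal_not_linEquiv A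
  have hdeg (z a : C.Point) : C.deg (C.pr z + C.pr a) = 4 := by
    rw [deg_add, deg_pr, deg_pr]; norm_num
  have hN (z : C.Point) : C.H0 (A + A' - C.pr z) = C.H0 (A + A' - C.pt z) :=
    H0_eq_of_le (sub_le_sub_left (pt_le_pr z) _) (by
      rw [hA.h0_add_sub_pt hA' hne]
      exact hA.three_le_h0_add_sub_pr hA' hne z)
  have hT (z a : C.Point) (h1 : a ≠ z) (h2 : a ≠ C.conj z) :
      C.IsTetragonal (A + A' - (C.pr z + C.pr a)) := by
    refine ⟨by rw [deg_sub, hdeg, deg_add, hA.1, hA'.1]; norm_num, ?_⟩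
    have h3 : C.H0 (A + A' - C.pr z - C.pt a) ≤ C.H0 (A + A' - (C.pr z + C.pr a)) :=
      fun f hf => mem_H0_sub_add (C.H0_mono (fun P => sub_pt_le _ a P) hf)
        (by
          rw [hN]
          exact C.H0_mono (fun P => sub_le_sub_right (sub_le_self _ (pr_nonneg z)) _ P) hf)
        (pr_nonneg z) (pr_nonneg a) (pr_disjoint h1 h2)
    have h4 : C.h0 (A + A' - C.pr z - C.pt a) ≤ C.h0 (A + A' - (C.pr z + C.pr a)) :=
      Submodule.finrank_mono h3
    have h5 := h0_le_sub_pt (A + A' - C.pr z) a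
    have h6 := hA.three_le_h0_add_sub_pr hA' hne z
    omega
  have hK (z a : C.Point) (h1 : a ≠ z) (h2 : a ≠ C.conj z) :
      2 ≤ C.h0 (C.pr z + C.pr a) ∨ C.LinEquiv (C.pr z + C.pr a) (A + A' + (A + A') - C.K) := by
    rcases two_le_h0_add_sub (hT z a h1 h2) hA hA' hne with h | h
    · rw [sub_sub_cancel] at h
      exact Or.inl h
    · exact Or.inr (h.symm.of_sub (by abel))
  by_cases hG : 0 < C.h0 (A + A' + (A + A') - C.K)
  · refine ⟨_, h0_sub_pt_finite hG, fun z hz a h1 h2 => ⟨hdeg z a, ?_⟩⟩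
    refine (hK z a h1 h2).elim id fun h => ?_
    by_contra hlt
    refine hz ?_
    rw [h.h0_eq] at hlt
    have h3 : C.LinEquiv (C.pr z + C.pr a - C.pt z) (A + A' + (A + A') - C.K - C.pt z) :=
      h.of_sub (by abel)
    have h4 := h0_pos_of_effective (D := C.pr z + C.pr a - C.pt z)
      (sub_nonneg.2 ((pt_le_pr z).trans (le_add_of_nonneg_right (pr_nonneg a))))
    rw [h3.h0_eq] at h4
    have h5 := h0_sub_pt_le (A + A' + (A + A') - C.K) z
    change C.h0 _ = C.h0 _
    omega
  · refine ⟨∅, Set.finite_empty, fun z _ a h1 h2 => ⟨hdeg z a, ?_⟩⟩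
    refine (hK z a h1 h2).elim id fun h => ?_
    have h4 := h0_pos_of_effective (add_nonneg (pr_nonneg z) (pr_nonneg a))
    rw [h.h0_eq] at h4
    exact absurd h4 hG

variable (C) in
/-- `M` has degree `2 k` and `k` independent sections, and almost all pairs of partners impose
at most one condition on them. -/
structure IsEven (k : ℕ) (M : C.Div) : Prop where
  deg : C.deg M = 2 * k
  h0 : C.h0 M = k
  finite : {x | C.h0 (M - C.pr x) + 1 < k}.Finite

theorem h0_le_of_deg (k : ℕ) (hk1 : 1 ≤ k) (hk : k + 2 ≤ C.genus) {N : C.Div}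
    (hN : C.deg N = 2 * k) : C.h0 N ≤ k := by
  obtain ⟨A, hA, -⟩ := exists_tetragonal_not_linEquiv (0 : C.Div)
  exact hA.h0_le_of_deg k hk1 hk hN

theorem h0_sub_pr_sub_pr {M : C.Div} {w x : C.Point} (h1 : x ≠ w) (h2 : x ≠ C.conj w) :
    C.h0 (M - C.pr w) + C.h0 (M - C.pr x) ≤ C.h0 M + C.h0 (M - C.pr w - C.pr x) := by
  have h3 : C.H0 (M - C.pr w) ⊓ C.H0 (M - C.pr x) ≤ C.H0 (M - C.pr w - C.pr x) := fun f hf => by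
    rw [sub_sub]
    exact mem_H0_sub_add hf.1 hf.2 (pr_nonneg w) (pr_nonneg x) (pr_disjoint h1 h2)
  have h4 := Submodule.finrank_sup_add_finrank_inf_eq (C.H0 (M - C.pr w)) (C.H0 (M - C.pr x))
  have h5 : Module.finrank ℂ ↥(C.H0 (M - C.pr w) ⊔ C.H0 (M - C.pr x)) ≤ C.h0 M :=
    Submodule.finrank_mono (sup_le (C.H0_mono fun P => sub_le_self M (pr_nonneg w) P)
      (C.H0_mono fun P => sub_le_self M (pr_nonneg x) P))
  have h6 : Module.finrank ℂ ↥(C.H0 (M - C.pr w) ⊓ C.H0 (M - C.pr x)) ≤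
    C.h0 (M - C.pr w - C.pr x) := Submodule.finrank_mono h3
  have h7 : Module.finrank ℂ (C.H0 (M - C.pr w)) = C.h0 (M - C.pr w) := rfl
  have h8 : Module.finrank ℂ (C.H0 (M - C.pr x)) = C.h0 (M - C.pr x) := rfl
  omega

theorem h0_sub_pr_finite {M : C.Div} (h : 0 < C.h0 M) :
    {w | C.h0 (M - C.pr w) = C.h0 M}.Finite :=
  (h0_sub_pt_finite h).subset fun w hw => le_antisymm (h0_sub_pt_le _ _) (by
    rw [← Set.mem_ofPred.1 hw]
    exact h0_mono (sub_le_sub_left (pt_le_pr w) M))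

theorem IsEven.sub_pr_of_le {k : ℕ} {M : C.Div} (hM : C.IsEven (k + 2) M) (hk : k + 4 ≤ C.genus)
    {x : C.Point} (hx : k + 1 ≤ C.h0 (M - C.pr x)) : C.IsEven (k + 1) (M - C.pr x) := by
  have hdeg : C.deg (M - C.pr x) = 2 * (k + 1 : ℕ) := by
    rw [deg_sub, hM.deg, deg_pr]; push_cast; ring
  refine ⟨hdeg, le_antisymm (h0_le_of_deg _ (by omega) (by omega) hdeg) hx, ?_⟩
  refine (hM.finite.union (Set.toFinite {x, C.conj x})).subset fun w hw => ?_
  by_contra hc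
  simp only [Set.mem_union, Set.mem_insert_iff, Set.mem_singleton_iff, not_or,
    Set.mem_ofPred_eq] at hc hw
  have := h0_sub_pr_sub_pr (M := M) hc.2.1 hc.2.2
  have := hM.h0
  omega

theorem IsEven.sub_pr {k : ℕ} {M : C.Div} (hM : C.IsEven (k + 2) M) (hk : k + 4 ≤ C.genus)
    (x : C.Point) : C.IsEven (k + 1) (M - C.pr x) := by
  induction k generalizing M x with
  | zero =>
    refine hM.sub_pr_of_le hk ?_
    have h : C.IsTetragonal M := ⟨by rw [hM.deg]; norm_num, by rw [hM.h0]⟩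
    exact h.h0_sub_pr_pos x
  | succ k ih =>
    refine hM.sub_pr_of_le hk ?_
    by_contra! hlt
    have hM0 := hM.h0
    have h1 (w : C.Point) (hw : w ∉ {x | C.h0 (M - C.pr x) + 1 < k + 1 + 2}) :
        k + 1 ≤ C.h0 (M - C.pr w - C.pr x) := by
      have h2 := hM.sub_pr_of_le hk (x := w) (by
        simp only [Set.mem_ofPred_eq] at hw
        omega)
      exact (ih h2 (by omega) x).h0.ge
    have hfin := hM.finite
    obtain ⟨w, hw⟩ := exists_notMem_finite hfin
    have h3 := h1 w hw
    have h4 : C.h0 (M - C.pr w - C.pr x) ≤ C.h0 (M - C.pr x) :=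
      h0_mono (sub_le_sub_right (sub_le_self _ (pr_nonneg w)) _)
    obtain ⟨v, hv⟩ := exists_notMem_finite
      (hfin.union (h0_sub_pr_finite (M := M - C.pr x) (by omega)))
    rw [Set.mem_union, not_or] at hv
    have h5 := h1 v hv.1
    have h6 : C.h0 (M - C.pr x - C.pr v) ≤ C.h0 (M - C.pr x) :=
      h0_mono (sub_le_self _ (pr_nonneg v))
    refine hv.2 ?_
    rw [sub_right_comm] at h5
    change C.h0 _ = C.h0 _
    omega

variable (C) in
/-- The pushforward of divisors along `conj`. -/
def conjDiv : C.Div →+ C.Div := Finsupp.mapDomain.addMonoidHom C.conj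

theorem conj_injective : Function.Injective C.conj := fun a b h => by
  rw [← conj_conj a, h, conj_conj]

theorem conjDiv_apply (D : C.Div) (z : C.Point) : C.conjDiv D z = D (C.conj z) := by
  conv_lhs => rw [← conj_conj z]
  exact Finsupp.mapDomain_apply conj_injective D _

theorem conjDiv_pt (z : C.Point) : C.conjDiv (C.pt z) = C.pt (C.conj z) :=
  Finsupp.mapDomain_single

theorem conjDiv_nonneg {D : C.Div} (h : 0 ≤ D) : 0 ≤ C.conjDiv D := fun z => by
  rw [conjDiv_apply]
  exact h _

variable (C) in
/-- `D + conjDiv D`. -/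
def bar : C.Div →+ C.Div := AddMonoidHom.id _ + C.conjDiv

theorem bar_apply (D : C.Div) : C.bar D = D + C.conjDiv D := rfl

theorem bar_pt (z : C.Point) : C.bar (C.pt z) = C.pr z := by
  rw [bar_apply, conjDiv_pt, pr]

theorem bar_nonneg {D : C.Div} (h : 0 ≤ D) : 0 ≤ C.bar D := add_nonneg h (conjDiv_nonneg h)

theorem deg_bar {D : C.Div} (h : 0 ≤ D) : C.deg (C.bar D) = 2 * C.deg D := by
  induction h using effective_induction with
  | h0 => simp
  | hadd D z _ ih => rw [map_add, deg_add, ih, bar_pt, deg_pr, deg_add, deg_pt]; ring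

theorem deg_conjDiv {D : C.Div} (h : 0 ≤ D) : C.deg (C.conjDiv D) = C.deg D := by
  have := deg_bar h
  rw [bar_apply, deg_add] at this
  omega

theorem IsEven.sub_bar {k : ℕ} {M E : C.Div} (hM : C.IsEven k M) (hk : k + 2 ≤ C.genus)
    (hE : 0 ≤ E) {m : ℕ} (hm : 1 ≤ m) (hEk : C.deg E + m = k) : C.IsEven m (M - C.bar E) := by
  induction hE using effective_induction generalizing m with
  | h0 =>
    rw [deg_zero] at hEk
    obtain rfl : m = k := by omega
    simpa using hM
  | hadd D z hD ih =>
    rw [deg_add, deg_pt] at hEk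
    obtain ⟨m, rfl⟩ : ∃ m', m = m' + 1 := ⟨m - 1, by omega⟩
    rw [map_add, bar_pt, ← sub_sub]
    refine (ih (m := m + 2) (by omega) (by push_cast at hEk ⊢; omega)).sub_pr ?_ z
    have := deg_nonneg hD
    push_cast at hEk
    omega

theorem exists_finite_isEven : ∃ R : Set C.Point, R.Finite ∧
    ∀ y ∉ R, C.IsEven (C.genus - 2) (C.K - C.pr y) := by
  obtain ⟨R, hR, h⟩ := exists_finite_isTetragonal_pr_add (C := C)
  have hg := IsExceptional.six_le_genus (C := C)
  refine ⟨R, hR, fun y hy => ⟨?_, ?_, ?_⟩⟩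
  · rw [deg_sub, deg_K, deg_pr]
    omega
  · have := h0_K_sub (C.pr y)
    rw [h0_pr, deg_pr] at this
    omega
  · refine (Set.toFinite {y, C.conj y}).subset fun x hx => ?_
    by_contra hc
    simp only [Set.mem_insert_iff, Set.mem_singleton_iff, not_or, Set.mem_ofPred_eq] at hc hx
    have h1 := h y hy x hc.1 hc.2
    have h2 := h0_K_sub (C.pr y + C.pr x)
    rw [h1.1, h1.isBPFPencil.2, ← sub_sub] at h2
    omega

theorem isTetragonal_K_sub_bar {E : C.Div} (hE : 0 ≤ E) (hdeg : C.deg E + 3 = C.genus) :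
    C.IsTetragonal (C.K - C.bar E) := by
  refine ⟨by rw [deg_sub, deg_K, deg_bar hE]; omega, ?_⟩
  have hg := IsExceptional.six_le_genus (C := C)
  obtain ⟨R, hR, h⟩ := exists_finite_isEven (C := C)
  have h1 (y : C.Point) (hy : y ∉ R) : C.h0 (C.K - C.bar E - C.pr y) = 1 := by
    rw [sub_right_comm]
    exact ((h y hy).sub_bar (m := 1) (by omega) hE le_rfl (by push_cast; omega)).h0
  obtain ⟨y, hy⟩ := exists_notMem_finite hR
  have h2 : C.h0 (C.K - C.bar E - C.pr y) ≤ C.h0 (C.K - C.bar E) :=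
    h0_mono (sub_le_self _ (pr_nonneg y))
  rw [h1 y hy] at h2
  obtain ⟨w, hw⟩ := exists_notMem_finite
    (hR.union (h0_sub_pr_finite (M := C.K - C.bar E) (by omega)))
  rw [Set.mem_union, not_or] at hw
  have h3 := h1 w hw.1
  have h4 : ¬ C.h0 (C.K - C.bar E - C.pr w) = C.h0 (C.K - C.bar E) := hw.2
  omega

variable (C) in
/-- `D` contains no pair of partners. -/
def PairFree (D : C.Div) : Prop := ∀ z, ¬ C.pr z ≤ D

theorem PairFree.mono {D D' : C.Div} (h : C.PairFree D) (h' : D' ≤ D) : C.PairFree D' :=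
  fun z hz => h z (hz.trans h')

theorem h0_K_sub_bar_sub {F D : C.Div} (hF : 0 ≤ F) (hD : 0 ≤ D) (hp : C.PairFree D)
    (hdeg : C.deg D + C.deg F + 2 ≤ C.genus) :
    (C.h0 (C.K - C.bar F - D) : ℤ) = C.h0 (C.K - C.bar F) - C.deg D := by
  induction hD using effective_induction with
  | h0 => simp
  | hadd D x hD ih =>
    have hle : D ≤ D + C.pt x := le_add_of_nonneg_right (pt_nonneg x)
    have hdF := deg_nonneg hF
    have hdD := deg_nonneg hD
    rw [deg_add, deg_pt] at hdeg
    have h1 := ih (hp.mono hle) (by omega)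
    obtain ⟨w, hw⟩ := exists_notMem_finite (Set.toFinite {x, C.conj x})
    simp only [Set.mem_insert_iff, Set.mem_singleton_iff, not_or] at hw
    obtain ⟨n, hn⟩ : ∃ n : ℕ, C.deg D + C.deg F + n + 3 = C.genus :=
      ⟨(C.genus - 3 - C.deg D - C.deg F).toNat, by omega⟩
    have hnw : 0 ≤ n • C.pt w := nsmul_nonneg (pt_nonneg w) n
    have hT := isTetragonal_K_sub_bar (C := C) (E := D + F + n • C.pt w)
      (add_nonneg (add_nonneg hD hF) hnw) (by
        rw [deg_add, deg_add, deg_nsmul, deg_pt]; omega)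
    obtain ⟨s, hs, hs'⟩ := exists_notMem_of_h0_lt (D := C.K - C.bar (D + F + n • C.pt w))
      (D' := C.K - C.bar (D + F + n • C.pt w) - C.pt x) (by
        have h2 := hT.2
        have h3 := hT.isBPFPencil.h0_sub_pt x
        omega)
    have hM : C.K - C.bar (D + F + n • C.pt w) =
        C.K - C.bar F - D - (C.conjDiv D + C.bar (n • C.pt w)) := by
      rw [map_add, map_add, bar_apply D]
      abel
    have hx0 : (C.conjDiv D + C.bar (n • C.pt w)) x = 0 := by
      have h2 : C.pr w x = 0 := pr_apply_eq_zero hw.1 fun h => hw.2 (by rw [← h, conj_conj])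
      rw [Finsupp.add_apply, map_nsmul, bar_pt, Finsupp.smul_apply, h2, smul_zero, add_zero,
        conjDiv_apply]
      by_contra hne
      refine hp (C.conj x) ?_
      rw [pr, conj_conj]
      exact add_le_add_left ((pt_le_iff hD).2 (lt_of_le_of_ne (hD _) (Ne.symm hne))) _
    have h2 : C.h0 (C.K - C.bar F - D - C.pt x) < C.h0 (C.K - C.bar F - D) := by
      refine h0_lt_of_notMem (sub_pt_le _ x) (f := s) ?_ (notMem_H0_sub_pt_of_le hs hs' ?_)
      · refine C.H0_mono (fun P => ?_) hs
        rw [hM]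
        exact sub_le_self (C.K - C.bar F - D) (add_nonneg (conjDiv_nonneg hD) (bar_nonneg hnw)) P
      · rw [hM, Finsupp.sub_apply _ (_ + _), hx0, sub_zero]
    have h3 := h0_le_sub_pt (C.K - C.bar F - D) x
    rw [← sub_sub, deg_add, deg_pt]
    omega

theorem PairFree.h0_eq_one {D : C.Div} (hp : C.PairFree D) (hD : 0 ≤ D)
    (hdeg : C.deg D + 2 ≤ C.genus) : C.h0 D = 1 := by
  have h1 := h0_K_sub_bar_sub (C := C) le_rfl hD hp (by simpa using hdeg)
  have h2 := h0_K_sub D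
  rw [map_zero, sub_zero, h0_K] at h1
  omega

theorem PairFree.isBPFPencil {D : C.Div} (hp : C.PairFree D) (hD : 0 ≤ D)
    (hdeg : C.deg D = C.genus - 1) (h2 : 2 ≤ C.h0 D) : C.IsBPFPencil D := by
  have h3 (x : C.Point) (hx : C.pt x ≤ D) : C.h0 (D - C.pt x) = 1 :=
    (hp.mono (sub_pt_le D x)).h0_eq_one (sub_nonneg.2 hx) (by
      rw [deg_sub, deg_pt, hdeg]; omega)
  have hg := IsExceptional.six_le_genus (C := C)
  obtain ⟨x, hx⟩ := exists_pt_le hD (by omega)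
  have h4 := h0_le_sub_pt D x
  have h5 := h3 x hx
  refine ⟨fun P => ?_, by omega⟩
  by_cases hP : C.pt P ≤ D
  · have := h3 P hP
    omega
  · have h6 := h0_lt_of_notMem (sub_pt_le D P) (one_mem_H0_iff.2 hD) (by
      rwa [one_mem_H0_iff, sub_nonneg])
    have h7 := h0_le_sub_pt D P
    omega

end Exceptional

end Curve

section DerivationExtension

variable {k L : Type} [Field k] [Field L] [Algebra k L] [CharZero k]

theorem IsTranscendenceBasis.exists_derivation {ι : Type} {y : ι → L}
    (hy : IsTranscendenceBasis k y) (φ : ι → L) :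
    ∃ d : Derivation k L L, ∀ i, d (y i) = φ i := by
  let : Algebra (MvPolynomial ι k) L := (MvPolynomial.aeval y).toRingHom.toAlgebra
  have hmap : ∀ p, algebraMap (MvPolynomial ι k) L p = MvPolynomial.aeval y p := fun p => rfl
  have : IsScalarTower k (MvPolynomial ι k) L := IsScalarTower.of_algebraMap_eq fun c => by
    rw [hmap]; simp
  have : FaithfulSMul (MvPolynomial ι k) L :=
    (faithfulSMul_iff_algebraMap_injective _ _).mpr hy.1
  have : Algebra.IsAlgebraic (MvPolynomial ι k) L := by
    have := hy.isAlgebraic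
    exact Algebra.IsAlgebraic.of_ringHom_of_comp_eq (S := Algebra.adjoin k (Set.range y))
      (B := L) hy.1.aevalEquiv.toRingEquiv.toRingHom (RingHom.id L)
      hy.1.aevalEquiv.surjective (fun _ _ h => h) (by
        ext p <;> simp [hmap])
  let := FractionRing.liftAlgebra (MvPolynomial ι k) L
  have := FractionRing.isScalarTower_liftAlgebra (MvPolynomial ι k) L
  have : Algebra.IsAlgebraic (FractionRing (MvPolynomial ι k)) L :=
    (IsFractionRing.comap_isAlgebraic_iff (A := MvPolynomial ι k)).mp inferInstance
  have : CharZero (FractionRing (MvPolynomial ι k)) :=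
    charZero_of_injective_algebraMap
      (algebraMap k (FractionRing (MvPolynomial ι k))).injective
  have : Algebra.FormallyEtale (FractionRing (MvPolynomial ι k)) L :=
    Algebra.FormallyEtale.of_isSeparable _ _
  have : Algebra.FormallyEtale (MvPolynomial ι k) (FractionRing (MvPolynomial ι k)) :=
    Algebra.FormallyEtale.of_isLocalization (nonZeroDivisors (MvPolynomial ι k))
  have : Algebra.FormallyEtale (MvPolynomial ι k) L :=
    Algebra.FormallyEtale.comp _ (FractionRing (MvPolynomial ι k)) _
  let d₀ : Derivation k (MvPolynomial ι k) L := MvPolynomial.mkDerivation k φ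
  let hb := KaehlerDifferential.isBaseChange_of_formallyEtale k (MvPolynomial ι k) L
  refine ⟨(hb.lift d₀.liftKaehlerDifferential).compDer (KaehlerDifferential.D k L), fun i => ?_⟩
  have h1 : y i = algebraMap (MvPolynomial ι k) L (MvPolynomial.X i) := by
    rw [hmap, MvPolynomial.aeval_X]
  change hb.lift d₀.liftKaehlerDifferential (KaehlerDifferential.D k L (y i)) = φ i
  rw [h1, ← KaehlerDifferential.map_D k k, hb.lift_eq, Derivation.liftKaehlerDifferential_comp_D]
  exact MvPolynomial.mkDerivation_X _ _ _

theorem AlgebraicIndependent.exists_derivation {ι : Type} {y : ι → L}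
    (hy : AlgebraicIndependent k y) (φ : ι → L) :
    ∃ d : Derivation k L L, ∀ i, d (y i) = φ i := by
  classical
  obtain ⟨t, hts, ht⟩ := exists_isTranscendenceBasis_superset hy.coe_range
  obtain ⟨d, hd⟩ := ht.exists_derivation
    (fun z => if h : ∃ i, y i = z then φ h.choose else 0)
  refine ⟨d, fun i => ?_⟩
  have h := hd ⟨y i, hts ⟨i, rfl⟩⟩
  have hex : ∃ j, y j = y i := ⟨i, rfl⟩
  simp only [hex, dite_true] at h
  rw [h, hy.injective hex.choose_spec]

end DerivationExtension

/-- A derivation vanishing on a generator of the base of an algebraic extension vanishes. -/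
theorem Derivation.eq_zero_of_isAlgebraic_adjoin {k F L : Type} [Field k] [CharZero k] [Field F]
    [Algebra k F] [Field L] [Algebra k L] [Algebra F L] [IsScalarTower k F L]
    (d : Derivation k F L) {x : F} (hx : d x = 0)
    [Algebra.IsAlgebraic (IntermediateField.adjoin k {x}) F] (f : F) : d f = 0 := by
  have hinv : ∀ a, d a = 0 → d a⁻¹ = 0 := fun a ha => by
    rw [Derivation.leibniz_inv, ha, smul_zero]
  let E : IntermediateField k F :=
    { carrier := {a | d a = 0}
      mul_mem' := fun {a b} ha hb => by
        change d (a * b) = 0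
        rw [d.leibniz, show d a = 0 from ha, show d b = 0 from hb, smul_zero, smul_zero, add_zero]
      add_mem' := fun {a b} ha hb => by
        change d (a + b) = 0
        rw [map_add, show d a = 0 from ha, show d b = 0 from hb, add_zero]
      algebraMap_mem' := fun c => d.map_algebraMap c
      inv_mem' := fun a ha => hinv a ha }
  have hE : IntermediateField.adjoin k {x} ≤ E :=
    IntermediateField.adjoin_le_iff.mpr (Set.singleton_subset_iff.mpr hx)
  have hmem : ∀ a : E, d (a : F) = 0 := fun a => a.2
  have hf : IsAlgebraic E f := by
    obtain ⟨p, hp, hpf⟩ := Algebra.IsAlgebraic.isAlgebraic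
      (R := IntermediateField.adjoin k {x}) f
    refine ⟨p.map (IntermediateField.inclusion hE).toRingHom, ?_, ?_⟩
    · exact (Polynomial.map_ne_zero_iff (IntermediateField.inclusion hE).injective).mpr hp
    · rw [Polynomial.aeval_def, Polynomial.eval₂_map]
      exact hpf
  let d' : Derivation E F L :=
    { toFun := d
      map_add' := d.map_add
      map_smul' := fun a b => by
        change d ((a : F) * b) = a • d b
        rw [d.leibniz, hmem, smul_zero, add_zero]; rfl
      map_one_eq_zero' := d.map_one_eq_zero
      leibniz' := d.leibniz }
  have h1 : d' (Polynomial.aeval f (minpoly E f)) = 0 := by rw [minpoly.aeval, map_zero]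
  rw [Derivation.map_aeval] at h1
  rcases smul_eq_zero.mp h1 with h | h
  · have hs : (minpoly E f).Separable := (minpoly.irreducible hf.isIntegral).separable
    exact absurd h (hs.aeval_derivative_ne_zero (minpoly.aeval _ _))
  · exact h

namespace Curve
variable {C : Curve}

theorem transcendental_of_nonconst {f : C.F} (hf : ∀ c, f ≠ algebraMap ℂ C.F c) :
    Transcendental ℂ f := fun h => by
  obtain ⟨c, hc⟩ := minpoly.mem_range_of_degree_eq_one ℂ f
    (IsAlgClosed.degree_eq_one_of_irreducible ℂ (minpoly.irreducible h.isIntegral))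
  exact hf c hc.symm

theorem exists_derivation_eq_one {f : C.F} (hf : ∀ c, f ≠ algebraMap ℂ C.F c) :
    ∃ d : Derivation ℂ C.F C.F, d f = 1 := by
  have h := (algebraicIndependent_unique_type_iff (ι := Unit) (x := fun _ => f)).mpr
    (transcendental_of_nonconst hf)
  obtain ⟨d, hd⟩ := h.exists_derivation (fun _ => 1)
  exact ⟨d, hd ()⟩

/-- The derivation `d/dx` of the function field. -/
def ddx (C : Curve) : Derivation ℂ C.F C.F :=
  (exists_derivation_eq_one (C := C) C.x_ne_const).choose

theorem ddx_x : C.ddx C.x = 1 := (exists_derivation_eq_one C.x_ne_const).choose_spec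

theorem derivation_eq_smul_ddx (d : Derivation ℂ C.F C.F) (f : C.F) :
    d f = d C.x * C.ddx f := by
  have h := Derivation.eq_zero_of_isAlgebraic_adjoin (d - d C.x • C.ddx) (x := C.x)
    (by simp [ddx_x]) f
  simpa [sub_eq_zero] using h

theorem ddx_ne_zero {f : C.F} (hf : ∀ c, f ≠ algebraMap ℂ C.F c) : C.ddx f ≠ 0 := fun h => by
  obtain ⟨d, hd⟩ := exists_derivation_eq_one hf
  have := derivation_eq_smul_ddx d f
  rw [hd, h, mul_zero] at this
  exact one_ne_zero this

end Curve

namespace Curve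
variable {C : Curve}

/-- The divisor of poles of `f`. -/
def polar (C : Curve) (f : C.F) : C.Div := -C.divOf f ⊔ 0

theorem polar_apply {f : C.F} (hf : f ≠ 0) (P : C.Point) :
    C.polar f P = max (-C.ord P f) 0 := by
  rw [polar, Finsupp.sup_apply, Finsupp.neg_apply, divOf_apply hf]; rfl

theorem polar_nonneg (f : C.F) : 0 ≤ C.polar f := le_sup_right

theorem mem_H0_polar (f : C.F) : f ∈ C.H0 (C.polar f) := by
  rcases eq_or_ne f 0 with rfl | hf
  · exact zero_mem _
  · refine Or.inr fun P => ?_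
    rw [polar_apply hf]; omega

theorem polar_apply_eq_zero {f : C.F} {P : C.Point} (hf : f ≠ 0) (h : f ∈ C.V P 0) :
    C.polar f P = 0 := by
  rw [polar_apply hf]
  have := (mem_V_iff hf).1 h
  omega

theorem deg_polar_pos {f : C.F} (hf : ∀ c, f ≠ algebraMap ℂ C.F c) : 1 ≤ C.deg (C.polar f) := by
  by_contra h
  have h0 := deg_nonneg (C.polar_nonneg f)
  have h1 := eq_zero_of_deg (C.polar_nonneg f) (by omega)
  have h2 := C.mem_H0_polar f
  rw [h1] at h2
  obtain ⟨c, hc⟩ := exists_const_of_mem_H0_zero h2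
  exact hf c hc

theorem h0_of_deg {D : C.Div} (h : 2 * (C.genus : ℤ) - 2 < C.deg D) :
    (C.h0 D : ℤ) = C.deg D + 1 - C.genus := by
  have h1 := h0_K_sub D
  have h2 : C.h0 (C.K - D) = 0 := h0_eq_zero_of_deg_neg (by simp [deg_K]; omega)
  omega

theorem mem_H0_of_mul_polar {f : C.F} (hf : f ≠ 0) {k : ℕ} {b : C.F}
    (hb : b ∈ C.H0 ((k + 1) • C.polar f)) (hfb : f * b ∈ C.H0 ((k + 1) • C.polar f)) :
    b ∈ C.H0 (k • C.polar f) := by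
  rcases eq_or_ne b 0 with rfl | hb0
  · exact zero_mem _
  refine Or.inr fun P => ?_
  have h1 := (hb.resolve_left hb0) P
  have h2 := (hfb.resolve_left (mul_ne_zero hf hb0)) P
  rw [C.ord_mul P f b hf hb0] at h2
  simp only [Finsupp.smul_apply, polar_apply hf, nsmul_eq_mul] at h1 h2 ⊢
  push_cast at h1 h2 ⊢
  rcases max_cases (-C.ord P f) 0 with ⟨h, _⟩ | ⟨h, _⟩ <;> rw [h] at h1 h2 ⊢ <;> linarith

theorem exists_add_mul_polar {f : C.F} (hf : ∀ c, f ≠ algebraMap ℂ C.F c) {k : ℕ}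
    (hk : 2 * C.genus ≤ k) {h : C.F} (hh : h ∈ C.H0 ((k + 2) • C.polar f)) :
    ∃ a ∈ C.H0 ((k + 1) • C.polar f), ∃ b ∈ C.H0 ((k + 1) • C.polar f), h = a + f * b := by
  have hf0 : f ≠ 0 := fun h => hf 0 (by simpa using h)
  set N := C.polar f with hN
  have hmono : (k + 1) • N ≤ (k + 2) • N := by
    rw [show k + 2 = k + 1 + 1 from rfl, succ_nsmul N (k + 1)]
    exact le_add_of_nonneg_right (C.polar_nonneg f)
  have hmul : ∀ b : C.H0 ((k + 1) • N), f * (b : C.F) ∈ C.H0 ((k + 2) • N) := fun b => by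
    have := C.mul_mem_H0 (C.mem_H0_polar f) b.2
    rwa [← hN, show N + (k + 1) • N = (k + 2) • N by
      rw [show k + 2 = k + 1 + 1 from rfl, succ_nsmul N (k + 1), add_comm]] at this
  let φ : (C.H0 ((k + 1) • N) × C.H0 ((k + 1) • N)) →ₗ[ℂ] C.H0 ((k + 2) • N) :=
    LinearMap.coprod (Submodule.inclusion (C.H0_mono hmono))
      ((((LinearMap.mulLeft ℂ f).comp (Submodule.subtype _))).codRestrict _ hmul)
  have hφ : ∀ p, ((φ p : C.F)) = (p.1 : C.F) + f * (p.2 : C.F) := fun p => rfl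
  have hker : ∀ p : LinearMap.ker φ, (p.1.2 : C.F) ∈ C.H0 (k • N) := fun p => by
    have h1 : (p.1.1 : C.F) + f * (p.1.2 : C.F) = 0 := by
      rw [← hφ, LinearMap.mem_ker.1 p.2]; rfl
    refine mem_H0_of_mul_polar hf0 p.1.2.2 ?_
    rw [eq_neg_of_add_eq_zero_right h1]
    exact neg_mem p.1.1.2
  let ψ : LinearMap.ker φ →ₗ[ℂ] C.H0 (k • N) :=
    (((Submodule.subtype _).comp (LinearMap.snd ℂ _ _)).comp
      (Submodule.subtype (LinearMap.ker φ))).codRestrict _ hker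
  have hψ : Function.Injective ψ := by
    intro p q hpq
    have h2 : (p.1.2 : C.F) = q.1.2 :=
      congrArg (fun t : C.H0 (k • N) => (t : C.F)) hpq
    have h1 : ∀ p : LinearMap.ker φ, (p.1.1 : C.F) = - (f * (p.1.2 : C.F)) := fun p => by
      rw [eq_neg_iff_add_eq_zero, ← hφ, LinearMap.mem_ker.1 p.2]; rfl
    have h3 : (p.1.1 : C.F) = q.1.1 := by rw [h1, h1, h2]
    exact Subtype.ext (Prod.ext (Subtype.ext h3) (Subtype.ext h2))
  have h1 := LinearMap.finrank_le_finrank_of_injective hψ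
  have h2 := LinearMap.finrank_range_add_finrank_ker φ
  have hd := deg_polar_pos hf
  rw [← hN] at hd
  have hdeg : ∀ m : ℕ, 2 * C.genus ≤ m →
      (C.h0 (m • N) : ℤ) = m * C.deg N + 1 - C.genus := fun m hm => by
    have e := deg_nsmul m N
    rw [h0_of_deg, e]
    rw [e]; nlinarith
  have d0 := hdeg k hk
  have d1 := hdeg (k + 1) (by omega)
  have d2 := hdeg (k + 2) (by omega)
  rw [Module.finrank_prod] at h2
  change _ + _ = C.h0 _ + C.h0 _ at h2
  change _ ≤ C.h0 _ at h1
  push_cast at d0 d1 d2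
  have htop : LinearMap.range φ = ⊤ := by
    refine Submodule.eq_top_of_finrank_eq (le_antisymm (Submodule.finrank_le _) ?_)
    change C.h0 _ ≤ _
    zify at h1 h2 ⊢
    nlinarith
  obtain ⟨p, hp⟩ := LinearMap.range_eq_top.1 htop ⟨h, hh⟩
  exact ⟨p.1, p.1.2, p.2, p.2.2, by rw [← hφ, hp]⟩

theorem mem_V_of_not_polar {D : C.Div} {P : C.Point} {f : C.F} (hf : f ∈ C.H0 D) (hD : D P = 0) :
    f ∈ C.V P 0 := by
  have := mem_H0_iff.1 hf P
  rwa [hD, neg_zero] at this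

theorem finite_notMem_V (f : C.F) : {P | f ∉ C.V P 0}.Finite := by
  rcases eq_or_ne f 0 with rfl | hf
  · simp
  · refine (C.ord_finite_support f hf).subset fun P hP => ?_
    rw [Set.mem_ofPred, mem_V_iff hf] at hP
    rw [Function.mem_support]; omega

/-- Outside finitely many points the derivation `d/dx` preserves regularity. -/
theorem exists_finite_ddx_mem_V : ∃ S : Set C.Point, S.Finite ∧ ∀ P ∉ S,
    C.x ∈ C.V P 0 ∧ ∀ f ∈ C.V P 0, C.ddx f ∈ C.V P 0 := by
  set N := C.polar C.x with hN
  have hx0 : C.x ≠ 0 := fun h => x_ne_const 0 (by simpa using h)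
  let m := 2 * C.genus + 1
  obtain ⟨s, hs⟩ := Submodule.fg_iff_finiteDimensional (C.H0 (m • N)) |>.2 inferInstance
  refine ⟨(N.support : Set C.Point) ∪ ⋃ f ∈ s, {P | C.ddx f ∉ C.V P 0},
    (Finset.finite_toSet _).union (s.finite_toSet.biUnion fun f _ => finite_notMem_V _),
    fun P hP => ?_⟩
  simp only [Set.mem_union, Finset.mem_coe, Finsupp.mem_support_iff, not_or, not_not,
    Set.mem_iUnion, not_exists] at hP
  obtain ⟨hNP, hP⟩ := hP
  have hkN : ∀ k : ℕ, (k • N) P = 0 := fun k => by simp [hNP]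
  have hxV : C.x ∈ C.V P 0 := mem_V_of_not_polar (C.mem_H0_polar _) hNP
  have hmulV : ∀ {a b : C.F}, a ∈ C.V P 0 → b ∈ C.V P 0 → a * b ∈ C.V P 0 := fun ha hb => by
    simpa using mul_mem_V ha hb
  have hbase : C.H0 (m • N) ≤ (C.V P 0).comap C.ddx.toLinearMap := by
    rw [← hs, Submodule.span_le]
    exact fun f hf => not_not.1 (hP f hf)
  have hall : ∀ k : ℕ, C.H0 ((m + k) • N) ≤ (C.V P 0).comap C.ddx.toLinearMap := by
    intro k
    induction k with
    | zero => exact hbase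
    | succ k ih =>
      intro f hf
      rw [show m + (k + 1) = (2 * C.genus + k) + 2 by omega] at hf
      obtain ⟨a, ha, b, hb, rfl⟩ := exists_add_mul_polar C.x_ne_const (by omega) hf
      rw [show 2 * C.genus + k + 1 = m + k by omega] at ha hb
      change C.ddx (a + C.x * b) ∈ C.V P 0
      rw [map_add, C.ddx.leibniz, ddx_x, smul_eq_mul, smul_eq_mul, mul_one]
      exact add_mem (ih ha) (add_mem (hmulV hxV (ih hb)) (mem_V_of_not_polar hb (hkN _)))
  refine ⟨hxV, fun f hf => ?_⟩
  rcases eq_or_ne f 0 with rfl | hf0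
  · simp
  have hEP := polar_apply_eq_zero hf0 hf
  set E := C.polar f with hE
  have hE0 : 0 ≤ E := C.polar_nonneg f
  obtain ⟨k, hk⟩ : ∃ k : ℕ, 2 * C.genus + C.deg E ≤ k :=
    ⟨(2 * C.genus + C.deg E).toNat, Int.self_le_toNat _⟩
  have hdN : 1 ≤ C.deg N := deg_polar_pos C.x_ne_const
  have hdeg : 2 * C.genus + C.deg E ≤ C.deg ((m + k) • N) := by
    rw [deg_nsmul]; push_cast
    nlinarith [deg_nonneg hE0]
  have hlt : C.h0 ((m + k) • N - E - C.pt P) < C.h0 ((m + k) • N - E) := by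
    have h1 := h0_of_deg (D := (m + k) • N - E) (by rw [deg_sub]; omega)
    have h2 := h0_of_deg (D := (m + k) • N - E - C.pt P) (by rw [deg_sub, deg_sub, deg_pt]; omega)
    rw [deg_sub (D := (m + k) • N - E), deg_pt] at h2
    omega
  obtain ⟨b, hb, hb'⟩ := exists_notMem_of_h0_lt hlt
  have hbN : b ∈ C.H0 ((m + k) • N) := C.H0_mono (fun Q => sub_le_self _ hE0 Q) hb
  have hbf : b * f ∈ C.H0 ((m + k) • N) := by
    have := C.mul_mem_H0 hb (C.mem_H0_polar f)
    rwa [← hE, sub_add_cancel] at this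
  have hbP : b ∉ C.V P 1 := fun h => hb' (mem_H0_sub_pt.2 ⟨hb, by
    simpa [hNP, hEP] using h⟩)
  have hbV : b ∈ C.V P 0 := mem_V_of_not_polar hbN (hkN _)
  obtain ⟨hb0, hord⟩ := ord_eq_of_mem_of_notMem hbV (by simpa using hbP)
  have h1 : C.ddx (b * f) ∈ C.V P 0 := hall k hbf
  have h2 : C.ddx b ∈ C.V P 0 := hall k hbN
  rw [C.ddx.leibniz, smul_eq_mul, smul_eq_mul] at h1
  have h3 : b * C.ddx f ∈ C.V P 0 := by
    have := sub_mem h1 (hmulV hf h2)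
    rwa [add_sub_cancel_right] at this
  have := (mul_mem_V_iff (P := P) (n := 0) (g := C.ddx f) hb0).1 (by rwa [hord, add_zero])
  exact this

end Curve

namespace Curve
variable {C : Curve}

/-- `x` and the derivation `d/dx` are regular at `P`. -/
def Good (C : Curve) (P : C.Point) : Prop :=
  C.x ∈ C.V P 0 ∧ ∀ f ∈ C.V P 0, C.ddx f ∈ C.V P 0

theorem finite_not_good : {P | ¬ C.Good P}.Finite := by
  obtain ⟨S, hS, h⟩ := exists_finite_ddx_mem_V (C := C)
  exact hS.subset fun P hP => by_contra fun h' => hP (h P h')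

open Classical in
/-- The value of `f` at `P`, set to `0` when `f` has a pole at `P`. -/
def val (C : Curve) (P : C.Point) (f : C.F) : ℂ :=
  if h : f ∈ C.V P 0 then (exists_sub_mem_V h).choose else 0

theorem val_spec {P : C.Point} {f : C.F} (h : f ∈ C.V P 0) :
    f - algebraMap ℂ C.F (C.val P f) ∈ C.V P 1 := by
  rw [val, dif_pos h]; exact (exists_sub_mem_V h).choose_spec

theorem val_eq {P : C.Point} {f : C.F} {c : ℂ} (h : f - algebraMap ℂ C.F c ∈ C.V P 1) :
    C.val P f = c := by
  have hf : f ∈ C.V P 0 := by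
    have := add_mem (V_anti P zero_le_one h) (algebraMap_mem_V P c)
    rwa [sub_add_cancel] at this
  exact eq_of_sub_mem_V (val_spec hf) h

theorem val_add {P : C.Point} {f g : C.F} (hf : f ∈ C.V P 0) (hg : g ∈ C.V P 0) :
    C.val P (f + g) = C.val P f + C.val P g := by
  apply val_eq
  rw [map_add, add_sub_add_comm]
  exact add_mem (val_spec hf) (val_spec hg)

theorem val_mul {P : C.Point} {f g : C.F} (hf : f ∈ C.V P 0) (hg : g ∈ C.V P 0) :
    C.val P (f * g) = C.val P f * C.val P g := by
  apply val_eq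
  have h1 := mul_mem_V (val_spec hf) hg
  have h2 := mul_mem_V (algebraMap_mem_V P (C.val P f)) (val_spec hg)
  rw [add_zero] at h1
  rw [zero_add] at h2
  convert add_mem h1 h2 using 1
  rw [map_mul]; ring

@[simp] theorem val_algebraMap (P : C.Point) (c : ℂ) : C.val P (algebraMap ℂ C.F c) = c :=
  val_eq (by simp)

@[simp] theorem val_zero (P : C.Point) : C.val P 0 = 0 := by
  simpa using val_algebraMap P 0

@[simp] theorem val_one (P : C.Point) : C.val P 1 = 1 := by
  simpa using val_algebraMap P 1

theorem val_eq_zero_iff {P : C.Point} {f : C.F} (hf : f ∈ C.V P 0) :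
    C.val P f = 0 ↔ f ∈ C.V P 1 :=
  ⟨fun h => by simpa [h] using val_spec hf, fun h => val_eq (by simpa using h)⟩

theorem val_smul {P : C.Point} {f : C.F} (hf : f ∈ C.V P 0) (c : ℂ) :
    C.val P (c • f) = c * C.val P f := by
  rw [Algebra.smul_def, val_mul (algebraMap_mem_V P c) hf, val_algebraMap]

theorem val_sum {ι : Type*} {P : C.Point} (s : Finset ι) {f : ι → C.F}
    (hf : ∀ i, f i ∈ C.V P 0) : C.val P (∑ i ∈ s, f i) = ∑ i ∈ s, C.val P (f i) := by
  classical
  induction s using Finset.induction_on with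
  | empty => simp
  | insert a s ha ih =>
    rw [Finset.sum_insert ha, Finset.sum_insert ha, val_add (hf a) (sum_mem fun i _ => hf i), ih]

theorem one_notMem_V (P : C.Point) {n : ℤ} (hn : 1 ≤ n) : (1 : C.F) ∉ C.V P n := by
  rw [mem_V_iff one_ne_zero, ord_one]; omega

theorem mem_V_mul_pow {P : C.Point} {w f : C.F} (hw : w ≠ 0) (h1 : C.ord P w = 1) {n : ℕ}
    (hf : f ∈ C.V P n) : ∃ v ∈ C.V P 0, f = w ^ n * v := by
  refine ⟨f / w ^ n, ?_, by field_simp⟩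
  rcases eq_or_ne f 0 with rfl | hf0
  · simp
  · rw [mem_V_iff (div_ne_zero hf0 (pow_ne_zero _ hw)), ord_div P hf0 (pow_ne_zero _ hw),
      ord_pow P hw, h1]
    have := (mem_V_iff hf0).1 hf
    omega

theorem Good.ddx_mem {P : C.Point} (hP : C.Good P) {n : ℕ} {f : C.F} (hf : f ∈ C.V P (n + 1 : ℕ)) :
    C.ddx f ∈ C.V P n := by
  obtain ⟨w, hw, h1⟩ := C.ord_uniformizer P
  obtain ⟨v, hv, rfl⟩ := mem_V_mul_pow hw h1 hf
  have hwV : w ∈ C.V P 1 := h1 ▸ mem_V_ord P w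
  have hp : ∀ k : ℕ, w ^ k ∈ C.V P k := fun k => by simpa using pow_mem_V hwV k
  have hmul : ∀ {a b : C.F}, a ∈ C.V P n → b ∈ C.V P 0 → a * b ∈ C.V P n := fun ha hb => by
    simpa using mul_mem_V ha hb
  rw [C.ddx.leibniz, C.ddx.leibniz_pow, smul_eq_mul, smul_eq_mul, Nat.add_sub_cancel]
  refine add_mem (hmul (V_anti P (by push_cast; omega) (hp (n + 1))) (hP.2 v hv)) ?_
  rw [mul_comm]
  refine hmul ?_ hv
  rw [nsmul_eq_mul, smul_eq_mul]
  have := (C.V P n).smul_mem ((n + 1 : ℕ) : ℂ)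
    (hmul (hp n) (hP.2 w (V_anti P zero_le_one hwV)))
  simpa [Algebra.smul_def] using this

theorem Good.ord_x_sub {P : C.Point} (hP : C.Good P) :
    C.ord P (C.x - algebraMap ℂ C.F (C.val P C.x)) = 1 := by
  refine (ord_eq_of_mem_of_notMem (val_spec hP.1) fun h => ?_).2
  have := hP.ddx_mem (n := 1) (by simpa using h)
  rw [map_sub, ddx_x, Derivation.map_algebraMap, sub_zero] at this
  exact one_notMem_V P le_rfl (by simpa using this)

theorem Good.mem_V_succ {P : C.Point} (hP : C.Good P) {n : ℕ} {f : C.F} (hf : f ∈ C.V P 1)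
    (hd : C.ddx f ∈ C.V P n) : f ∈ C.V P (n + 1 : ℕ) := by
  rcases eq_or_ne f 0 with rfl | hf0
  · simp
  by_contra hcon
  rw [mem_V_iff hf0] at hf hcon
  set u := C.x - algebraMap ℂ C.F (C.val P C.x) with hu
  have hu0 : u ≠ 0 := x_ne _
  have hu1 : C.ord P u = 1 := hP.ord_x_sub
  obtain ⟨m, hm⟩ : ∃ m : ℕ, C.ord P f = (m + 1 : ℕ) :=
    ⟨(C.ord P f - 1).toNat, by push_cast; omega⟩
  have ho : C.ord P (u ^ (m + 1)) = (m + 1 : ℕ) := by rw [ord_pow P hu0, hu1, mul_one]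
  obtain ⟨c, hc⟩ := exists_sub_smul_mem_V (pow_ne_zero (m + 1) hu0) ho (hm ▸ mem_V_ord P f)
  have hc0 : c ≠ 0 := by
    rintro rfl
    rw [zero_smul, sub_zero, mem_V_iff hf0] at hc
    omega
  have h1 := hP.ddx_mem (n := m + 1) hc
  have h2 : C.ddx f ∈ C.V P (m + 1 : ℕ) := V_anti P (by omega) hd
  have h3 := sub_mem h2 h1
  have hdu : C.ddx u = 1 := by rw [hu, map_sub, ddx_x, Derivation.map_algebraMap, sub_zero]
  rw [map_sub, sub_sub_cancel, Derivation.map_smul, C.ddx.leibniz_pow, hdu, Nat.add_sub_cancel,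
    smul_eq_mul, mul_one] at h3
  have h4 := ((C.V P (m + 1 : ℕ)).smul_mem_iff hc0).1 h3
  rw [← Nat.cast_smul_eq_nsmul ℂ, Submodule.smul_mem_iff _ (Nat.cast_ne_zero.2 m.succ_ne_zero),
    mem_V_iff (pow_ne_zero _ hu0), ord_pow P hu0, hu1] at h4
  push_cast at h4
  omega

theorem Good.mem_V_iff_forall {P : C.Point} (hP : C.Good P) (n : ℕ) {f : C.F}
    (hf : f ∈ C.V P 0) : f ∈ C.V P n ↔ ∀ k < n, C.val P (C.ddx^[k] f) = 0 := by
  induction n generalizing f with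
  | zero => simpa using hf
  | succ n ih =>
    have ih' := ih (hP.2 f hf)
    constructor
    · rintro h (_ | k) hk
      · exact (val_eq_zero_iff hf).2 (V_anti P (by push_cast; omega) h)
      · exact ih'.1 (hP.ddx_mem h) k (by omega)
    · intro h
      refine hP.mem_V_succ ((val_eq_zero_iff hf).1 (h 0 (by omega))) (ih'.2 fun k hk => ?_)
      exact h (k + 1) (by omega)

/-- A nonconstant function is unramified outside finitely many points. -/
theorem finite_ramified {f : C.F} (hf : ∀ c, f ≠ algebraMap ℂ C.F c) :
    {P | f ∉ C.V P 0 ∨ f - algebraMap ℂ C.F (C.val P f) ∈ C.V P 2}.Finite := by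
  refine (((finite_not_good (C := C)).union (finite_notMem_V f)).union
    (C.ord_finite_support _ (ddx_ne_zero hf))).subset fun P hP => ?_
  by_contra h
  simp only [Set.mem_union, Set.mem_ofPred, not_or, not_not, Function.mem_support] at h
  obtain ⟨⟨h1, h2⟩, h3⟩ := h
  rcases hP with hP | hP
  · exact hP h2
  · have := h1.ddx_mem (n := 1) hP
    rw [map_sub, Derivation.map_algebraMap, sub_zero, mem_V_iff (ddx_ne_zero hf), h3] at this
    simp at this

end Curve

/-- The ultrapower of `ℂ` along an ultrafilter. -/
def Ultrapower {I : Type} (U : Ultrafilter I) : Type := (U : Filter I).Germ ℂ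

namespace Ultrapower
variable {I : Type} {U : Ultrafilter I}

instance : Field (Ultrapower U) := inferInstanceAs (Field ((U : Filter I).Germ ℂ))

/-- The class of a function in the ultrapower. -/
def mk (U : Ultrafilter I) : (I → ℂ) →+* Ultrapower U := Filter.Germ.coeRingHom (U : Filter I)

theorem mk_eq {f g : I → ℂ} : mk U f = mk U g ↔ ∀ᶠ i in U, f i = g i := Filter.Germ.coe_eq

theorem mk_eq_zero {f : I → ℂ} : mk U f = 0 ↔ ∀ᶠ i in U, f i = 0 := by
  rw [← map_zero (mk U), mk_eq]; rfl

theorem mk_surjective : Function.Surjective (mk U) := fun a =>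
  Filter.Germ.inductionOn a fun f => ⟨f, rfl⟩

/-- A function representing an element of the ultrapower. -/
def rep (a : Ultrapower U) : I → ℂ := (mk_surjective a).choose

@[simp] theorem mk_rep (a : Ultrapower U) : mk U (rep a) = a := (mk_surjective a).choose_spec

theorem rep_mk (f : I → ℂ) : ∀ᶠ i in U, rep (mk U f) i = f i := mk_eq.1 (mk_rep _)

instance : Algebra ℂ (Ultrapower U) := ((mk U).comp (algebraMap ℂ (I → ℂ))).toAlgebra

theorem algebraMap_eq (c : ℂ) : algebraMap ℂ (Ultrapower U) c = mk U fun _ => c := rfl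

instance : CharZero (Ultrapower U) :=
  charZero_of_injective_algebraMap (algebraMap ℂ (Ultrapower U)).injective

theorem rep_add (a b : Ultrapower U) : ∀ᶠ i in U, rep (a + b) i = rep a i + rep b i :=
  mk_eq.1 (by rw [mk_rep]; conv_lhs => rw [← mk_rep a, ← mk_rep b, ← map_add]
              rfl)

theorem rep_mul (a b : Ultrapower U) : ∀ᶠ i in U, rep (a * b) i = rep a i * rep b i :=
  mk_eq.1 (by rw [mk_rep]; conv_lhs => rw [← mk_rep a, ← mk_rep b, ← map_mul]
              rfl)

theorem mk_sum_mul {J : Type} [Fintype J] (a : J → Ultrapower U) (b : J → I → ℂ) :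
    ∑ j, a j * mk U (b j) = mk U fun i => ∑ j, rep (a j) i * b j i := by
  have : (fun i => ∑ j, rep (a j) i * b j i) = ∑ j, rep (a j) * b j := by
    ext i; simp
  rw [this, map_sum]
  exact Finset.sum_congr rfl fun j _ => by rw [map_mul, mk_rep]

variable {J : Type}

/-- Representatives of the coordinates of a vector over the ultrapower. -/
def vrep (h : J → Ultrapower U) (i : I) : J → ℂ := fun j => rep (h j) i

/-- The vector over the ultrapower represented by a family of complex vectors. -/
def vmk (U : Ultrafilter I) (f : I → J → ℂ) : J → Ultrapower U := fun j => mk U fun i => f i j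

theorem vmk_vrep (h : J → Ultrapower U) : vmk U (vrep h) = h := by
  ext j; exact mk_rep _

theorem vrep_vmk [Finite J] (f : I → J → ℂ) : ∀ᶠ i in U, vrep (vmk U f) i = f i := by
  have : ∀ᶠ i in U, ∀ j, rep (vmk U f j) i = f i j :=
    Filter.eventually_all.2 fun j => rep_mk _
  exact this.mono fun i hi => funext hi

theorem vrep_add [Finite J] (h h' : J → Ultrapower U) :
    ∀ᶠ i in U, vrep (h + h') i = vrep h i + vrep h' i :=
  (Filter.eventually_all.2 fun j => rep_add (h j) (h' j)).mono fun _ hi => funext hi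

theorem vrep_smul [Finite J] (a : Ultrapower U) (h : J → Ultrapower U) :
    ∀ᶠ i in U, vrep (a • h) i = rep a i • vrep h i :=
  (Filter.eventually_all.2 fun j => rep_mul a (h j)).mono fun _ hi => funext hi

theorem vrep_zero [Finite J] : ∀ᶠ i in U, vrep (0 : J → Ultrapower U) i = 0 :=
  (Filter.eventually_all.2 fun _ : J => mk_eq_zero.1 (mk_rep (0 : Ultrapower U))).mono
    fun _ hi => funext hi

theorem eq_zero_of_vrep {h : J → Ultrapower U} (hh : ∀ᶠ i in U, vrep h i = 0) : h = 0 := by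
  ext j
  rw [← mk_rep (h j)]
  exact mk_eq_zero.2 (hh.mono fun i hi => congrFun hi j)

/-- The ultraproduct of a family of subspaces. -/
def sub [Finite J] (U : Ultrafilter I) (W : I → Submodule ℂ (J → ℂ)) :
    Submodule (Ultrapower U) (J → Ultrapower U) where
  carrier := {h | ∀ᶠ i in U, vrep h i ∈ W i}
  zero_mem' := vrep_zero.mono fun i hi => by rw [hi]; exact zero_mem _
  add_mem' := fun {a b} ha hb => by
    filter_upwards [ha, hb, vrep_add a b] with i h1 h2 h3
    rw [h3]; exact add_mem h1 h2
  smul_mem' := fun c a ha => by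
    filter_upwards [ha, vrep_smul c a] with i h1 h2
    rw [h2]; exact Submodule.smul_mem _ _ h1

theorem mem_sub [Finite J] {W : I → Submodule ℂ (J → ℂ)} {h : J → Ultrapower U} :
    h ∈ sub U W ↔ ∀ᶠ i in U, vrep h i ∈ W i := Iff.rfl

theorem vmk_mem_sub [Finite J] {W : I → Submodule ℂ (J → ℂ)} {f : I → J → ℂ}
    (h : ∀ᶠ i in U, f i ∈ W i) : vmk U f ∈ sub U W := by
  filter_upwards [h, vrep_vmk f] with i h1 h2
  rwa [h2]

theorem vrep_sum_smul [Finite J] {d : Type} [Fintype d] (a : d → Ultrapower U)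
    (f : d → I → J → ℂ) :
    ∀ᶠ i in U, vrep (∑ k, a k • vmk U (f k)) i = ∑ k, rep (a k) i • f k i := by
  have : ∑ k, a k • vmk U (f k) = vmk U fun i => ∑ k, rep (a k) i • f k i := by
    ext j
    simp only [Finset.sum_apply, Pi.smul_apply, smul_eq_mul, vmk]
    exact mk_sum_mul a fun k i => f k i j
  rw [this]
  exact vrep_vmk _

theorem finrank_sub [Finite J] {W : I → Submodule ℂ (J → ℂ)} {d : ℕ}
    (hd : ∀ᶠ i in U, Module.finrank ℂ (W i) = d) :
    Module.finrank (Ultrapower U) (sub U W) = d := by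
  classical
  have : ∀ i, ∃ b : Fin d → J → ℂ, Module.finrank ℂ (W i) = d →
      LinearIndependent ℂ b ∧ Submodule.span ℂ (Set.range b) = W i := fun i => by
    by_cases h : Module.finrank ℂ (W i) = d
    · let b := Module.finBasisOfFinrankEq ℂ (W i) h
      refine ⟨fun k => b k, fun _ => ⟨?_, ?_⟩⟩
      · exact b.linearIndependent.map' (W i).subtype (Submodule.ker_subtype _)
      · have := congrArg (Submodule.map (W i).subtype) b.span_eq
        rwa [Submodule.map_span, Submodule.map_top, Submodule.range_subtype,
          ← Set.range_comp] at this
    · exact ⟨0, fun h' => absurd h' h⟩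
  choose b hb using this
  let B : Fin d → J → Ultrapower U := fun k => vmk U fun i => b i k
  have hli : LinearIndependent (Ultrapower U) B := by
    refine Fintype.linearIndependent_iff.2 fun a ha k => ?_
    rw [← mk_rep (a k)]
    refine mk_eq_zero.2 ?_
    have h1 := vrep_sum_smul a fun k i => b i k
    change ∀ᶠ i in U, vrep (∑ k, a k • B k) i = _ at h1
    rw [ha] at h1
    filter_upwards [h1, vrep_zero (J := J) (U := U), hd] with i h1 h2 h3
    rw [h2] at h1
    exact Fintype.linearIndependent_iff.1 (hb i h3).1 _ h1.symm k
  have hspan : Submodule.span (Ultrapower U) (Set.range B) = sub U W := by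
    refine le_antisymm (Submodule.span_le.2 ?_) fun h hh => ?_
    · rintro _ ⟨k, rfl⟩
      refine vmk_mem_sub (hd.mono fun i hi => ?_)
      rw [← (hb i hi).2]
      exact Submodule.subset_span ⟨k, rfl⟩
    · have h1 : ∀ i, ∃ c : Fin d → ℂ, vrep h i ∈ W i → Module.finrank ℂ (W i) = d →
          ∑ k, c k • b i k = vrep h i := fun i => by
        by_cases h1 : vrep h i ∈ W i ∧ Module.finrank ℂ (W i) = d
        · have h2 := h1.1
          rw [← (hb i h1.2).2] at h2
          obtain ⟨c, hc⟩ := (Submodule.mem_span_range_iff_exists_fun ℂ).1 h2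
          exact ⟨c, fun _ _ => hc⟩
        · exact ⟨0, fun h2 h3 => absurd ⟨h2, h3⟩ h1⟩
      choose c hc using h1
      refine (Submodule.mem_span_range_iff_exists_fun _).2 ⟨fun k => mk U fun i => c i k, ?_⟩
      rw [← sub_eq_zero]
      have h2 : ∑ k, (mk U fun i => c i k) • B k = vmk U (vrep h) := by
        ext j
        simp only [Finset.sum_apply, Pi.smul_apply, smul_eq_mul, B, vmk]
        rw [mk_sum_mul, mk_eq]
        have h3 : ∀ᶠ i in U, ∀ k, rep (mk U fun i => c i k) i = c i k :=
          Filter.eventually_all.2 fun k => rep_mk _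
        filter_upwards [hh, hd, h3] with i h4 h5 h6
        have := congrFun (hc i h4 h5) j
        simp only [Finset.sum_apply, Pi.smul_apply, smul_eq_mul] at this
        rw [← this]
        exact Finset.sum_congr rfl fun k _ => by rw [h6]
      rw [h2, vmk_vrep, sub_self]
  rw [← hspan, finrank_span_eq_card hli, Fintype.card_fin]

/-- A function with finitely many values is almost everywhere constant. -/
theorem _root_.Ultrafilter.eventually_eq_const {β : Type} (s : Set β) (hs : s.Finite) {f : I → β}
    (h : ∀ᶠ i in U, f i ∈ s) : ∃ b ∈ s, ∀ᶠ i in U, f i = b := by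
  have : s ∈ U.map f := h
  obtain ⟨b, hb, h'⟩ := Ultrafilter.eq_pure_of_finite_mem hs this
  refine ⟨b, hb, ?_⟩
  have h2 : ({b} : Set β) ∈ U.map f := by rw [h']; exact Set.mem_singleton b
  exact h2

/-- The componentwise action of a derivation preserves the ultrapower of a fixed subspace. -/
theorem map_derivation_mem_sub [Fintype J] (δ : Derivation ℂ (Ultrapower U) (Ultrapower U))
    (W : Submodule ℂ (J → ℂ)) {h : J → Ultrapower U} (hh : h ∈ sub U fun _ => W) :
    (fun j => δ (h j)) ∈ sub U fun _ => W := by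
  classical
  let b := Module.finBasis ℂ ((J → ℂ) ⧸ W)
  let a : Fin _ → J → ℂ := fun k j => b.repr (W.mkQ (Pi.single j 1)) k
  have key : ∀ c : J → ℂ, c ∈ W ↔ ∀ k, ∑ j, c j * a k j = 0 := fun c => by
    have h1 : ∀ k, ∑ j, c j * a k j = b.repr (W.mkQ c) k := fun k => by
      conv_rhs => rw [← Finset.univ_sum_single c]
      rw [map_sum, map_sum, Finsupp.finsetSum_apply]
      refine Finset.sum_congr rfl fun j _ => ?_
      rw [show Pi.single j (c j) = c j • (Pi.single j 1 : J → ℂ) by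
        rw [← Pi.single_smul, smul_eq_mul, mul_one], map_smul, map_smul, Finsupp.smul_apply,
        smul_eq_mul]
    simp only [h1]
    rw [← Submodule.Quotient.mk_eq_zero, ← Submodule.mkQ_apply, ← b.repr.map_eq_zero_iff,
      Finsupp.ext_iff]
    rfl
  have key' : ∀ h : J → Ultrapower U, h ∈ sub U (fun _ => W) ↔
      ∀ k, ∑ j, h j * mk U (fun _ => a k j) = 0 := fun h => by
    rw [mem_sub]
    simp only [key, mk_sum_mul, mk_eq_zero, Filter.eventually_all]
    rfl
  rw [key'] at hh ⊢
  intro k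
  have := congrArg δ (hh k)
  rw [map_sum, map_zero] at this
  rw [← this]
  refine Finset.sum_congr rfl fun j _ => ?_
  rw [δ.leibniz, ← algebraMap_eq, δ.map_algebraMap, smul_zero, zero_add, smul_eq_mul, mul_comm]

end Ultrapower

namespace Curve
variable {C : Curve} {I : Type} {U : Ultrafilter I}
open Ultrapower

/-- A basis of the space of sections of the canonical divisor. -/
def ω (C : Curve) : Module.Basis (Fin C.genus) ℂ (C.H0 C.K) :=
  Module.finBasisOfFinrankEq ℂ (C.H0 C.K) h0_K

/-- The section of `K` with given coordinates. -/
def sec (C : Curve) : (Fin C.genus → ℂ) →ₗ[ℂ] C.F :=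
  (C.H0 C.K).subtype ∘ₗ C.ω.equivFun.symm.toLinearMap

theorem sec_apply (c : Fin C.genus → ℂ) : C.sec c = ∑ j, c j • (C.ω j : C.F) := by
  rw [sec, LinearMap.comp_apply, LinearEquiv.coe_coe, Module.Basis.equivFun_symm_apply]
  simp

theorem sec_injective : Function.Injective C.sec :=
  Subtype.val_injective.comp C.ω.equivFun.symm.injective

theorem sec_mem (c : Fin C.genus → ℂ) : C.sec c ∈ C.H0 C.K := (C.ω.equivFun.symm c).2

theorem exists_sec {f : C.F} (hf : f ∈ C.H0 C.K) : ∃ c, C.sec c = f :=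
  ⟨C.ω.equivFun ⟨f, hf⟩, by simp [sec]⟩

/-- The coordinates of the sections of `K` vanishing on `Z`. -/
def van (C : Curve) (Z : C.Div) : Submodule ℂ (Fin C.genus → ℂ) := (C.H0 (C.K - Z)).comap C.sec

theorem finrank_van {Z : C.Div} (hZ : 0 ≤ Z) : Module.finrank ℂ (C.van Z) = C.h0 (C.K - Z) := by
  have h : Function.Surjective (C.sec.submoduleComap (C.H0 (C.K - Z))) := fun f => by
    obtain ⟨c, hc⟩ := exists_sec (C.H0_mono (fun P => sub_le_self C.K hZ P) f.2)
    exact ⟨⟨c, by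
      change C.sec c ∈ C.H0 (C.K - Z); rw [hc]; exact f.2⟩, Subtype.ext hc⟩
  exact (LinearEquiv.ofBijective (C.sec.submoduleComap (C.H0 (C.K - Z)))
    ⟨fun a b hab => by
      have h1 : C.sec a.1 = C.sec b.1 := congrArg (fun t : C.H0 (C.K - Z) => (t : C.F)) hab
      exact Subtype.ext (sec_injective h1), h⟩).finrank_eq

/-- The sections over the ultrapower vanishing on a family of divisors. -/
def starVan (U : Ultrafilter I) (Z : I → C.Div) :
    Submodule (Ultrapower U) (Fin C.genus → Ultrapower U) := sub U fun i => C.van (Z i)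

/-- A family of points avoids every fixed point. -/
def IsMoving (U : Ultrafilter I) (z : I → C.Point) : Prop := ∀ P, ∀ᶠ i in U, z i ≠ P

theorem IsMoving.notMem {z : I → C.Point} (hz : IsMoving U z) {S : Set C.Point} (hS : S.Finite) :
    ∀ᶠ i in U, z i ∉ S := by
  by_contra h
  rw [Ultrafilter.eventually_not, not_not] at h
  obtain ⟨P, _, hP⟩ := Ultrafilter.eventually_eq_const S hS h
  obtain ⟨i, h1, h2⟩ := (hP.and (hz P)).exists
  exact h2 h1

theorem exists_eq_of_not_isMoving {z : I → C.Point} (hz : ¬ IsMoving U z) :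
    ∃ P, ∀ᶠ i in U, z i = P := by
  rw [IsMoving, not_forall] at hz
  obtain ⟨P, hP⟩ := hz
  refine ⟨P, ?_⟩
  rwa [Ultrafilter.eventually_not, not_not] at hP

theorem IsMoving.regular {z : I → C.Point} (hz : IsMoving U z) (f : C.F) :
    ∀ᶠ i in U, f ∈ C.V (z i) 0 :=
  (hz.notMem (finite_notMem_V f)).mono fun _ hi => not_not.1 hi

theorem IsMoving.good {z : I → C.Point} (hz : IsMoving U z) : ∀ᶠ i in U, C.Good (z i) :=
  (hz.notMem finite_not_good).mono fun _ hi => not_not.1 hi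

theorem IsMoving.apply_eq_zero {z : I → C.Point} (hz : IsMoving U z) (D : C.Div) :
    ∀ᶠ i in U, D (z i) = 0 :=
  (hz.notMem D.support.finite_toSet).mono fun i hi => by simpa using hi

/-- The value of a function at a family of points. -/
def starVal (U : Ultrafilter I) (z : I → C.Point) (f : C.F) : Ultrapower U :=
  Ultrapower.mk U fun i => C.val (z i) f

/-- Evaluation at a moving family of points. -/
def IsMoving.eval {z : I → C.Point} (hz : IsMoving U z) : C.F →ₐ[ℂ] Ultrapower U where
  toFun := starVal U z
  map_one' := by simp [starVal]; exact map_one (Ultrapower.mk U)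
  map_zero' := by simp [starVal]; exact map_zero (Ultrapower.mk U)
  map_mul' f g := by
    rw [starVal, starVal, starVal, ← map_mul, mk_eq]
    filter_upwards [hz.regular f, hz.regular g] with i hf hg using val_mul hf hg
  map_add' f g := by
    rw [starVal, starVal, starVal, ← map_add, mk_eq]
    filter_upwards [hz.regular f, hz.regular g] with i hf hg using val_add hf hg
  commutes' c := by simp [starVal, algebraMap_eq]

theorem IsMoving.derivation_starVal {z : I → C.Point} (hz : IsMoving U z)
    (δ : Derivation ℂ (Ultrapower U) (Ultrapower U)) (f : C.F) :
    δ (starVal U z f) = δ (starVal U z C.x) * starVal U z (C.ddx f) := by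
  let : Algebra C.F (Ultrapower U) := hz.eval.toAlgebra
  have : IsScalarTower ℂ C.F (Ultrapower U) := IsScalarTower.of_algHom hz.eval
  have hsmul : ∀ (f : C.F) (a : Ultrapower U), f • a = starVal U z f * a := fun f a => rfl
  have hmul : ∀ f g : C.F, starVal U z (f * g) = starVal U z f * starVal U z g :=
    fun f g => map_mul hz.eval f g
  have hadd : ∀ f g : C.F, starVal U z (f + g) = starVal U z f + starVal U z g :=
    fun f g => map_add hz.eval f g
  have hc : ∀ c : ℂ, starVal U z (algebraMap ℂ C.F c) = algebraMap ℂ _ c :=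
    fun c => hz.eval.commutes c
  have h1 : starVal U z 1 = 1 := map_one hz.eval
  have h0 : starVal U z 0 = 0 := map_zero hz.eval
  let d : Derivation ℂ C.F (Ultrapower U) :=
    { toFun := fun f => δ (starVal U z f) - δ (starVal U z C.x) * starVal U z (C.ddx f)
      map_add' := fun f g => by simp only [hadd, map_add]; ring
      map_smul' := fun c f => by
        have h2 : starVal U z (c • f) = c • starVal U z f := map_smul hz.eval c f
        have h3 : starVal U z (c • C.ddx f) = c • starVal U z (C.ddx f) := map_smul hz.eval c _
        rw [h2, Derivation.map_smul, Derivation.map_smul, h3, RingHom.id_apply, smul_sub,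
          mul_smul_comm]
      map_one_eq_zero' := by
        change δ (starVal U z 1) - δ (starVal U z C.x) * starVal U z (C.ddx 1) = 0
        rw [h1, δ.map_one_eq_zero, C.ddx.map_one_eq_zero, h0, mul_zero, sub_zero]
      leibniz' := fun f g => by
        change δ (starVal U z (f * g)) - δ (starVal U z C.x) * starVal U z (C.ddx (f * g)) =
          f • (δ (starVal U z g) - δ (starVal U z C.x) * starVal U z (C.ddx g)) +
          g • (δ (starVal U z f) - δ (starVal U z C.x) * starVal U z (C.ddx f))
        simp only [hsmul, hmul, hadd, C.ddx.leibniz, δ.leibniz, smul_eq_mul]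
        ring }
  have hd : ∀ f, d f = δ (starVal U z f) - δ (starVal U z C.x) * starVal U z (C.ddx f) :=
    fun f => rfl
  have := Derivation.eq_zero_of_isAlgebraic_adjoin d (x := C.x)
    (by rw [hd, ddx_x, h1, mul_one, sub_self]) f
  rwa [hd, sub_eq_zero] at this

theorem derivation_starVal_of_eq {z : I → C.Point} {P : C.Point} (hz : ∀ᶠ i in U, z i = P)
    (δ : Derivation ℂ (Ultrapower U) (Ultrapower U)) (f : C.F) : δ (starVal U z f) = 0 := by
  have : starVal U z f = algebraMap ℂ _ (C.val P f) :=
    mk_eq.2 (hz.mono fun i hi => by rw [hi]; rfl)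
  rw [this, δ.map_algebraMap]

theorem isMoving_of_ne {z : I → C.Point} {δ : Derivation ℂ (Ultrapower U) (Ultrapower U)}
    {f : C.F} (h : δ (starVal U z f) ≠ 0) : IsMoving U z := by
  by_contra hz
  obtain ⟨P, hP⟩ := exists_eq_of_not_isMoving hz
  exact h (derivation_starVal_of_eq hP δ f)

/-- The section `h` vanishes at `z` to order `m`. -/
def VanAt (h : Fin C.genus → Ultrapower U) (z : I → C.Point) (m : ℕ) : Prop :=
  ∀ᶠ i in U, C.sec (vrep h i) ∈ C.V (z i) (m - C.K (z i))

/-- The `k`-th Taylor coefficient of the section `h` at `z`. -/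
def taylor (h : Fin C.genus → Ultrapower U) (z : I → C.Point) (k : ℕ) : Ultrapower U :=
  ∑ j, h j * starVal U z (C.ddx^[k] (C.ω j))

theorem Good.iterate_mem {P : C.Point} (hP : C.Good P) {f : C.F} (hf : f ∈ C.V P 0) (k : ℕ) :
    C.ddx^[k] f ∈ C.V P 0 := by
  induction k generalizing f with
  | zero => exact hf
  | succ k ih => exact ih (hP.2 f hf)

theorem IsMoving.vanAt_iff {z : I → C.Point} (hz : IsMoving U z) {h : Fin C.genus → Ultrapower U}
    {m : ℕ} : VanAt h z m ↔ ∀ k < m, taylor h z k = 0 := by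
  have key : ∀ᶠ i in U, (C.sec (vrep h i) ∈ C.V (z i) (m - C.K (z i)) ↔
      ∀ k < m, ∑ j, vrep h i j * C.val (z i) (C.ddx^[k] (C.ω j)) = 0) := by
    filter_upwards [hz.good, hz.apply_eq_zero C.K] with i hi hK
    have hω : ∀ j, (C.ω j : C.F) ∈ C.V (z i) 0 := fun j => mem_V_of_not_polar (C.ω j).2 hK
    have hs : C.sec (vrep h i) ∈ C.V (z i) 0 := mem_V_of_not_polar (sec_mem _) hK
    rw [hK, sub_zero, hi.mem_V_iff_forall m hs]
    refine forall₂_congr fun k _ => ?_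
    have : C.ddx^[k] (C.sec (vrep h i)) = ∑ j, vrep h i j • C.ddx^[k] (C.ω j : C.F) := by
      have hit : ∀ f, C.ddx^[k] f = (C.ddx.toLinearMap ^ k) f := fun f => by
        rw [Module.End.pow_apply]; rfl
      simp only [hit, sec_apply, map_sum, map_smul]
    rw [this, val_sum _ fun j => Submodule.smul_mem _ _ (hi.iterate_mem (hω j) k)]
    simp only [val_smul (hi.iterate_mem (hω _) k)]
  have key2 : VanAt h z m ↔ ∀ᶠ i in U,
      ∀ k < m, ∑ j, vrep h i j * C.val (z i) (C.ddx^[k] (C.ω j)) = 0 :=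
    Filter.eventually_congr key
  rw [key2]
  have h3 : (∀ᶠ i in U, ∀ k ∈ Finset.range m,
      ∑ j, vrep h i j * C.val (z i) (C.ddx^[k] (C.ω j)) = 0) ↔ _ :=
    Filter.eventually_all_finset (Finset.range m)
  simp only [Finset.mem_range] at h3
  rw [h3]
  refine forall₂_congr fun k _ => ?_
  rw [taylor]
  simp only [starVal]
  rw [mk_sum_mul, mk_eq_zero]
  rfl

theorem IsMoving.derivation_taylor {z : I → C.Point} (hz : IsMoving U z)
    (δ : Derivation ℂ (Ultrapower U) (Ultrapower U)) (h : Fin C.genus → Ultrapower U) (k : ℕ) :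
    δ (taylor h z k) =
      taylor (fun j => δ (h j)) z k + δ (starVal U z C.x) * taylor h z (k + 1) := by
  rw [taylor, taylor, taylor, map_sum, Finset.mul_sum, ← Finset.sum_add_distrib]
  refine Finset.sum_congr rfl fun j _ => ?_
  rw [δ.leibniz, smul_eq_mul, smul_eq_mul, hz.derivation_starVal, Function.iterate_succ_apply']
  ring

theorem VanAt.derivation {z : I → C.Point} {h : Fin C.genus → Ultrapower U} {m : ℕ}
    (δ : Derivation ℂ (Ultrapower U) (Ultrapower U)) (hh : VanAt h z (m + 1)) :
    VanAt (fun j => δ (h j)) z m := by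
  by_cases hz : IsMoving U z
  · rw [hz.vanAt_iff] at hh ⊢
    intro k hk
    have := hz.derivation_taylor δ h k
    rw [hh k (by omega), hh (k + 1) (by omega), map_zero, mul_zero, add_zero] at this
    exact this.symm
  · obtain ⟨P, hP⟩ := exists_eq_of_not_isMoving hz
    have h1 : h ∈ sub U fun _ => (C.V P (m - C.K P)).comap C.sec := by
      filter_upwards [hh, hP] with i h1 h2
      rw [h2] at h1
      exact V_anti P (by push_cast; omega) h1
    filter_upwards [map_derivation_mem_sub δ _ h1, hP] with i h2 h3
    rw [h3]; exact h2

theorem VanAt.derivation_of_eq_zero {z : I → C.Point} {h : Fin C.genus → Ultrapower U} {m : ℕ}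
    {δ : Derivation ℂ (Ultrapower U) (Ultrapower U)} (hδ : δ (starVal U z C.x) = 0)
    (hh : VanAt h z m) : VanAt (fun j => δ (h j)) z m := by
  by_cases hz : IsMoving U z
  · rw [hz.vanAt_iff] at hh ⊢
    intro k hk
    have := hz.derivation_taylor δ h k
    rw [hh k hk, hδ, map_zero, zero_mul, add_zero] at this
    exact this.symm
  · obtain ⟨P, hP⟩ := exists_eq_of_not_isMoving hz
    have h1 : h ∈ sub U fun _ => (C.V P (m - C.K P)).comap C.sec := by
      filter_upwards [hh, hP] with i h1 h2
      rwa [h2] at h1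
    filter_upwards [map_derivation_mem_sub δ _ h1, hP] with i h2 h3
    rw [h3]; exact h2

/-- A section vanishing at a point which is moved by a derivation preserving its line is zero. -/
theorem eq_zero_of_derivation_eq_smul {z : I → C.Point} {h : Fin C.genus → Ultrapower U}
    {δ : Derivation ℂ (Ultrapower U) (Ultrapower U)} (hδ : δ (starVal U z C.x) ≠ 0)
    {β : Ultrapower U} (hβ : ∀ j, δ (h j) = β * h j) (hh : VanAt h z 1) : h = 0 := by
  have hz := isMoving_of_ne hδ
  have hk : ∀ k, taylor h z k = 0 := fun k => by
    induction k with
    | zero => exact hz.vanAt_iff.1 hh 0 one_pos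
    | succ k ih =>
      have := hz.derivation_taylor δ h k
      have h2 : taylor (fun j => δ (h j)) z k = β * taylor h z k := by
        rw [taylor, taylor, Finset.mul_sum]
        exact Finset.sum_congr rfl fun j _ => by rw [hβ, mul_assoc]
      rw [h2, ih, map_zero, mul_zero, zero_add, eq_comm, mul_eq_zero] at this
      exact this.resolve_left hδ
  have h2 : VanAt h z (2 * C.genus) := hz.vanAt_iff.2 fun k _ => hk k
  refine eq_zero_of_vrep (h2.mono fun i hi => ?_)
  have h3 : C.sec (vrep h i) ∈ C.H0 (C.K - (2 * C.genus) • C.pt (z i)) := by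
    rw [mem_H0_iff]
    intro P
    by_cases hP : P = z i
    · subst hP
      convert hi using 1
      simp
    · have := mem_H0_iff.1 (sec_mem (vrep h i)) P
      convert this using 1
      simp [pt_ne (Ne.symm hP)]
  have h4 : C.h0 (C.K - (2 * C.genus) • C.pt (z i)) = 0 :=
    h0_eq_zero_of_deg_neg (by simp [deg_K])
  have h5 : C.sec (vrep h i) = 0 := by
    by_contra h6
    exact (h0_pos_iff.2 ⟨_, h3, h6⟩).ne' h4
  exact sec_injective (h5.trans (map_zero _).symm)

end Curve

section LinearAlgebra
variable {K J : Type} [Field K]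

/-- The vectors whose coordinates vanish on `T`. -/
def Submodule.coordZero (K : Type) [Field K] {J : Type} (T : Finset J) : Submodule K (J → K) where
  carrier := {h | ∀ j ∈ T, h j = 0}
  zero_mem' := fun _ _ => rfl
  add_mem' := fun {a b} ha hb j hj => by rw [Pi.add_apply, ha j hj, hb j hj, add_zero]
  smul_mem' := fun c a ha j hj => by rw [Pi.smul_apply, ha j hj, smul_zero]

theorem Submodule.exists_coordZero_finrank [Finite J] (V : Submodule K (J → K)) {N : ℕ}
    (hN : N ≤ Module.finrank K V) : ∃ T : Finset J, T.card = N ∧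
      Module.finrank K (V ⊓ coordZero K T : Submodule K (J → K)) + N ≤ Module.finrank K V := by
  classical
  induction N with
  | zero => exact ⟨∅, rfl, by simpa using Submodule.finrank_mono inf_le_left⟩
  | succ N ih =>
    obtain ⟨T, hT, h⟩ := ih (by omega)
    by_cases h0 : Module.finrank K (V ⊓ coordZero K T : Submodule K (J → K)) = 0
    · have hJ : N + 1 ≤ Nat.card J := by
        have hle := Submodule.finrank_le V
        let := Fintype.ofFinite J
        rw [Module.finrank_fintype_fun_eq_card, ← Nat.card_eq_fintype_card] at hle
        omega
      obtain ⟨j, hj⟩ : ∃ j, j ∉ T := by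
        by_contra hcon
        push Not at hcon
        let := Fintype.ofFinite J
        rw [Finset.eq_univ_iff_forall.2 hcon, Finset.card_univ, ← Nat.card_eq_fintype_card] at hT
        omega
      refine ⟨insert j T, by rw [Finset.card_insert_of_notMem hj, hT], ?_⟩
      have hle : (V ⊓ coordZero K (insert j T) : Submodule K (J → K)) ≤ V ⊓ coordZero K T :=
        inf_le_inf_left _ fun h hh k hk => hh k (Finset.mem_insert_of_mem hk)
      have := Submodule.finrank_mono hle
      omega
    · have hne : (V ⊓ coordZero K T : Submodule K (J → K)) ≠ ⊥ := fun hbot =>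
        h0 (by rw [hbot, finrank_bot])
      obtain ⟨v, hv, hv0⟩ := Submodule.exists_mem_ne_zero_of_ne_bot hne
      obtain ⟨j, hj⟩ := Function.ne_iff.1 hv0
      have hjT : j ∉ T := fun hjT => hj (hv.2 j hjT)
      refine ⟨insert j T, by rw [Finset.card_insert_of_notMem hjT, hT], ?_⟩
      have hlt : (V ⊓ coordZero K (insert j T) : Submodule K (J → K)) < V ⊓ coordZero K T := by
        refine lt_of_le_of_ne
          (inf_le_inf_left _ fun h hh k hk => hh k (Finset.mem_insert_of_mem hk)) fun heq => ?_
        rw [← heq] at hv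
        exact hj (hv.2 j (Finset.mem_insert_self _ _))
      have := Submodule.finrank_lt_finrank_of_lt hlt
      omega

theorem Submodule.exists_mem_coordZero [Finite J] (V : Submodule K (J → K)) {T : Finset J}
    (hT : T.card < Module.finrank K V) : ∃ h ∈ V, h ∈ coordZero K T ∧ h ≠ 0 := by
  let f : V →ₗ[K] (T → K) := (LinearMap.funLeft K K (Subtype.val : T → J)) ∘ₗ V.subtype
  have hf : LinearMap.ker f ≠ ⊥ := LinearMap.ker_ne_bot_of_finrank_lt (by
    rwa [Module.finrank_fintype_fun_eq_card, Fintype.card_coe])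
  obtain ⟨v, hv, hv0⟩ := Submodule.exists_mem_ne_zero_of_ne_bot hf
  exact ⟨v, v.2, fun j hj => congrFun (LinearMap.mem_ker.1 hv) ⟨j, hj⟩,
    fun h => hv0 (Subtype.ext h)⟩

end LinearAlgebra

namespace Curve
variable {C : Curve} {I : Type} {U : Ultrafilter I}
open Ultrapower

theorem apply_le_deg {D : C.Div} (hD : 0 ≤ D) (P : C.Point) : D P ≤ C.deg D := by
  by_cases hP : P ∈ D.support
  · exact Finset.single_le_sum (f := fun Q => D Q) (fun Q _ => hD Q) hP
  · rw [Finsupp.notMem_support_iff.1 hP]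
    exact deg_nonneg hD

theorem finrank_starVan {Z : I → C.Div} {d : ℕ} (hZ : ∀ᶠ i in U, 0 ≤ Z i)
    (hd : ∀ᶠ i in U, C.h0 (C.K - Z i) = d) :
    Module.finrank (Ultrapower U) (starVan U Z) = d :=
  finrank_sub (by filter_upwards [hZ, hd] with i h1 h2; rw [finrank_van h1, h2])

theorem le_finrank_starVan {Z : I → C.Div} {d : ℕ} (hZ : ∀ᶠ i in U, 0 ≤ Z i)
    (hd : ∀ᶠ i in U, d ≤ C.h0 (C.K - Z i)) :
    d ≤ Module.finrank (Ultrapower U) (starVan U Z) := by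
  obtain ⟨e, he, he'⟩ := Ultrafilter.eventually_eq_const (U := U) (Set.Icc d C.genus)
    (Set.finite_Icc _ _) (f := fun i => C.h0 (C.K - Z i)) (by
      filter_upwards [hZ, hd] with i h1 h2
      exact ⟨h2, (h0_mono (sub_le_self _ h1)).trans_eq h0_K⟩)
  rw [finrank_starVan hZ he']
  exact he.1

theorem vanAt_of_mem_starVan {Z : I → C.Div} {h : Fin C.genus → Ultrapower U}
    (hh : h ∈ starVan U Z) {z : I → C.Point} {m : ℕ} (hm : ∀ᶠ i in U, (m : ℤ) ≤ Z i (z i)) :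
    VanAt h z m := by
  filter_upwards [hh, hm] with i h1 h2
  refine V_anti _ ?_ (mem_H0_iff.1 (Submodule.mem_comap.1 h1) (z i))
  rw [Finsupp.sub_apply]; omega

/-- Differentiating a section loses one order of vanishing, only at the points which move. -/
theorem derivation_mem_starVan {Z Z' : I → C.Div} {T : Set (I → C.Point)} (hT : T.Finite)
    {δ : Derivation ℂ (Ultrapower U) (Ultrapower U)}
    (hsupp : ∀ᶠ i in U, ∀ P, Z' i P ≠ 0 → ∃ z ∈ T, z i = P) (hpos : ∀ᶠ i in U, 0 ≤ Z' i)
    {M : ℤ} (hdeg : ∀ᶠ i in U, C.deg (Z' i) ≤ M) (hle : ∀ᶠ i in U, Z' i ≤ Z i)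
    (hδ : ∀ z ∈ T, δ (starVal U z C.x) ≠ 0 → ∀ᶠ i in U, Z' i (z i) + 1 ≤ Z i (z i))
    {h : Fin C.genus → Ultrapower U} (hh : h ∈ starVan U Z) :
    (fun j => δ (h j)) ∈ starVan U Z' := by
  have key : ∀ z ∈ T, ∀ᶠ i in U,
      C.sec (vrep (fun j => δ (h j)) i) ∈ C.V (z i) (Z' i (z i) - C.K (z i)) := fun z hz => by
    obtain ⟨m, hm, hm'⟩ := Ultrafilter.eventually_eq_const (U := U) (Set.Icc 0 M)
      (Set.finite_Icc _ _) (f := fun i => Z' i (z i)) (by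
        filter_upwards [hpos, hdeg] with i h1 h2
        exact ⟨h1 _, (apply_le_deg h1 _).trans h2⟩)
    obtain ⟨m, rfl⟩ := Int.eq_ofNat_of_zero_le hm.1
    have hv : VanAt (fun j => δ (h j)) z m := by
      by_cases h0 : δ (starVal U z C.x) = 0
      · refine VanAt.derivation_of_eq_zero h0 (vanAt_of_mem_starVan hh ?_)
        filter_upwards [hm', hle] with i h1 h2
        exact h1 ▸ h2 _
      · refine VanAt.derivation δ (vanAt_of_mem_starVan hh ?_)
        filter_upwards [hm', hδ z hz h0] with i h1 h2
        push_cast; omega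
    filter_upwards [hv, hm'] with i h1 h2
    rwa [h2]
  filter_upwards [(Filter.eventually_all_finite hT).2 key, hsupp] with i h1 h2
  refine Submodule.mem_comap.2 (mem_H0_iff.2 fun P => ?_)
  by_cases hP : Z' i P = 0
  · have := mem_H0_iff.1 (sec_mem (vrep (fun j => δ (h j)) i)) P
    rwa [Finsupp.sub_apply, hP, sub_zero]
  · obtain ⟨z, hz, rfl⟩ := h2 P hP
    convert h1 z hz using 1
    rw [Finsupp.sub_apply, neg_sub]

/-- The sum of a finite family of points. -/
def ptSum {ι : Type} (p : ι → I → C.Point) (B : Finset ι) (i : I) : C.Div := ∑ j ∈ B, C.pt (p j i)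

theorem ptSum_nonneg {ι : Type} (p : ι → I → C.Point) (B : Finset ι) (i : I) :
    0 ≤ ptSum p B i := Finset.sum_nonneg fun _ _ => pt_nonneg _

@[simp] theorem deg_ptSum {ι : Type} (p : ι → I → C.Point) (B : Finset ι) (i : I) :
    C.deg (ptSum p B i) = B.card := by
  simp [ptSum, deg_sum]

theorem ptSum_erase {ι : Type} [DecidableEq ι] (p : ι → I → C.Point) {B : Finset ι} {k : ι}
    (hk : k ∈ B) (i : I) : ptSum p B i = ptSum p (B.erase k) i + C.pt (p k i) :=
  (Finset.sum_erase_add _ _ hk).symm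

theorem pt_le_ptSum {ι : Type} (p : ι → I → C.Point) {B : Finset ι} {k : ι} (hk : k ∈ B) (i : I) :
    C.pt (p k i) ≤ ptSum p B i :=
  Finset.single_le_sum (f := fun j => C.pt (p j i)) (fun _ _ => pt_nonneg _) hk

theorem one_le_ptSum {ι : Type} (p : ι → I → C.Point) {B : Finset ι} {k : ι} (hk : k ∈ B) (i : I) :
    1 ≤ ptSum p B i (p k i) :=
  (pt_le_iff (ptSum_nonneg p B i)).1 (pt_le_ptSum p hk i)

theorem exists_of_ptSum_ne_zero {ι : Type} {p : ι → I → C.Point} {B : Finset ι} {i : I}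
    {P : C.Point} (h : ptSum p B i P ≠ 0) : ∃ j ∈ B, p j i = P := by
  by_contra hcon
  push Not at hcon
  refine h ?_
  rw [ptSum, Finsupp.finsetSum_apply]
  exact Finset.sum_eq_zero fun j hj => pt_ne (hcon j hj)

/-- The derivations `δ k` are dual to the coordinates of the points `p j`. -/
def IsDual {ι : Type} [DecidableEq ι] (p : ι → I → C.Point)
    (δ : ι → Derivation ℂ (Ultrapower U) (Ultrapower U)) : Prop :=
  ∀ j k, δ k (starVal U (p j) C.x) = if j = k then 1 else 0

theorem IsDual.card_le {ι : Type} [DecidableEq ι] {p : ι → I → C.Point}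
    {δ : ι → Derivation ℂ (Ultrapower U) (Ultrapower U)} (hδ : IsDual p δ) {c : ℕ}
    (q : Fin c → I → C.Point) {B : Finset ι}
    (hB : ∀ᶠ i in U, 2 ≤ C.h0 (ptSum p B i + ptSum q Finset.univ i))
    (hmin : ∀ k ∈ B, ∀ᶠ i in U, C.h0 (ptSum p (B.erase k) i + ptSum q Finset.univ i) ≤ 1)
    (hb : B.card + 2 * c ≤ C.genus) : B.card ≤ c := by
  by_contra! hcon
  set Q := ptSum q Finset.univ with hQ
  have hQ0 : ∀ i, 0 ≤ Q i := ptSum_nonneg _ _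
  have hQd : ∀ i, C.deg (Q i) = c := fun i => by
    rw [hQ, deg_ptSum, Finset.card_univ, Fintype.card_fin]
  have hcard : ∀ k ∈ B, ((B.erase k).card : ℤ) = B.card - 1 := fun k hk => by
    have := Finset.card_erase_add_one hk
    omega
  have hone : ∀ k ∈ B, ∀ᶠ i in U, C.h0 (ptSum p (B.erase k) i + Q i) = 1 := fun k hk =>
    (hmin k hk).mono fun i hi => le_antisymm hi
      (h0_pos_of_effective (add_nonneg (ptSum_nonneg _ _ _) (hQ0 i)))
  have hV : ∀ k ∈ B, ∀ᶠ i in U, C.van (ptSum p (B.erase k) i + Q i) = C.van (ptSum p B i + Q i) :=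
    fun k hk => by
      filter_upwards [hone k hk, hB] with i h1 h2
      have h3 := h0_K_sub (ptSum p (B.erase k) i + Q i)
      have h4 := h0_K_sub (ptSum p B i + Q i)
      have h5 : C.h0 (ptSum p B i + Q i) ≤ C.h0 (ptSum p (B.erase k) i + Q i) + 1 := by
        rw [ptSum_erase p hk, add_right_comm]
        simpa using h0_le_sub_pt (ptSum p (B.erase k) i + Q i + C.pt (p k i)) (p k i)
      rw [deg_add, deg_ptSum, hcard k hk] at h3
      rw [deg_add, deg_ptSum] at h4
      rw [van, van, H0_eq_of_le (D := C.K - (ptSum p B i + Q i)) (sub_le_sub_left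
        (add_le_add_left ((ptSum_erase p hk i).symm ▸ le_add_of_nonneg_right (pt_nonneg _)) _) _)]
      omega
  obtain ⟨k₀, hk₀⟩ : B.Nonempty := Finset.card_pos.1 (by omega)
  set V := starVan U fun i => ptSum p B i + Q i with hVdef
  have hmem : ∀ k ∈ B, ∀ h, h ∈ starVan U (fun i => ptSum p (B.erase k) i + Q i) → h ∈ V :=
    fun k hk h hh => by
      filter_upwards [hh, hV k hk] with i h1 h2
      exact h2 ▸ h1
  have hVrank : Module.finrank (Ultrapower U) V = C.genus - B.card - c + 1 := by
    refine finrank_starVan (.of_forall fun i => add_nonneg (ptSum_nonneg _ _ _) (hQ0 i)) ?_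
    filter_upwards [hone k₀ hk₀, hB] with i h1 h2
    have h4 := h0_K_sub (ptSum p B i + Q i)
    have h5 : C.h0 (ptSum p B i + Q i) ≤ C.h0 (ptSum p (B.erase k₀) i + Q i) + 1 := by
      rw [ptSum_erase p hk₀, add_right_comm]
      simpa using h0_le_sub_pt (ptSum p (B.erase k₀) i + Q i + C.pt (p k₀ i)) (p k₀ i)
    rw [deg_add, deg_ptSum, hQd] at h4
    omega
  obtain ⟨T, hT, hTV⟩ := V.exists_coordZero_finrank (N := C.genus - B.card - 2 * c) (by omega)
  have hW : T.card < Module.finrank (Ultrapower U)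
      (starVan U fun i => ptSum p B i + Q i + Q i) := by
    refine le_finrank_starVan (.of_forall fun i =>
      add_nonneg (add_nonneg (ptSum_nonneg _ _ _) (hQ0 i)) (hQ0 i)) ?_
    filter_upwards [hB] with i h2
    have h4 := h0_K_sub (ptSum p B i + Q i)
    have h5 := h0_le_add_deg (hQ0 i) (C.K - (ptSum p B i + Q i))
    rw [sub_sub] at h5
    rw [deg_add, deg_ptSum, hQd] at h4
    rw [hQd] at h5
    omega
  obtain ⟨h, hhW, hhT, hh0⟩ := Submodule.exists_mem_coordZero _ hW
  have hhV : h ∈ V := by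
    filter_upwards [hhW] with i h1
    exact C.H0_mono (fun P => sub_le_sub_left (le_add_of_nonneg_right (hQ0 i)) _ P) h1
  have hder : ∀ k ∈ B, (fun j => δ k (h j)) ∈ V := fun k hk => by
    refine hmem k hk _ (derivation_mem_starVan (Z := fun i => ptSum p B i + Q i + Q i)
      (T := p '' (B.erase k) ∪ Set.range q)
      (((Finset.finite_toSet _).image _).union (Set.finite_range q))
      (.of_forall fun i P hP => ?_)
      (.of_forall fun i => add_nonneg (ptSum_nonneg _ _ _) (hQ0 i)) (M := B.card + c)
      (.of_forall fun i => ?_) (.of_forall fun i => ?_) ?_ hhW)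
    · by_cases h1 : ptSum p (B.erase k) i P = 0
      · have h2 : Q i P ≠ 0 := fun h2 => hP (by rw [Finsupp.add_apply, h1, h2, add_zero])
        obtain ⟨r, _, hr⟩ := exists_of_ptSum_ne_zero h2
        exact ⟨q r, Or.inr ⟨r, rfl⟩, hr⟩
      · obtain ⟨j, hj, hj'⟩ := exists_of_ptSum_ne_zero h1
        exact ⟨p j, Or.inl ⟨j, hj, rfl⟩, hj'⟩
    · rw [deg_add, deg_ptSum, hQd, hcard k hk]; omega
    · rw [ptSum_erase p hk, add_assoc, add_assoc]
      exact add_le_add_right (le_add_of_nonneg_of_le (pt_nonneg _)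
        (le_add_of_nonneg_right (hQ0 i))) _
    · rintro z (⟨j, hj, rfl⟩ | ⟨r, rfl⟩) hz
      · rw [hδ, if_neg (Finset.ne_of_mem_erase hj)] at hz
        exact absurd rfl hz
      · refine .of_forall fun i => ?_
        have h1 := one_le_ptSum q (Finset.mem_univ r) i
        have h2 := pt_nonneg (p k i) (q r i)
        rw [ptSum_erase p hk]
        simp only [Finsupp.add_apply]
        change 1 ≤ Q i (q r i) at h1
        have h3 : (0 : C.Div) (q r i) = 0 := rfl
        omega
  have hderT : ∀ k ∈ B, (fun j => δ k (h j)) ∈ Submodule.coordZero (Ultrapower U) T :=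
    fun k _ j hj => by change δ k (h j) = 0; rw [hhT j hj, map_zero]
  let v : Option B → (V ⊓ Submodule.coordZero (Ultrapower U) T :
      Submodule (Ultrapower U) (Fin C.genus → Ultrapower U)) := fun o =>
    o.elim ⟨h, hhV, hhT⟩ fun k => ⟨fun j => δ k (h j), hder k k.2, hderT k k.2⟩
  have hdep : ¬ LinearIndependent (Ultrapower U) v := fun hli => by
    have := hli.fintype_card_le_finrank
    rw [Fintype.card_option, Fintype.card_coe] at this
    omega
  rw [Fintype.not_linearIndependent_iff] at hdep
  obtain ⟨a, ha, o, hao⟩ := hdep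
  have ha' : ∀ j, a none * h j + ∑ k : B, a (some k) * δ k (h j) = 0 := fun j => by
    have := congrFun (congrArg Subtype.val ha) j
    rw [Fintype.sum_option] at this
    simpa [v] using this
  obtain ⟨k, hk⟩ : ∃ k, a (some k) ≠ 0 := by
    by_contra! hall
    cases o with
    | some k => exact hao (hall k)
    | none =>
      obtain ⟨j, hj⟩ := Function.ne_iff.1 hh0
      have := ha' j
      simp only [hall, zero_mul, Finset.sum_const_zero, add_zero] at this
      exact (mul_ne_zero hao hj) this
  let ε : Derivation ℂ (Ultrapower U) (Ultrapower U) := ∑ k : B, a (some k) • δ k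
  have hε : ∀ f, ε f = ∑ k : B, a (some k) * δ k f := fun f => by
    simp only [ε, ← Derivation.coeFnAddMonoidHom_apply, map_sum, Finset.sum_apply]
    rfl
  refine hh0 (eq_zero_of_derivation_eq_smul (δ := ε) (z := p k) (β := -a none) ?_ (fun j => ?_)
    (vanAt_of_mem_starVan hhV (.of_forall fun i => ?_)))
  · rw [hε, Finset.sum_eq_single k]
    · rw [hδ, if_pos rfl, mul_one]; exact hk
    · intro l _ hl
      rw [hδ, if_neg fun h => hl (Subtype.ext h.symm), mul_zero]
    · exact fun h => absurd (Finset.mem_univ _) h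
  · rw [hε]; linear_combination ha' j
  · have h1 := one_le_ptSum p k.2 i
    have h2 := hQ0 i (p k i)
    rw [Finsupp.add_apply]
    have h3 : (0 : C.Div) (p k i) = 0 := rfl
    push_cast
    omega

end Curve

namespace Curve
open Ultrapower
variable {C : Curve} {I : Type} {U : Ultrafilter I}

/-- A function takes different values at two points one of which moves independently. -/
theorem starVal_ne {z w : I → C.Point} {δ : Derivation ℂ (Ultrapower U) (Ultrapower U)}
    (hz : δ (starVal U z C.x) ≠ 0) (hw : δ (starVal U w C.x) = 0) (hwm : IsMoving U w) {f : C.F}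
    (hf : ∀ c, f ≠ algebraMap ℂ C.F c) : starVal U z f ≠ starVal U w f := fun h => by
  have hzm := isMoving_of_ne hz
  have h1 := hzm.derivation_starVal δ f
  rw [h, hwm.derivation_starVal δ f, hw, zero_mul] at h1
  have h2 : hzm.eval (C.ddx f) = 0 := (mul_eq_zero.1 h1.symm).resolve_left hz
  exact ddx_ne_zero hf ((map_eq_zero _).1 h2)

/-- The value of the pencil spanned by `s` and `t` at a zero of one of its members. -/
theorem add_mul_val_eq_zero {A : C.Div} {s t : C.F} {P : C.Point} {a b : ℂ}
    (hA : A P = 0) (hs' : s⁻¹ ∈ C.V P 0) (hv : t * s⁻¹ ∈ C.V P 0)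
    (hs0 : s ≠ 0) (hf : a • s + b • t ∈ C.H0 (A - C.pt P)) : a + b * C.val P (t * s⁻¹) = 0 := by
  have h1 : a • s + b • t ∈ C.V P 1 := by
    have := (mem_H0_sub_pt.1 hf).2
    rwa [hA, neg_zero, zero_add] at this
  have h2 : (a • s + b • t) * s⁻¹ ∈ C.V P (1 + 0) := mul_mem_V h1 hs'
  have h3 : (a • s + b • t) * s⁻¹ = algebraMap ℂ C.F a + b • (t * s⁻¹) := by
    rw [add_mul, smul_mul_assoc, smul_mul_assoc, mul_inv_cancel₀ hs0, Algebra.algebraMap_eq_smul_one]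
  rw [h3, add_zero] at h2
  have h4 : b • (t * s⁻¹) ∈ C.V P 0 := Submodule.smul_mem _ _ hv
  have h5 := (val_eq_zero_iff (Submodule.add_mem _ (algebraMap_mem_V P a) h4)).2 h2
  rwa [val_add (algebraMap_mem_V P a) h4, val_algebraMap, val_smul hv] at h5

/-- Two independently moving points are not contained in a member of a fixed pencil. -/
theorem not_eventually_mem_pencil {z w : I → C.Point}
    {δ : Derivation ℂ (Ultrapower U) (Ultrapower U)} (hz : δ (starVal U z C.x) ≠ 0)
    (hw : δ (starVal U w C.x) = 0) (hwm : IsMoving U w) {A : C.Div} (hA : C.IsBPFPencil A)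
    (h : ∀ᶠ i in U, ∃ f ∈ C.H0 (A - C.pt (z i)), f ∈ C.H0 (A - C.pt (w i)) ∧ f ≠ 0) : False := by
  obtain ⟨s, -, t, -, hs0, hst, hspan⟩ := hA.exists_pair
  have hzm := isMoving_of_ne hz
  refine starVal_ne hz hw hwm (f := t * s⁻¹) (fun c hc => hst c ?_) (mk_eq.2 ?_)
  · rw [Algebra.smul_def, ← hc, inv_mul_cancel_right₀ hs0]
  · filter_upwards [h, hzm.apply_eq_zero A, hwm.apply_eq_zero A, hzm.regular s⁻¹, hwm.regular s⁻¹,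
      hzm.regular (t * s⁻¹), hwm.regular (t * s⁻¹)] with i hf hz1 hw1 hz2 hw2 hz3 hw3
    obtain ⟨f, hfz, hfw, hf0⟩ := hf
    obtain ⟨a, b, rfl⟩ := hspan f (C.H0_mono (sub_pt_le A _) hfz)
    have h1 := add_mul_val_eq_zero hz1 hz2 hz3 hs0 hfz
    have h2 := add_mul_val_eq_zero hw1 hw2 hw3 hs0 hfw
    have hb : b ≠ 0 := fun hb => hf0 (by
      rw [hb, zero_mul, add_zero] at h1
      rw [hb, h1, zero_smul, zero_smul, add_zero])
    exact mul_left_cancel₀ hb (by linear_combination h1 - h2)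

section Dual

variable {ι : Type} [DecidableEq ι] {p : ι → I → C.Point}
    {δ : ι → Derivation ℂ (Ultrapower U) (Ultrapower U)}

theorem IsDual.isMoving (hδ : IsDual p δ) (j : ι) : IsMoving U (p j) :=
  isMoving_of_ne (δ := δ j) (f := C.x) (by rw [hδ, if_pos rfl]; exact one_ne_zero)

variable [Fintype ι]

theorem IsDual.exists_card_le (hδ : IsDual p δ) {c : ℕ} (q : Fin c → I → C.Point)
    (hg : Fintype.card ι + 2 * c ≤ C.genus)
    (h : ¬ ∀ᶠ i in U, C.h0 (ptSum p Finset.univ i + ptSum q Finset.univ i) ≤ 1) :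
    ∃ B : Finset ι, B.card ≤ c ∧ ∀ᶠ i in U, 2 ≤ C.h0 (ptSum p B i + ptSum q Finset.univ i) := by
  obtain ⟨B, hB, hmin⟩ := WellFounded.has_min (wellFounded_lt (α := Finset ι))
    {B | ¬ ∀ᶠ i in U, C.h0 (ptSum p B i + ptSum q Finset.univ i) ≤ 1} ⟨_, h⟩
  have hB' : ∀ᶠ i in U, 2 ≤ C.h0 (ptSum p B i + ptSum q Finset.univ i) := by
    filter_upwards [Ultrafilter.eventually_not.2 hB] with i hi
    omega
  refine ⟨B, hδ.card_le q hB' (fun k hk => ?_) ?_, hB'⟩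
  · by_contra hcon
    exact hmin _ hcon (Finset.erase_ssubset hk)
  · have := Finset.card_le_univ B
    omega

theorem IsDual.eventually_h0_add_pt [IsGeneral C] (hδ : IsDual p δ)
    (hg : Fintype.card ι + 2 ≤ C.genus) :
    ∀ᶠ i in U, ∀ q, C.h0 (ptSum p Finset.univ i + C.pt q) ≤ 1 := by
  by_contra hcon
  have h : ∀ᶠ i in U, ∃ q, ¬ C.h0 (ptSum p Finset.univ i + C.pt q) ≤ 1 := by
    filter_upwards [Ultrafilter.eventually_not.2 hcon] with i hi
    exact not_forall.1 hi
  obtain ⟨q, hq⟩ := h.choice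
  have hQ : ∀ i, ptSum (fun _ : Fin 1 => q) Finset.univ i = C.pt (q i) := fun i => by simp [ptSum]
  obtain ⟨B, hB, h2⟩ := hδ.exists_card_le (fun _ : Fin 1 => q) (by omega)
    (Ultrafilter.eventually_not.1 (by simpa only [hQ] using hq))
  obtain ⟨i, hi⟩ := h2.exists
  rw [hQ] at hi
  have := h0_le_one (D := ptSum p B i + C.pt (q i)) (by rw [deg_add, deg_ptSum, deg_pt]; omega)
  omega

theorem IsDual.eventually_h0_add_pt_add_pt [IsGeneral C] {S : Finset C.Div}
    (hS : ∀ A, C.IsTetragonal A → ∃ B ∈ S, C.LinEquiv A B) (hδ : IsDual p δ)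
    (hg : Fintype.card ι + 4 ≤ C.genus) :
    ∀ᶠ i in U, ∀ q r, C.h0 (ptSum p Finset.univ i + (C.pt q + C.pt r)) ≤ 1 := by
  by_contra hcon
  have h : ∀ᶠ i in U, ∃ q : C.Point × C.Point,
      ¬ C.h0 (ptSum p Finset.univ i + (C.pt q.1 + C.pt q.2)) ≤ 1 := by
    filter_upwards [Ultrafilter.eventually_not.2 hcon] with i hi
    simp only [not_forall] at hi
    obtain ⟨q, r, h⟩ := hi
    exact ⟨(q, r), h⟩
  obtain ⟨q, hq⟩ := h.choice
  have hQ : ∀ i, ptSum (fun k : Fin 2 => fun i => ![(q i).1, (q i).2] k) Finset.univ i =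
      C.pt (q i).1 + C.pt (q i).2 := fun i => by simp [ptSum]
  obtain ⟨B, hB, h2⟩ := hδ.exists_card_le (fun k : Fin 2 => fun i => ![(q i).1, (q i).2] k)
    (by omega) (Ultrafilter.eventually_not.1 (by simpa only [hQ] using hq))
  simp only [hQ] at h2
  have hB2 : B.card = 2 := by
    obtain ⟨i, hi⟩ := h2.exists
    by_contra hne
    have := h0_le_one (D := ptSum p B i + (C.pt (q i).1 + C.pt (q i).2))
      (by rw [deg_add, deg_ptSum, deg_add, deg_pt, deg_pt]; omega)
    omega
  obtain ⟨a, b, hab, rfl⟩ := Finset.card_eq_two.1 hB2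
  have hT : ∀ᶠ i in U, C.IsTetragonal (ptSum p {a, b} i + (C.pt (q i).1 + C.pt (q i).2)) := by
    filter_upwards [h2] with i hi
    exact ⟨by rw [deg_add, deg_ptSum, deg_add, deg_pt, deg_pt, hB2]; rfl, hi⟩
  obtain ⟨A, hA⟩ := (hT.mono fun i hi => hS _ hi).choice
  obtain ⟨A₀, -, hA₀⟩ := Ultrafilter.eventually_eq_const (S : Set C.Div) S.finite_toSet
    (hA.mono fun i hi => hi.1)
  have hlin : ∀ᶠ i in U,
      C.LinEquiv (ptSum p {a, b} i + (C.pt (q i).1 + C.pt (q i).2)) A₀ := by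
    filter_upwards [hA, hA₀] with i h1 h3
    exact h3 ▸ h1.2
  have hA₀T : C.IsTetragonal A₀ := by
    obtain ⟨i, h1, h3⟩ := (hT.and hlin).exists
    exact h1.congr h3.symm
  refine not_eventually_mem_pencil (δ := δ a) (z := p a) (w := p b) (by simp [hδ a a])
    (by rw [hδ, if_neg hab.symm]) (hδ.isMoving b) hA₀T.isBPFPencil ?_
  filter_upwards [hlin] with i hi
  obtain ⟨f, hf0, hf⟩ := hi
  have hle : C.pt (p a i) + C.pt (p b i) ≤ A₀ + C.divOf f := by
    rw [← hf, add_sub_cancel, ptSum, Finset.sum_pair hab]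
    exact le_add_of_nonneg_right (add_nonneg (pt_nonneg _) (pt_nonneg _))
  exact ⟨f, (mem_H0_sub hf0).2 ((le_add_of_nonneg_right (pt_nonneg _)).trans hle),
    (mem_H0_sub hf0).2 ((le_add_of_nonneg_left (pt_nonneg _)).trans hle), hf0⟩

end Dual

end Curve

namespace Curve
variable {C : Curve}

theorem exists_of_sum_pt_ne_zero {κ : Type} {σ : κ → C.Point} {B : Finset κ} {P : C.Point}
    (h : (∑ k ∈ B, C.pt (σ k)) P ≠ 0) : ∃ j ∈ B, σ j = P := by
  by_contra hcon
  push Not at hcon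
  refine h ?_
  rw [Finsupp.finsetSum_apply]
  exact Finset.sum_eq_zero fun j hj => pt_ne (hcon j hj)

theorem mem_H0_sub_sum_pt {κ : Type} {σ : κ → C.Point} (hσ : Injective σ) {N : C.Div} {f : C.F}
    (B : Finset κ) (hf0 : f ∈ C.H0 N) (hf : ∀ k ∈ B, f ∈ C.H0 (N - C.pt (σ k))) :
    f ∈ C.H0 (N - ∑ k ∈ B, C.pt (σ k)) := by
  classical
  induction B using Finset.induction_on with
  | empty => simpa using hf0
  | insert k B hk ih =>
    rw [Finset.sum_insert hk]
    refine mem_H0_sub_add (hf k (Finset.mem_insert_self _ _))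
      (ih fun j hj => hf j (Finset.mem_insert_of_mem hj)) (pt_nonneg _)
      (Finset.sum_nonneg fun _ _ => pt_nonneg _) fun P => ?_
    by_contra! hcon
    obtain ⟨j, hj, rfl⟩ := exists_of_sum_pt_ne_zero hcon.2
    exact hcon.1 (pt_ne fun h => hk (hσ h ▸ hj))

theorem exists_eq_sum_pt {m : ℕ} {Z : C.Div} (hZ : 0 ≤ Z) (hm : C.deg Z = m) :
    ∃ z : Fin m → C.Point, Z = ∑ l, C.pt (z l) := by
  induction m generalizing Z with
  | zero => exact ⟨Fin.elim0, by simpa using eq_zero_of_deg hZ (by simpa using hm)⟩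
  | succ m ih =>
    obtain ⟨P, hP⟩ := exists_pt_le hZ (by rw [hm]; positivity)
    obtain ⟨z, hz⟩ := ih (sub_nonneg.2 hP) (by rw [deg_sub, hm, deg_pt]; push_cast; ring)
    refine ⟨Fin.cons P z, ?_⟩
    rw [Fin.sum_univ_succ, Fin.cons_zero]
    simp only [Fin.cons_succ]
    rw [← hz]; abel

/-- A pencil obtained by projecting the canonical curve from points in general position. -/
theorem exists_pencil [IsGeneral C] {κ : Type} [Fintype κ] [DecidableEq κ] {σ : κ → C.Point}
    (hκ : Fintype.card κ + 3 = C.genus)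
    (h1 : ∀ q, C.h0 (∑ k, C.pt (σ k) + C.pt q) ≤ 1)
    (h2 : ∀ k q r, C.h0 (∑ j ∈ Finset.univ.erase k, C.pt (σ j) + (C.pt q + C.pt r)) ≤ 1) :
    ∃ q r, C.deg (∑ k, C.pt (σ k) + (C.pt q + C.pt r)) = C.genus - 1 ∧
      C.IsBPFPencil (∑ k, C.pt (σ k) + (C.pt q + C.pt r)) ∧
      C.h0 (C.K - (∑ k, C.pt (σ k) + (C.pt q + C.pt r))) = 2 := by
  have hE' : ∀ k, ∑ j, C.pt (σ j) = ∑ j ∈ Finset.univ.erase k, C.pt (σ j) + C.pt (σ k) :=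
    fun k => (Finset.sum_erase_add _ _ (Finset.mem_univ k)).symm
  have hEd : C.deg (∑ k, C.pt (σ k)) = C.genus - 3 := by
    rw [deg_sum]; simp; omega
  have hE0 : 0 ≤ ∑ k, C.pt (σ k) := Finset.sum_nonneg fun _ _ => pt_nonneg _
  set E := ∑ k, C.pt (σ k) with hE
  have hq : ∀ q, C.h0 (E + C.pt q) = 1 := fun q =>
    le_antisymm (h1 q) (h0_pos_of_effective (add_nonneg hE0 (pt_nonneg _)))
  have hE1 : C.h0 E = 1 := le_antisymm ((h0_mono (le_add_of_nonneg_right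
    (pt_nonneg (Classical.arbitrary C.Point)))).trans (h1 _)) (h0_pos_of_effective hE0)
  have hRR := h0_K_sub E
  obtain ⟨q, r, hqr⟩ := exists_node (C := C) (M := C.K - E) (by rw [deg_sub, deg_K, hEd]; ring)
    (by omega) fun q => by
      have := h0_K_sub (E + C.pt q)
      rw [hq, deg_add, deg_pt, hEd] at this
      rw [sub_sub]; omega
  have hDd : C.deg (E + (C.pt q + C.pt r)) = C.genus - 1 := by
    rw [deg_add, deg_add, deg_pt, deg_pt, hEd]; ring
  rw [sub_sub, sub_sub, ← add_assoc] at hqr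
  have hD2 : C.h0 (E + (C.pt q + C.pt r)) = 2 := by
    have h3 := h0_K_sub (E + (C.pt q + C.pt r))
    have h4 := h0_le_sub_pt (E + (C.pt q + C.pt r)) r
    rw [← add_assoc, add_sub_cancel_right, hq] at h4
    rw [← add_assoc] at h3 hDd ⊢
    omega
  have hKD : C.h0 (C.K - (E + (C.pt q + C.pt r))) = 2 := by
    have h3 := h0_K_sub (E + (C.pt q + C.pt r))
    omega
  refine ⟨q, r, hDd, ⟨fun P => ?_, hD2⟩, hKD⟩
  rw [hD2]
  have h3 := h0_le_sub_pt (E + (C.pt q + C.pt r)) P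
  suffices C.h0 (E + (C.pt q + C.pt r) - C.pt P) ≤ 1 by omega
  by_contra! hcon
  have h4 := H0_eq_of_le (sub_pt_le (E + (C.pt q + C.pt r)) P) (by omega)
  have h5 : (1 : C.F) ∈ C.H0 (E + (C.pt q + C.pt r)) :=
    one_mem_H0_iff.2 (add_nonneg hE0 (add_nonneg (pt_nonneg _) (pt_nonneg _)))
  rw [← h4, one_mem_H0_iff] at h5
  have h6 := h5 P
  rw [Finsupp.sub_apply, pt_self] at h6
  simp only [Finsupp.add_apply] at h6
  have h7 : (0 : C.Div) P = 0 := rfl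
  by_cases hqP : q = P
  · rw [← hqP, add_left_comm, add_sub_cancel_left, hq] at hcon
    omega
  by_cases hrP : r = P
  · rw [← hrP, ← add_assoc, add_sub_cancel_right, hq] at hcon
    omega
  rw [pt_ne hqP, pt_ne hrP] at h6
  obtain ⟨k, -, rfl⟩ := exists_of_sum_pt_ne_zero (show E P ≠ 0 by omega)
  rw [hE' k, add_right_comm, add_sub_cancel_right] at hcon
  exact absurd (h2 k q r) (by omega)

/-- If the residual of a pencil as in `exists_pencil` has a base point, then there is a canonical
divisor `Z + N` with `h0 Z = 2`, with `t` in `Z`, and with all the points in `N`. -/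
theorem exists_residual [IsGeneral C] {κ : Type} [Fintype κ] {σ : κ → C.Point}
    (hσ : Injective σ) {q r : C.Point}
    (hd : C.deg (∑ k, C.pt (σ k) + (C.pt q + C.pt r)) = C.genus - 1)
    (hK2 : C.h0 (C.K - (∑ k, C.pt (σ k) + (C.pt q + C.pt r))) = 2)
    (hb : ¬ C.IsBPFPencil (C.K - (∑ k, C.pt (σ k) + (C.pt q + C.pt r)))) (t : C.Point) :
    ∃ f : C.F, ∃ Z : C.Div, ∃ a b, f ≠ 0 ∧ 0 ≤ Z ∧ C.pt t ≤ Z ∧ C.deg Z = C.genus - 2 ∧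
      C.h0 Z = 2 ∧ C.h0 (C.K - (Z + (C.pt (σ a) + C.pt (σ b)))) = 1 ∧
      f ∈ C.H0 (C.K - (Z + (C.pt (σ a) + C.pt (σ b)))) ∧ ∀ j, f ∈ C.H0 (C.K - C.pt (σ j)) := by
  classical
  have hE0 : 0 ≤ ∑ k, C.pt (σ k) := Finset.sum_nonneg fun _ _ => pt_nonneg _
  have hEσ : ∀ B : Finset κ, ∑ k ∈ B, C.pt (σ k) ≤ ∑ k, C.pt (σ k) := fun B =>
    Finset.sum_le_sum_of_subset_of_nonneg (Finset.subset_univ B) fun _ _ _ => pt_nonneg _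
  set E := ∑ k, C.pt (σ k) with hE
  set D := E + (C.pt q + C.pt r) with hD
  obtain ⟨s, hs⟩ : ∃ s, C.h0 (C.K - D - C.pt s) + 1 ≠ C.h0 (C.K - D) := by
    by_contra! hcon
    exact hb ⟨hcon, hK2⟩
  have hs1 := h0_le_sub_pt (C.K - D) s
  have hs2 := h0_sub_pt_le (C.K - D) s
  obtain ⟨N, hN⟩ : ∃ N, N = D + C.pt s := ⟨_, rfl⟩
  rw [sub_sub, ← hN] at hs hs1 hs2
  have hNd : C.deg N = C.genus := by rw [hN, deg_add, hd, deg_pt]; ring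
  have hEN : E ≤ N := by
    rw [hN, hD, add_assoc]
    exact le_add_of_nonneg_right (add_nonneg (add_nonneg (pt_nonneg _) (pt_nonneg _)) (pt_nonneg _))
  have hRR := h0_K_sub N
  have hNE : C.h0 (N - E) ≤ 1 := h0_le_one (by
    rw [hN, hD, show E + (C.pt q + C.pt r) + C.pt s - E = C.pt q + C.pt r + C.pt s by abel]
    simp)
  have hsep : ∀ f ∈ C.H0 N, f ∉ C.H0 (N - E) → ∃ k, f ∉ C.H0 (N - C.pt (σ k)) := by
    intro f hf hfE
    by_contra! hcon
    exact hfE (mem_H0_sub_sum_pt hσ Finset.univ hf fun k _ => hcon k)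
  obtain ⟨f₁, hf₁, hf₁'⟩ := exists_notMem_of_h0_lt (show C.h0 (N - E) < C.h0 N by omega)
  obtain ⟨a, ha⟩ := hsep f₁ hf₁ hf₁'
  have ha1 := h0_lt_of_notMem (sub_pt_le N _) hf₁ ha
  have ha2 := h0_le_sub_pt N (σ a)
  obtain ⟨f₂, hf₂, hf₂'⟩ := exists_notMem_of_h0_lt
    (show C.h0 (N - E) < C.h0 (N - C.pt (σ a)) by omega)
  obtain ⟨b, hb⟩ := hsep f₂ (C.H0_mono (sub_pt_le N _) hf₂) hf₂'
  have hab : a ≠ b := fun h => hb (h ▸ hf₂)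
  have hb1 := h0_lt_of_notMem (sub_pt_le (N - C.pt (σ a)) (σ b)) hf₂ fun h =>
    hb (C.H0_mono (by rw [sub_right_comm]; exact sub_pt_le _ _) h)
  have hb2 := h0_le_sub_pt (N - C.pt (σ a)) (σ b)
  obtain ⟨f, hf, hf0⟩ := h0_pos_iff.1 (show 0 < C.h0 (C.K - N - C.pt t) by
    have := h0_le_sub_pt (C.K - N) t
    omega)
  have htZ := (mem_H0_sub hf0).1 hf
  have hlin := divOf_linEquiv hf0 (C.K - N)
  obtain ⟨Z, hZ⟩ : ∃ Z, Z = C.K - N + C.divOf f := ⟨_, rfl⟩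
  rw [← hZ] at htZ hlin
  have hZ0 := (pt_nonneg t).trans htZ
  have hKf : C.K + C.divOf f = Z + N := by rw [hZ]; abel
  refine ⟨f, Z, a, b, hf0, hZ0, htZ, ?_, by rw [hlin.h0_eq]; omega, ?_, ?_, fun j => ?_⟩
  · rw [hlin.deg_eq, deg_sub, deg_K, hNd]; ring
  · have h1 := (((PreCurve.LinEquiv.refl C.K).sub (hlin.add
      (PreCurve.LinEquiv.refl (C.pt (σ a) + C.pt (σ b)))))).h0_eq
    rw [h1, show C.K - (C.K - N + (C.pt (σ a) + C.pt (σ b))) = N - C.pt (σ a) - C.pt (σ b) by abel]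
    omega
  · rw [mem_H0_sub hf0, hKf]
    refine add_le_add_right (le_trans ?_ hEN) _
    rw [← Finset.sum_pair (f := fun k => C.pt (σ k)) hab]
    exact hEσ _
  · rw [mem_H0_sub hf0, hKf]
    refine le_add_of_nonneg_of_le hZ0 (le_trans ?_ hEN)
    have := hEσ {j}
    rwa [Finset.sum_singleton] at this

end Curve

namespace Curve
open Ultrapower
variable {C : Curve}

/-- An ultrafilter on `ℂⁿ` along which the coordinates are algebraically independent. -/
theorem _root_.Ultrapower.exists_algebraicIndependent (ι : Type) [Finite ι] :
    ∃ U : Ultrafilter (ι → ℂ), AlgebraicIndependent ℂ fun j => Ultrapower.mk U fun c => c j := by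
  obtain ⟨U, hU⟩ := Ultrafilter.exists_ultrafilter_of_finite_inter_nonempty
    (Set.range fun G : {G : MvPolynomial ι ℂ // G ≠ 0} => {c | MvPolynomial.eval c G.1 ≠ 0})
    fun T hT => by
      obtain ⟨S, hS⟩ := Set.subset_range_iff_exists_image_eq.1 hT
      have hSf : (⋂₀ (T : Set (Set (ι → ℂ)))).Nonempty := by
        choose G hG using fun t : T => hT t.2
        have h0 : ∏ t, (G t).1 ≠ 0 := Finset.prod_ne_zero_iff.2 fun t _ => (G t).2
        obtain ⟨c, hc⟩ : ∃ c, MvPolynomial.eval c (∏ t, (G t).1) ≠ 0 := by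
          by_contra! hcon
          exact h0 (MvPolynomial.funext fun c => by rw [hcon, map_zero])
        refine ⟨c, fun t ht => ?_⟩
        rw [map_prod, Finset.prod_ne_zero_iff] at hc
        have h1 := hc ⟨t, ht⟩ (Finset.mem_univ _)
        have h2 := hG ⟨t, ht⟩
        rw [← show _ = t from h2]
        exact h1
      exact hSf
  refine ⟨U, algebraicIndependent_iff.2 fun G hG => ?_⟩
  have h1 : ∀ G : MvPolynomial ι ℂ, MvPolynomial.aeval (fun j => Ultrapower.mk U fun c => c j) G =
      Ultrapower.mk U fun c => MvPolynomial.eval c G := fun G => by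
    induction G using MvPolynomial.induction_on with
    | C a => rw [MvPolynomial.aeval_C, Ultrapower.algebraMap_eq]; simp
    | add p q hp hq => rw [map_add, hp, hq, ← map_add]; simp; rfl
    | mul_X p n hp => rw [map_mul, hp, MvPolynomial.aeval_X, ← map_mul]; simp; rfl
  rw [h1, mk_eq_zero] at hG
  by_contra h0
  obtain ⟨c, hc, hc'⟩ := (hG.and (hU ⟨⟨G, h0⟩, rfl⟩)).exists
  exact hc' hc

theorem exists_isDual (C : Curve) (ι : Type) [Finite ι] [DecidableEq ι] :
    ∃ (U : Ultrafilter (ι → ℂ)) (p : ι → (ι → ℂ) → C.Point)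
      (δ : ι → Derivation ℂ (Ultrapower U) (Ultrapower U)), IsDual p δ := by
  obtain ⟨U, hU⟩ := Ultrapower.exists_algebraicIndependent ι
  have hp : ∀ j, starVal U (fun c : ι → ℂ => C.px (c j)) C.x = Ultrapower.mk U fun c => c j :=
    fun j => mk_eq.2 (.of_forall fun c => val_eq (px_spec (c j)))
  choose δ hδ using fun k : ι => hU.exists_derivation fun j => if j = k then 1 else 0
  exact ⟨U, fun j c => C.px (c j), δ, fun j k => by rw [hp, hδ]⟩

variable {I : Type} {U : Ultrafilter I}

theorem IsDual.comp {ι κ : Type} [DecidableEq ι] [DecidableEq κ] {p : ι → I → C.Point}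
    {δ : ι → Derivation ℂ (Ultrapower U) (Ultrapower U)} (hδ : IsDual p δ) {e : κ → ι}
    (he : Injective e) : IsDual (p ∘ e) (δ ∘ e) := fun j k => by
  rw [Function.comp_apply, Function.comp_apply, hδ]
  simp only [he.eq_iff]

theorem ptSum_comp {ι κ : Type} [Fintype κ] {p : ι → I → C.Point} {e : κ → ι} (he : Injective e)
    (i : I) : ptSum (p ∘ e) Finset.univ i = ptSum p (Finset.univ.map ⟨e, he⟩) i := by
  simp [ptSum]

theorem IsDual.eventually_injective {ι : Type} [Finite ι] [DecidableEq ι] {p : ι → I → C.Point}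
    {δ : ι → Derivation ℂ (Ultrapower U) (Ultrapower U)} (hδ : IsDual p δ) :
    ∀ᶠ i in U, Injective fun j => p j i := by
  have h : ∀ᶠ i in U, ∀ j k, j ≠ k → p j i ≠ p k i := by
    refine Filter.eventually_all.2 fun j => Filter.eventually_all.2 fun k => ?_
    by_cases hjk : j = k
    · exact .of_forall fun i h => absurd hjk h
    · have : ∀ᶠ i in U, p j i ≠ p k i := by
        rw [Ultrafilter.eventually_not]
        intro hcon
        have h1 : starVal U (p j) C.x = starVal U (p k) C.x :=
          mk_eq.2 (hcon.mono fun i hi => by rw [hi])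
        have h2 := hδ j j
        rw [h1, hδ, if_neg (Ne.symm hjk), if_pos rfl] at h2
        exact zero_ne_one h2
      exact this.mono fun i hi _ => hi
  exact h.mono fun i hi j k hjk => by_contra fun hne => hi j k hne hjk

/-- The variation of a family of points, as a function of the derivation. -/
def variation (U : Ultrafilter I) (z : I → C.Point) :
    Module.Dual (Ultrapower U) (Derivation ℂ (Ultrapower U) (Ultrapower U)) where
  toFun δ := δ (starVal U z C.x)
  map_add' _ _ := rfl
  map_smul' _ _ := rfl

theorem variation_apply (z : I → C.Point) (δ : Derivation ℂ (Ultrapower U) (Ultrapower U)) :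
    variation U z δ = δ (starVal U z C.x) := rfl

theorem IsDual.linearIndependent {ι : Type} [DecidableEq ι] {p : ι → I → C.Point}
    {δ : ι → Derivation ℂ (Ultrapower U) (Ultrapower U)} (hδ : IsDual p δ) :
    LinearIndependent (Ultrapower U) fun j => variation U (p j) := by
  refine linearIndependent_iff'.2 fun s a ha k hk => ?_
  have h := LinearMap.congr_fun ha (δ k)
  rw [LinearMap.sum_apply, Finset.sum_eq_single k] at h
  · simpa [variation_apply, hδ k k] using h
  · intro j _ hj
    rw [LinearMap.smul_apply, variation_apply, hδ, if_neg hj, smul_zero]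
  · exact fun h => absurd hk h

theorem exists_isDual_of_linearIndependent {ι : Type} [Finite ι] [DecidableEq ι]
    {p : ι → I → C.Point} (hp : LinearIndependent (Ultrapower U) fun j => variation U (p j)) :
    ∃ δ : ι → Derivation ℂ (Ultrapower U) (Ultrapower U), IsDual p δ := by
  have h : ∀ k, ∃ δ : Derivation ℂ (Ultrapower U) (Ultrapower U),
      ∀ j, δ (starVal U (p j) C.x) = if j = k then 1 else 0 := fun k => by
    have h1 : ¬ (⨅ j : {j // j ≠ k}, LinearMap.ker (variation U (p j))) ≤
        LinearMap.ker (variation U (p k)) := fun hle => by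
      have h2 := mem_span_of_iInf_ker_le_ker hle
      refine (linearIndependent_iff_notMem_span.1 hp) k (Submodule.span_mono ?_ h2)
      rintro _ ⟨j, rfl⟩
      exact ⟨j, ⟨Set.mem_univ _, fun h => j.2 h⟩, rfl⟩
    obtain ⟨d, hd, hdk⟩ := SetLike.not_le_iff_exists.1 h1
    rw [Submodule.mem_iInf] at hd
    rw [LinearMap.mem_ker, variation_apply] at hdk
    refine ⟨(d (starVal U (p k) C.x))⁻¹ • d, fun j => ?_⟩
    rw [Derivation.smul_apply, smul_eq_mul]
    split_ifs with hj
    · rw [hj, inv_mul_cancel₀ hdk]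
    · have := hd ⟨j, hj⟩
      rw [LinearMap.mem_ker, variation_apply] at this
      rw [this, mul_zero]
  choose δ hδ using h
  exact ⟨δ, fun j k => hδ k j⟩

end Curve

namespace Curve
open Ultrapower
variable {C : Curve} {I : Type} {U : Ultrafilter I}

/-- A family of points on which all the others depend contains, up to two points, as many
independently moving points. -/
theorem IsDual.exists_isDual_of_forall {ι : Type} [Fintype ι] [DecidableEq ι] {p : ι → I → C.Point}
    {δ : ι → Derivation ℂ (Ultrapower U) (Ultrapower U)} (hδ : IsDual p δ) {m : ℕ}
    {z : Fin m → I → C.Point} {x y : I → C.Point}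
    (h : ∀ d : Derivation ℂ (Ultrapower U) (Ultrapower U), (∀ l, d (starVal U (z l) C.x) = 0) →
      d (starVal U x C.x) = 0 → d (starVal U y C.x) = 0 → ∀ j, d (starVal U (p j) C.x) = 0) {n : ℕ}
    (hn : n + 2 ≤ Fintype.card ι) :
    ∃ e : Fin n → Fin m, Injective e ∧
      ∃ ε : Fin n → Derivation ℂ (Ultrapower U) (Ultrapower U), IsDual (z ∘ e) ε := by
  let L : Fin m ⊕ Fin 2 → Module.Dual (Ultrapower U) (Derivation ℂ (Ultrapower U) (Ultrapower U)) :=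
    Sum.elim (fun l => variation U (z l)) ![variation U x, variation U y]
  let S : Set (Module.Dual (Ultrapower U) (Derivation ℂ (Ultrapower U) (Ultrapower U))) :=
    Set.range fun l => variation U (z l)
  let T : Set (Module.Dual (Ultrapower U) (Derivation ℂ (Ultrapower U) (Ultrapower U))) :=
    Set.range ![variation U x, variation U y]
  have hle : Submodule.span (Ultrapower U) (Set.range fun j => variation U (p j)) ≤
      Submodule.span (Ultrapower U) S ⊔ Submodule.span (Ultrapower U) T := by
    rw [← Submodule.span_union, Submodule.span_le]
    rintro _ ⟨j, rfl⟩
    rw [← Set.Sum.elim_range]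
    refine mem_span_of_iInf_ker_le_ker (L := L) fun d hd => ?_
    rw [Submodule.mem_iInf] at hd
    exact h d (fun l => hd (Sum.inl l)) (hd (Sum.inr 0)) (hd (Sum.inr 1)) j
  have hfS : FiniteDimensional (Ultrapower U) (Submodule.span (Ultrapower U) S) :=
    FiniteDimensional.span_of_finite _ (Set.finite_range _)
  have hfT : FiniteDimensional (Ultrapower U) (Submodule.span (Ultrapower U) T) :=
    FiniteDimensional.span_of_finite _ (Set.finite_range _)
  have h1 := Submodule.finrank_mono hle
  have h2 := Submodule.finrank_add_le_finrank_add_finrank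
    (Submodule.span (Ultrapower U) S) (Submodule.span (Ultrapower U) T)
  have h3 : Module.finrank (Ultrapower U) (Submodule.span (Ultrapower U) T) ≤ 2 :=
    finrank_range_le_card (R := Ultrapower U) ![variation U x, variation U y]
  rw [finrank_span_eq_card hδ.linearIndependent] at h1
  obtain ⟨f, hf, -, hf'⟩ := Submodule.exists_fun_fin_finrank_span_eq (Ultrapower U) S
  choose e he using hf
  have hr : n ≤ Module.finrank (Ultrapower U) (Submodule.span (Ultrapower U) S) := by omega
  have he' : Injective e := fun a b hab => hf'.injective (by rw [← he a, ← he b, hab])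
  refine ⟨e ∘ Fin.castLE hr, he'.comp (Fin.castLE_injective hr),
    exists_isDual_of_linearIndependent ?_⟩
  have hcomp : (fun k => variation U ((z ∘ e ∘ Fin.castLE hr) k)) = f ∘ Fin.castLE hr :=
    funext fun k => he _
  rw [hcomp]
  exact hf'.comp _ (Fin.castLE_injective hr)

theorem ptSum_coe {ι : Type} (p : ι → I → C.Point) (B : Finset ι) (i : I) :
    ptSum (fun j : B => p j) Finset.univ i = ptSum p B i :=
  Finset.sum_coe_sort B fun j => C.pt (p j i)

/-- If `Z + N` is a canonical divisor containing the points `p` and `t`, and `Z + x + y` is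
contained in no other canonical divisor, then all the points `p` depend on `Z`, `x` and `y`. -/
theorem forall_derivation_eq_zero {κ : Type} {p : κ → I → C.Point} {t : I → C.Point} {m : ℕ}
    {z : Fin m → I → C.Point} {x y : I → C.Point} {c : I → Fin C.genus → ℂ}
    (hc0 : ∀ᶠ i in U, C.sec (c i) ≠ 0)
    (ht : ∀ᶠ i in U, C.pt (t i) ≤ ptSum z Finset.univ i)
    (h1 : ∀ᶠ i in U, C.h0 (C.K - (ptSum z Finset.univ i + (C.pt (x i) + C.pt (y i)))) = 1)
    (hc : ∀ᶠ i in U, C.sec (c i) ∈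
      C.H0 (C.K - (ptSum z Finset.univ i + (C.pt (x i) + C.pt (y i)))))
    (hp : ∀ᶠ i in U, ∀ j, C.sec (c i) ∈ C.H0 (C.K - C.pt (p j i)))
    {d : Derivation ℂ (Ultrapower U) (Ultrapower U)} (hz : ∀ l, d (starVal U (z l) C.x) = 0)
    (hx : d (starVal U x C.x) = 0) (hy : d (starVal U y C.x) = 0) :
    (∀ j, d (starVal U (p j) C.x) = 0) ∧ d (starVal U t C.x) = 0 := by
  have hxy : ∀ i, 0 ≤ C.pt (x i) + C.pt (y i) := fun i => add_nonneg (pt_nonneg _) (pt_nonneg _)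
  have hZ0 : ∀ i, 0 ≤ ptSum z Finset.univ i + (C.pt (x i) + C.pt (y i)) := fun i =>
    add_nonneg (ptSum_nonneg _ _ _) (hxy i)
  have hh : vmk U c ∈ starVan U fun i => ptSum z Finset.univ i + (C.pt (x i) + C.pt (y i)) :=
    vmk_mem_sub hc
  have hh0 : vmk U c ≠ 0 := fun h => by
    obtain ⟨i, h2, h3, h4⟩ :=
      (hc0.and ((vrep_vmk (U := U) c).and (vrep_zero (J := Fin C.genus)))).exists
    rw [h, h4] at h3
    exact h2 (by rw [← h3, map_zero])
  have hd := derivation_mem_starVan (δ := d) (T := Set.range z ∪ {x, y})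
    ((Set.finite_range z).union (Set.toFinite _)) (.of_forall fun i P hP => ?_) (.of_forall hZ0)
    (M := m + 2) (.of_forall fun i => ?_) (.of_forall fun i => le_refl _) ?_ hh
  · obtain ⟨β, hβ⟩ := (finrank_eq_one_iff_of_nonzero' (⟨_, hh⟩ : starVan U _)
      (fun h => hh0 (congrArg Subtype.val h))).1 (finrank_starVan (.of_forall hZ0) h1) ⟨_, hd⟩
    have hβ' : ∀ j, d (vmk U c j) = β * vmk U c j := fun j =>
      (congrFun (congrArg Subtype.val hβ) j).symm
    refine ⟨fun j => ?_, ?_⟩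
    · by_contra hne
      have h2 : vmk U c ∈ starVan U fun i => C.pt (p j i) :=
        vmk_mem_sub (hp.mono fun i hi => hi j)
      exact hh0 (eq_zero_of_derivation_eq_smul hne hβ' (vanAt_of_mem_starVan h2
        (.of_forall fun i => by rw [pt_self]; rfl)))
    · by_contra hne
      refine hh0 (eq_zero_of_derivation_eq_smul hne hβ' (vanAt_of_mem_starVan hh ?_))
      filter_upwards [ht] with i hi
      exact (pt_le_iff (hZ0 i)).1 (hi.trans (le_add_of_nonneg_right (hxy i)))
  · by_contra! hcon
    refine hP ?_
    have h2 : ptSum z Finset.univ i P = 0 := by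
      by_contra h2
      obtain ⟨l, -, hl⟩ := exists_of_ptSum_ne_zero h2
      exact hcon _ (Or.inl ⟨l, rfl⟩) hl
    rw [Finsupp.add_apply, Finsupp.add_apply, h2, pt_ne (hcon x (Or.inr (Or.inl rfl))),
      pt_ne (hcon y (Or.inr (Or.inr rfl)))]
    rfl
  · simp [deg_add]
  · rintro w (⟨l, rfl⟩ | rfl | rfl) hw
    · exact absurd (hz l) hw
    · exact absurd hx hw
    · exact absurd hy hw

theorem exists_of_finite_tetragonal [IsGeneral C] (hg : 6 ≤ C.genus) {S : Finset C.Div}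
    (hS : ∀ A, C.IsTetragonal A → ∃ B ∈ S, C.LinEquiv A B) :
    ∃ D : C.Div, C.deg D = (C.genus : ℤ) - 1 ∧ C.IsBPFPencil D ∧ C.IsBPFPencil (C.K - D) := by
  by_contra! hcon
  obtain ⟨U, p, δ, hδ⟩ := exists_isDual C (Option (Fin (C.genus - 3)))
  have hδ' := hδ.comp (Option.some_injective (Fin (C.genus - 3)))
  have hκ : Fintype.card (Fin (C.genus - 3)) = C.genus - 3 := Fintype.card_fin _
  have hR1 := hδ'.eventually_h0_add_pt (by omega)
  have hR2 : ∀ᶠ i in U, ∀ k q r, C.h0 (ptSum (p ∘ some) (Finset.univ.erase k) i +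
      (C.pt q + C.pt r)) ≤ 1 := Filter.eventually_all.2 fun k => by
    have h := (hδ'.comp (κ := (Finset.univ.erase k : Finset (Fin (C.genus - 3))))
      Subtype.val_injective).eventually_h0_add_pt_add_pt hS (by
        rw [Fintype.card_coe, Finset.card_erase_of_mem (Finset.mem_univ k), Finset.card_univ]
        omega)
    filter_upwards [h] with i hi
    rw [← ptSum_coe]
    exact hi
  have hex : ∀ᶠ i in U, ∃ w : (Fin C.genus → ℂ) × (Fin (C.genus - 2) → C.Point) ×
      Fin (C.genus - 3) × Fin (C.genus - 3), C.sec w.1 ≠ 0 ∧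
      C.pt (p none i) ≤ ∑ l, C.pt (w.2.1 l) ∧ C.h0 (∑ l, C.pt (w.2.1 l)) = 2 ∧
      C.h0 (C.K - (∑ l, C.pt (w.2.1 l) + (C.pt (p (some w.2.2.1) i) + C.pt (p (some w.2.2.2) i)))) =
        1 ∧ C.sec w.1 ∈ C.H0 (C.K - (∑ l, C.pt (w.2.1 l) +
        (C.pt (p (some w.2.2.1) i) + C.pt (p (some w.2.2.2) i)))) ∧
      ∀ j, C.sec w.1 ∈ C.H0 (C.K - C.pt (p (some j) i)) := by
    filter_upwards [hR1, hR2, hδ'.eventually_injective] with i h1 h2 h3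
    obtain ⟨q, r, hd, hD, hK⟩ := exists_pencil (σ := fun j => p (some j) i) (by omega) h1 h2
    obtain ⟨f, Z, a, b, hf0, hZ0, ht, hZd, hZ2, hZ1, hf, hf'⟩ :=
      exists_residual h3 hd hK (hcon _ hd hD) (p none i)
    obtain ⟨z, rfl⟩ := exists_eq_sum_pt (m := C.genus - 2) hZ0 (by rw [hZd]; omega)
    obtain ⟨c, rfl⟩ := exists_sec (C.H0_mono (sub_pt_le _ _) (hf' a))
    exact ⟨(c, z, a, b), hf0, ht, hZ2, hZ1, hf, hf'⟩
  obtain ⟨w, hw⟩ := hex.choice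
  obtain ⟨⟨a, b⟩, -, hab⟩ := Ultrafilter.eventually_eq_const (U := U) Set.univ Set.finite_univ
    (f := fun i => (w i).2.2) (.of_forall fun i => Set.mem_univ _)
  replace hw := hw.and hab
  obtain ⟨e, he, ε, hε⟩ := hδ.exists_isDual_of_forall (z := fun l i => (w i).2.1 l)
    (x := p (some a)) (y := p (some b)) (n := C.genus - 4)
    (fun d hz hx hy => by
      have h := forall_derivation_eq_zero (p := p ∘ some) (t := p none) (c := fun i => (w i).1)
        (hw.mono fun i hi => hi.1.1)
        (hw.mono fun i hi => hi.1.2.1)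
        (hw.mono fun i hi => by have := hi.1.2.2.2.1; rw [hi.2] at this; exact this)
        (hw.mono fun i hi => by have := hi.1.2.2.2.2.1; rw [hi.2] at this; exact this)
        (hw.mono fun i hi => hi.1.2.2.2.2.2) hz hx hy
      exact fun j => j.casesOn h.2 h.1)
    (by rw [Fintype.card_option]; omega)
  have hR := hε.eventually_h0_add_pt_add_pt hS (by rw [Fintype.card_fin]; omega)
  obtain ⟨i, hi, hi'⟩ := (hR.and hw).exists
  have hcard : (Finset.univ.map ⟨e, he⟩)ᶜ.card = 2 := by
    rw [Finset.card_compl, Finset.card_map, Finset.card_univ, Fintype.card_fin, Fintype.card_fin]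
    omega
  obtain ⟨k, l, hkl, hkl'⟩ := Finset.card_eq_two.1 hcard
  have h2 := hi ((w i).2.1 k) ((w i).2.1 l)
  rw [ptSum_comp he, ptSum, ← Finset.sum_pair (f := fun l => C.pt ((w i).2.1 l)) hkl, ← hkl',
    Finset.sum_add_sum_compl, hi'.1.2.2.1] at h2
  omega

end Curve

namespace Curve

variable {C : Curve}

theorem divOfFinset_cons {z : C.Point} {τ : Finset C.Point} (hz : z ∉ τ) :
    C.divOfFinset (Finset.cons z τ hz) = C.divOfFinset τ + C.pt z := by
  rw [PreCurve.divOfFinset, Finset.sum_cons, add_comm]; rfl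

theorem deg_divOfFinset (τ : Finset C.Point) : C.deg (C.divOfFinset τ) = τ.card := by
  rw [PreCurve.divOfFinset, deg_sum]; simp

theorem eq_of_linEquiv_of_h0_le_one {D E : C.Div} (hD : 0 ≤ D) (hE : 0 ≤ E)
    (h : C.LinEquiv D E) (h1 : C.h0 E ≤ 1) : D = E := by
  obtain ⟨f, hf, hfe⟩ := h
  have hfE : f ∈ C.H0 E := by rw [mem_H0_effective hf, ← hfe]; simpa using hD
  obtain ⟨c, hc⟩ := exists_smul_of_h0_le_one h1 (one_mem_H0_iff.2 hE) one_ne_zero hfE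
  have hc0 : c ≠ 0 := by rintro rfl; exact hf (by simpa using hc)
  rw [hc, divOf_smul hc0 one_ne_zero, divOf_one] at hfe
  exact sub_eq_zero.1 hfe

section Exceptional

variable [IsExceptional C]

theorem finite_pr_linEquiv (G : C.Div) : {z | C.LinEquiv (C.pr z) G}.Finite := by
  rcases Set.eq_empty_or_nonempty {z | C.LinEquiv (C.pr z) G} with h | ⟨w, hw⟩
  · rw [h]; exact Set.finite_empty
  · refine (Set.toFinite {w, C.conj w}).subset fun z hz => ?_
    have h := eq_of_pr_linEquiv (PreCurve.LinEquiv.trans hz (PreCurve.LinEquiv.symm hw))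
    by_contra hne
    simp only [Set.mem_insert_iff, Set.mem_singleton_iff, not_or] at hne
    have h1 := pr_apply_eq_zero (z := w) (y := z) (Ne.symm hne.1) (Ne.symm hne.2)
    have h2 := pt_le_pr z
    rw [pt_le_iff (pr_nonneg z), h, h1] at h2
    omega

theorem finite_two_nsmul_pr_linEquiv (G : C.Div) :
    {z | C.LinEquiv (C.pr z + C.pr z) G}.Finite := by
  rcases Set.eq_empty_or_nonempty {z | C.LinEquiv (C.pr z + C.pr z) G} with h | ⟨w, hw⟩
  · rw [h]; exact Set.finite_empty
  obtain ⟨W, hW⟩ : ∃ W, W = C.pr w + C.pr w := ⟨_, rfl⟩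
  have hW0 : 0 ≤ W := by rw [hW]; exact add_nonneg (pr_nonneg w) (pr_nonneg w)
  have hWd : C.deg W = 4 := by rw [hW]; simp [deg_pr]
  have hz2 : ∀ z, 2 ≤ (C.pr z + C.pr z) z := fun z => by
    have h2 := (pt_le_iff (pr_nonneg z)).1 (pt_le_pr z)
    rw [Finsupp.add_apply]; omega
  have hlin : ∀ z ∈ {z | C.LinEquiv (C.pr z + C.pr z) G}, C.LinEquiv (C.pr z + C.pr z) W :=
    fun z hz => by rw [hW]; exact PreCurve.LinEquiv.trans hz (PreCurve.LinEquiv.symm hw)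
  rcases Nat.lt_or_ge 1 (C.h0 W) with h2 | h1
  · have hb : C.IsBPFPencil W := isBPFPencil_of_deg_eq_four hWd h2
    obtain ⟨t, ht, ht1, hspan⟩ := exists_of_h0_eq_two hb.2 (one_mem_H0_iff.2 hW0) one_ne_zero
    have hram := finite_ramified (f := t) fun c hc => ht1 c (by
      rw [hc, Algebra.algebraMap_eq_smul_one])
    refine (hram.union W.support.finite_toSet).subset fun z hz => ?_
    by_contra hzn
    simp only [Set.mem_union, Set.mem_ofPred_eq, not_or, Finset.mem_coe, Finsupp.mem_support_iff,
      not_not] at hzn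
    obtain ⟨⟨ht0, hram⟩, hWz⟩ := hzn
    obtain ⟨f, hf, hfe⟩ := hlin z hz
    have hfW : f ∈ C.H0 W := by
      rw [mem_H0_effective hf, ← hfe]
      simpa using add_nonneg (pr_nonneg z) (pr_nonneg z)
    have hfz : f ∈ C.V z 2 := by
      rw [mem_V_iff hf, ← divOf_apply hf, ← hfe, Finsupp.sub_apply, hWz, sub_zero]
      exact hz2 z
    obtain ⟨a, b, hab⟩ := hspan f hfW
    have hb0 : b ≠ 0 := by
      rintro rfl
      rw [zero_smul, add_zero] at hab
      have ha : a ≠ 0 := by rintro rfl; exact hf (by simpa using hab)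
      have := (C.V z 2).smul_mem a⁻¹ hfz
      rw [hab, smul_smul, inv_mul_cancel₀ ha, one_smul] at this
      exact one_notMem_V z (by norm_num) this
    have hmem : t - algebraMap ℂ C.F (-(b⁻¹ * a)) ∈ C.V z 2 := by
      have := (C.V z 2).smul_mem b⁻¹ hfz
      rw [hab, smul_add, smul_smul, smul_smul, inv_mul_cancel₀ hb0, one_smul] at this
      convert this using 1
      rw [Algebra.algebraMap_eq_smul_one, neg_smul]; abel
    have hval := val_eq (V_anti z (by norm_num : (1 : ℤ) ≤ 2) hmem)
    exact hram (by rw [hval]; exact hmem)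
  · refine W.support.finite_toSet.subset fun z hz => ?_
    have h := eq_of_linEquiv_of_h0_le_one (add_nonneg (pr_nonneg z) (pr_nonneg z)) hW0
      (hlin z hz) h1
    have := hz2 z
    rw [h] at this
    rw [Finset.mem_coe, Finsupp.mem_support_iff]; omega

/-- No two distinct points of the set are conjugate to each other. -/
def Separated (τ : Finset C.Point) : Prop := ∀ a ∈ τ, ∀ b ∈ τ, a ≠ b → a ≠ C.conj b

theorem Separated.exists_cons {τ : Finset C.Point} (hτ : Separated τ) {S : Set C.Point}
    (hS : S.Finite) : ∃ z, ∃ hz : z ∉ τ, z ∉ S ∧ Separated (Finset.cons z τ hz) := by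
  obtain ⟨z, hz⟩ := exists_notMem_finite
    ((hS.union τ.finite_toSet).union (τ.finite_toSet.image C.conj))
  simp only [Set.mem_union, Finset.mem_coe, Set.mem_image, not_or, not_exists, not_and] at hz
  obtain ⟨⟨hzS, hzτ⟩, hzc⟩ := hz
  refine ⟨z, hzτ, hzS, fun a ha b hb hab => ?_⟩
  rw [Finset.mem_cons] at ha hb
  rcases ha with rfl | ha <;> rcases hb with rfl | hb
  · exact absurd rfl hab
  · exact fun h => hzc b hb h.symm
  · exact fun h => hzc a ha (by rw [h, conj_conj])
  · exact hτ a ha b hb hab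

theorem exists_separated (n : ℕ) : ∃ τ : Finset C.Point, τ.card = n ∧ Separated τ := by
  induction n with
  | zero => exact ⟨∅, rfl, fun a ha => by simp at ha⟩
  | succ n ih =>
    obtain ⟨τ, hn, hτ⟩ := ih
    obtain ⟨z, hz, -, h⟩ := hτ.exists_cons Set.finite_empty
    exact ⟨_, by rw [Finset.card_cons, hn], h⟩

theorem exists_separated_of_linEquiv (n : ℕ) (G : C.Div) : ∃ τ : Finset C.Point, τ.card = n + 1 ∧
    Separated τ ∧ ∀ a ∈ τ, ∀ b ∈ τ, a ≠ b →
      ¬ C.LinEquiv (G - C.bar (C.divOfFinset τ)) (C.pr a + C.pr b) := by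
  obtain ⟨τ, hn, hτ⟩ := exists_separated (C := C) n
  obtain ⟨H, hH⟩ : ∃ H, H = G - C.bar (C.divOfFinset τ) := ⟨_, rfl⟩
  have hS₁ : (⋃ a ∈ τ, ⋃ b ∈ τ, {z | C.LinEquiv (C.pr z) (H - (C.pr a + C.pr b))}).Finite :=
    Set.Finite.biUnion τ.finite_toSet fun a _ => Set.Finite.biUnion τ.finite_toSet fun b _ =>
      finite_pr_linEquiv _
  have hS₂ : (⋃ a ∈ τ, {z | C.LinEquiv (C.pr z + C.pr z) (H - C.pr a)}).Finite :=
    Set.Finite.biUnion τ.finite_toSet fun a _ => finite_two_nsmul_pr_linEquiv _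
  obtain ⟨z, hz, hzS, h⟩ := hτ.exists_cons (hS₁.union hS₂)
  simp only [Set.mem_union, Set.mem_iUnion, Set.mem_ofPred_eq, not_or, not_exists] at hzS
  have hlast : ∀ a ∈ τ, ¬ C.LinEquiv (H - C.pr z) (C.pr a + C.pr z) := fun a ha hl =>
    hzS.2 a ha (hl.symm.of_sub (by abel))
  refine ⟨_, by rw [Finset.card_cons, hn], h, fun a ha b hb hab => ?_⟩
  rw [divOfFinset_cons, map_add, bar_pt, ← sub_sub, ← hH]
  rw [Finset.mem_cons] at ha hb
  rcases ha with rfl | ha <;> rcases hb with rfl | hb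
  · exact absurd rfl hab
  · rw [add_comm]; exact hlast b hb
  · exact hlast a ha
  · exact fun hl => hzS.1 a ha b hb (hl.symm.of_sub (by abel))

end Exceptional

end Curve

namespace Curve

variable {C : Curve}

theorem divOfFinset_apply_of_mem {τ : Finset C.Point} {P : C.Point} (h : P ∈ τ) :
    C.divOfFinset τ P = 1 := by
  classical
  rw [PreCurve.divOfFinset, Finsupp.finsetSum_apply]
  simp [pt_apply, h]

theorem divOfFinset_apply_of_notMem {τ : Finset C.Point} {P : C.Point} (h : P ∉ τ) :
    C.divOfFinset τ P = 0 := by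
  classical
  rw [PreCurve.divOfFinset, Finsupp.finsetSum_apply]
  simp [pt_apply, h]

theorem divOfFinset_nonneg (τ : Finset C.Point) : 0 ≤ C.divOfFinset τ :=
  Finset.sum_nonneg fun _ _ => pt_nonneg _

theorem IsBPFPencil.congr {D E : C.Div} (h : C.IsBPFPencil D)
    (hDE : C.LinEquiv E D) : C.IsBPFPencil E :=
  ⟨fun P => by rw [(hDE.sub (PreCurve.LinEquiv.refl (C.pt P))).h0_eq, hDE.h0_eq]; exact h.1 P,
    by rw [hDE.h0_eq]; exact h.2⟩

section Exceptional

variable [IsExceptional C]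

theorem conjDiv_conjDiv (D : C.Div) : C.conjDiv (C.conjDiv D) = D := by
  ext z; rw [conjDiv_apply, conjDiv_apply, conj_conj]

theorem conjDiv_pr (z : C.Point) : C.conjDiv (C.pr z) = C.pr z := by
  rw [pr, map_add, conjDiv_pt, conjDiv_pt, conj_conj, add_comm]

theorem PairFree.conjDiv {D : C.Div} (h : C.PairFree D) : C.PairFree (C.conjDiv D) := fun z hz => by
  refine h z ?_
  have := conjDiv_nonneg (sub_nonneg.2 hz)
  rw [map_sub, conjDiv_conjDiv, conjDiv_pr] at this
  exact sub_nonneg.1 this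

theorem IsTetragonal.mem_H0_sub_pr {A : C.Div} (hA : C.IsTetragonal A) {s : C.F} {z : C.Point}
    (hs : s ∈ C.H0 (A - C.pt z)) : s ∈ C.H0 (A - C.pr z) := by
  obtain ⟨t, ht, ht0⟩ := h0_pos_iff.1 (hA.h0_sub_pr_pos z)
  have hle : A - C.pr z ≤ A - C.pt z := sub_le_sub_left (pt_le_pr z) A
  obtain ⟨c, rfl⟩ := exists_smul_of_h0_le_one (hA.isBPFPencil.h0_sub_pt z).le
    (C.H0_mono hle ht) ht0 hs
  exact (C.H0 _).smul_mem c ht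

theorem IsTetragonal.isEven_add {A A' : C.Div} (hA : C.IsTetragonal A) (hA' : C.IsTetragonal A')
    (hne : ¬ C.LinEquiv A A') : C.IsEven 4 (A + A') where
  deg := by simp [hA.1, hA'.1]
  h0 := hA.h0_add hA' IsExceptional.six_le_genus hne
  finite := by
    refine Set.finite_empty.subset fun x hx => ?_
    have := hA.three_le_h0_add_sub_pr hA' hne x
    rw [Set.mem_ofPred_eq] at hx
    omega

/-- A member of a tetragonal pencil containing `q` and `r` contains both pairs. -/
theorem IsTetragonal.linEquiv_pr_add_pr {A : C.Div} (hA : C.IsTetragonal A) {s : C.F} (hs0 : s ≠ 0)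
    {q r : C.Point} (hqr : r ≠ C.conj q) (hs : s ∈ C.H0 (A - C.pt q - C.pt r)) :
    C.LinEquiv A (C.pr q + C.pr r) := by
  have hsq : s ∈ C.H0 (A - C.pt q) := C.H0_mono (sub_pt_le _ _) hs
  have hsr : s ∈ C.H0 (A - C.pt r) := by
    rw [sub_right_comm] at hs
    exact C.H0_mono (sub_pt_le _ _) hs
  have hmem : s ∈ C.H0 (A - (C.pr q + C.pr r)) := by
    by_cases hne : r = q
    · subst hne
      obtain ⟨A', hA', hAA'⟩ := exists_tetragonal_not_linEquiv A
      have h3 := (hA.isEven_add hA' hAA').sub_pr (k := 2) IsExceptional.six_le_genus r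
      have h2 := h3.sub_pr (k := 1) (by have := IsExceptional.six_le_genus (C := C); omega) r
      have hd : C.deg (A + A' - C.pr r - C.pt r) = 5 := by
        rw [deg_sub, h3.deg]; simp
      have heq := H0_eq_of_le (sub_le_sub_left (pt_le_pr r) (A + A' - C.pr r))
        (by rw [h2.h0]; exact h0_le_two hd.le)
      have h1 : s ∈ C.H0 (A - (C.pr r + C.pt r)) := by
        rw [sub_sub] at hs
        refine mem_H0_sub_of_le_max hs (hA.mem_H0_sub_pr hsq) fun P => ?_
        classical
        simp only [pr, Finsupp.add_apply, pt_apply]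
        split_ifs <;> simp_all
      obtain ⟨g, hg, hg'⟩ := exists_notMem_of_h0_lt (D' := A' - C.pt (C.conj r)) (D := A')
        (by rw [hA'.isBPFPencil.h0_sub_pt, hA'.isBPFPencil.2]; norm_num)
      by_contra hcon
      refine mul_notMem_H0_sub_pt (z := C.conj r) h1
        (fun h => hcon (by convert h using 2; rw [pr]; abel)) hg hg' ?_
      have hsg : s * g ∈ C.H0 (A + A' - C.pr r - C.pt r) := by
        convert C.mul_mem_H0 h1 hg using 2; abel
      rw [← heq] at hsg
      convert hsg using 2
      rw [pr]; abel
    · exact mem_H0_sub_add (hA.mem_H0_sub_pr hsq) (hA.mem_H0_sub_pr hsr) (pr_nonneg q)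
        (pr_nonneg r) (pr_disjoint hne hqr)
  refine (linEquiv_zero_of_deg (h0_pos_iff.2 ⟨s, hmem, hs0⟩) ?_).of_sub (by abel)
  simp [deg_pr, hA.1]

end Exceptional

end Curve

namespace Curve

variable {C : Curve}

section Exceptional

variable [IsExceptional C]

theorem Separated.pairFree_add {τ : Finset C.Point} (hτ : Separated τ) {q r : C.Point}
    (hq : q ∉ τ) (hr : r ∉ τ) (hqr : r ≠ C.conj q) :
    C.PairFree (C.conjDiv (C.divOfFinset τ) + C.pt q + C.pt r) := by
  classical
  intro z hz
  have h1 := hz z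
  have h2 := hz (C.conj z)
  have hrq : q ≠ C.conj r := fun h => hqr (by rw [h, conj_conj])
  have hqc : q = C.conj z → C.conj q = z := fun h => by rw [h, conj_conj]
  have hrc : r = C.conj z → C.conj r = z := fun h => by rw [h, conj_conj]
  have hv : ∀ P, C.divOfFinset τ P = if P ∈ τ then 1 else 0 := fun P => by
    split_ifs with h
    · exact divOfFinset_apply_of_mem h
    · exact divOfFinset_apply_of_notMem h
  simp only [pr, Finsupp.add_apply, conjDiv_apply, conj_conj, pt_apply, hv, if_true] at h1 h2
  by_cases hzc : C.conj z = z
  · rw [hzc] at h1 h2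
    by_cases hzτ : z ∈ τ
    · have h3 : q ≠ z := fun h => hq (h ▸ hzτ)
      have h4 : r ≠ z := fun h => hr (h ▸ hzτ)
      simp [hzτ, h3, h4] at h1
    · by_cases h3 : q = z
      · have h4 : r ≠ z := fun h => hqr (by rw [h3, hzc, h])
        simp [hzτ, h3, h4] at h1
      · by_cases h4 : r = z <;> simp [hzτ, h3, h4] at h1
  · by_cases hz1 : z ∈ τ
    · by_cases hz2 : C.conj z ∈ τ
      · exact hτ _ hz2 _ hz1 hzc rfl
      · have h3 : q ≠ z := fun h => hq (h ▸ hz1)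
        have h4 : r ≠ z := fun h => hr (h ▸ hz1)
        simp [hz2, h3, h4, hzc] at h1
    · by_cases hz2 : C.conj z ∈ τ
      · have h3 : q ≠ C.conj z := fun h => hq (h ▸ hz2)
        have h4 : r ≠ C.conj z := fun h => hr (h ▸ hz2)
        simp [hz1, h3, h4, Ne.symm hzc] at h2
      · by_cases h3 : q = z
        · have h4 : r ≠ C.conj z := fun h => hqr (by rw [h3, h])
          simp [hz1, h3, h4, Ne.symm hzc] at h2
        · by_cases h4 : r = z
          · have h5 : q ≠ C.conj z := fun h => hrq (by rw [h4, h])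
            simp [hz1, h4, h5, Ne.symm hzc] at h2
          · simp [hz2, h3, h4, hzc] at h1

theorem Separated.pairFree {τ : Finset C.Point} (hτ : Separated τ) :
    C.PairFree (C.conjDiv (C.divOfFinset τ)) := by
  obtain ⟨q, hq⟩ := exists_notMem_finite τ.finite_toSet
  obtain ⟨r, hr⟩ := exists_notMem_finite (τ.finite_toSet.insert (C.conj q))
  rw [Set.mem_insert_iff, not_or] at hr
  refine (hτ.pairFree_add hq hr.2 hr.1).mono ?_
  rw [add_assoc]
  exact le_add_of_nonneg_right (add_nonneg (pt_nonneg _) (pt_nonneg _))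

theorem h0_K_sub_pr_sub {D : C.Div} (hD : 0 ≤ D) (hp : C.PairFree D) (z : C.Point)
    (hdeg : C.deg D + 3 ≤ C.genus) : (C.h0 (C.K - C.pr z - D) : ℤ) = C.genus - 2 - C.deg D := by
  have h := h0_K_sub_bar_sub (pt_nonneg z) hD hp (by rw [deg_pt]; linarith)
  rw [bar_pt] at h
  rw [h, h0_K_sub, h0_pr, deg_pr]
  push_cast; ring

theorem exists_of_isExceptional : ∃ D, C.deg D = (C.genus : ℤ) - 1 ∧ C.IsBPFPencil D ∧
    C.IsBPFPencil (C.K - D) := by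
  have hg := IsExceptional.six_le_genus (C := C)
  obtain ⟨n, hn⟩ : ∃ n, C.genus = n + 4 := ⟨C.genus - 4, by omega⟩
  obtain ⟨τ, hcard, hτ, hlin⟩ := exists_separated_of_linEquiv n C.K
  obtain ⟨X, hX⟩ : ∃ X, X = C.divOfFinset τ := ⟨_, rfl⟩
  obtain ⟨Y, hY⟩ : ∃ Y, Y = C.conjDiv X := ⟨_, rfl⟩
  obtain ⟨A, hAdef⟩ : ∃ A, A = C.K - C.bar X := ⟨_, rfl⟩
  have hX0 : 0 ≤ X := hX ▸ divOfFinset_nonneg τ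
  have hY0 : 0 ≤ Y := hY ▸ conjDiv_nonneg hX0
  have hXd : C.deg X = n + 1 := by rw [hX, deg_divOfFinset, hcard]; push_cast; rfl
  have hYd : C.deg Y = n + 1 := by rw [hY, deg_conjDiv hX0, hXd]
  have hA : C.IsTetragonal A := hAdef ▸ isTetragonal_K_sub_bar hX0 (by rw [hXd, hn]; push_cast; ring)
  have hAX : A + X = C.K - Y := by rw [hAdef, hY, bar_apply]; abel
  have hAY : A ≤ C.K - Y := hAX ▸ le_add_of_nonneg_right hX0
  have hYp : C.PairFree Y := by rw [hY, hX]; exact hτ.pairFree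
  have hKY : C.h0 (C.K - Y) = 3 := by
    have := h0_K_sub Y
    rw [hYp.h0_eq_one hY0 (by rw [hYd, hn]; push_cast; linarith), hYd, hn] at this
    push_cast at this
    omega
  have hKYP : ∀ P ∈ τ, C.H0 A = C.H0 (C.K - Y - C.pt P) := fun P hP => by
    have hXP : C.pt P ≤ X := by
      rw [pt_le_iff hX0, hX, divOfFinset_apply_of_mem hP]
    have hYP : 0 ≤ Y - C.pt (C.conj P) := by
      have := conjDiv_nonneg (sub_nonneg.2 hXP)
      rwa [map_sub, conjDiv_pt, ← hY] at this
    have h := h0_K_sub_pr_sub hYP (hYp.mono (sub_pt_le _ _)) P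
      (by rw [deg_sub, deg_pt, hYd, hn]; push_cast; linarith)
    have hE : C.K - C.pr P - (Y - C.pt (C.conj P)) = C.K - Y - C.pt P := by rw [pr]; abel
    rw [hE, deg_sub, deg_pt, hYd, hn] at h
    push_cast at h
    refine H0_eq_of_le ?_ ?_
    · rw [← hAX, add_sub_assoc]
      exact le_add_of_nonneg_right (sub_nonneg.2 hXP)
    · rw [hA.isBPFPencil.2]; omega
  obtain ⟨u, hu, huA⟩ := exists_notMem_of_h0_lt (D' := A) (D := C.K - Y)
    (by rw [hKY, hA.isBPFPencil.2]; norm_num)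
  obtain ⟨s, hs, hs0, s', hs', q, hq, r, hr, hsqr, c, hu'⟩ : ∃ s ∈ C.H0 A, s ≠ 0 ∧ ∃ s' ∈ C.H0 A,
      ∃ q ∉ τ, ∃ r ∉ τ, s ∈ C.H0 (A - C.pt q - C.pt r) ∧
        ∃ c : ℂ, u - c • s' ∈ C.H0 (C.K - Y - C.pt q - C.pt r) := by
    by_contra hcon
    push Not at hcon
    have h := nodes_le hA.isBPFPencil (m := 4) (by rw [hA.1]; rfl) (by norm_num) τ
      (u := u) (by rwa [← hX, hAX])
      (fun P hP hmem => huA (by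
        rw [hKYP P hP, mem_H0_sub_pt]
        refine ⟨hu, ?_⟩
        have : (C.K - Y) P = A P + 1 := by
          rw [← hAX, Finsupp.add_apply, hX, divOfFinset_apply_of_mem hP]
        rwa [this, neg_add, neg_add_cancel_right]))
      (fun s hs hs0 P hP Q hQ hPQ hmem => hlin P hP Q hQ hPQ (by
        rw [← hX, ← hAdef]
        exact hA.linEquiv_pr_add_pr hs0 (hτ Q hQ P hP (Ne.symm hPQ)) hmem))
      (fun s hs hs0 s' hs' _ q hq r hr hmem c => by
        rw [← hX, hAX]; exact hcon s hs hs0 s' hs' q hq r hr hmem c)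
    rw [hcard, hn] at h
    push_cast at h
    omega
  have hu'A : u - c • s' ∉ C.H0 A := fun h => huA (by
    simpa using (C.H0 A).add_mem h ((C.H0 A).smul_mem c hs'))
  have hqr : r ≠ C.conj q := by
    rintro rfl
    have hE : C.K - Y - C.pt q - C.pt (C.conj q) = C.K - C.pr q - Y := by rw [pr]; abel
    have h := h0_K_sub_pr_sub hY0 hYp q (by rw [hYd, hn]; push_cast; linarith)
    rw [hYd, hn] at h
    push_cast at h
    have hle : A - C.pr q ≤ C.K - C.pr q - Y := by
      rw [sub_right_comm]; exact sub_le_sub_right hAY _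
    have heq := H0_eq_of_le hle (by have := hA.h0_sub_pr_pos q; omega)
    rw [hE, ← heq] at hu'
    exact hu'A (C.H0_mono (sub_le_self A (pr_nonneg q)) hu')
  have hAqr := hA.linEquiv_pr_add_pr hs0 hqr hsqr
  obtain ⟨D, hD⟩ : ∃ D, D = Y + C.pt q + C.pt r := ⟨_, rfl⟩
  have hDp : C.PairFree D := by rw [hD, hY, hX]; exact hτ.pairFree_add hq hr hqr
  have hD0 : 0 ≤ D := hD ▸ add_nonneg (add_nonneg hY0 (pt_nonneg _)) (pt_nonneg _)
  have hDd : C.deg D = C.genus - 1 := by rw [hD, hn]; simp [hYd]; ring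
  have hKD : C.K - D = C.K - Y - C.pt q - C.pt r := by rw [hD]; abel
  have hKD2 : 2 ≤ C.h0 (C.K - D) := by
    have h1 : 0 < C.h0 (A - C.pt q - C.pt r) := h0_pos_iff.2 ⟨s, hsqr, hs0⟩
    have h2 : A - C.pt q - C.pt r ≤ C.K - D := by
      rw [hKD]; exact sub_le_sub_right (sub_le_sub_right hAY _) _
    have h3 := h0_lt_of_notMem h2 (hKD ▸ hu') fun h =>
      hu'A (C.H0_mono ((sub_pt_le _ _).trans (sub_pt_le _ _)) h)
    omega
  have hD2 : 2 ≤ C.h0 D := by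
    have := h0_K_sub D
    rw [hDd] at this
    omega
  have hKDl : C.LinEquiv (C.K - D) (C.conjDiv D) := by
    refine hAqr.of_sub ?_
    rw [hAdef, hD, map_add, map_add, conjDiv_pt, conjDiv_pt, hY, conjDiv_conjDiv, bar_apply, pr, pr]
    abel
  exact ⟨D, hDd, hDp.isBPFPencil hD0 hDd hD2, (hDp.conjDiv.isBPFPencil (conjDiv_nonneg hD0)
    (by rw [deg_conjDiv hD0, hDd]) (by rwa [← hKDl.h0_eq])).congr hKDl⟩

end Exceptional

end Curve

/-!  ### STATEMENT 3

Let `C` be a smooth connected projective complex curve of genus `g` which is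
non-hyperelliptic, non-trigonal, and not a smooth plane quintic.  Then there exists a
divisor `D` of degree `g-1` on `C` such that both `|D|` and `|K(-D)|` are
base-point-free pencils, where `K` is the canonical class. -/
theorem green_lazarsfeld_pencil (C : Curve)
    (hHE : ¬ C.Hyperelliptic) (hTri : ¬ C.Trigonal) (hPQ : ¬ C.IsPlaneQuintic) :
    ∃ D : C.Div, C.deg D = (C.genus : ℤ) - 1 ∧
      C.IsBPFPencil D ∧ C.IsBPFPencil (C.K - D) := by
  have : C.IsGeneral := ⟨hHE, hTri, hPQ⟩
  rcases C.five_le_genus.eq_or_lt with hg | hg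
  · exact Curve.exists_of_genus_eq_five hg.symm
  by_cases h : ∃ S : Finset C.Div, ∀ A, C.IsTetragonal A → ∃ B ∈ S, C.LinEquiv A B
  · obtain ⟨S, hS⟩ := h
    exact Curve.exists_of_finite_tetragonal hg hS
  · push Not at h
    have : C.IsExceptional := ⟨hg, h⟩
    exact Curve.exists_of_isExceptional

end
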